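/- arXiv:2406.16365 — 4 statements merged into one kernel-verified Lean document; each statement's English description precedes it below -/
import Mathlib

section
/- Let d ≥ 3 be a natural number, let b be a real number with 0 < b < 2, let ε > 0, set q = 2(d − b)/(d − 2), and define W_b : ℝ^d → ℝ by W_b(x) = [ε(d−b)(d−2)]^{(d−2)/(4−2b)} / (ε + |x|^{2−b})^{(d−2)/(2−b)}. Then both ∫_{ℝ^d} |∇W_b(x)|² dx and ∫_{ℝ^d} |x|^{−b} W_b(x)^{q} dx are finite and positive, and for every Schwartz function f : ℝ^d → ℂ one has (∫_{ℝ^d} |x|^{−b} |f(x)|^{q} dx)^{1/q} · (∫_{ℝ^d} |∇W_b(x)|² dx)^{1/2} ≤ (∫_{ℝ^d} |x|^{−b} W_b(x)^{q} dx)^{1/q} · (∫_{ℝ^d} |∇f(x)|² dx)^{1/2}. In other words, W_b attains the sharp constant in the Hardy–Sobolev inequality. -/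
open MeasureTheory

section

open Set Filter Topology
open scoped ENNReal NNReal Pointwise

theorem volume_add_volume_le_of_isCompact {A B C : Set ℝ} (hA : IsCompact A) (hB : IsCompact B)
    (hA' : A.Nonempty) (hB' : B.Nonempty) (h : ∀ a ∈ A, ∀ b ∈ B, a + b ∈ C) :
    volume A + volume B ≤ volume C := by
  obtain ⟨a, ha⟩ := hA.exists_isGreatest hA'
  obtain ⟨b, hb⟩ := hB.exists_isLeast hB'
  have h1 : volume ((fun x => x + b) '' A) = volume A := by simp
  have h2 : volume ((fun x => a + x) '' B) = volume B := by simp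
  have hd : AEDisjoint volume ((fun x => x + b) '' A) ((fun x => a + x) '' B) := by
    refine measure_mono_null (t := {a + b}) ?_ (by simp)
    rintro _ ⟨⟨x, hx, rfl⟩, ⟨y, hy, hxy⟩⟩
    have := ha.2 hx
    have := hb.2 hy
    simp only [mem_singleton_iff] at *
    linarith
  have hm : NullMeasurableSet ((fun x => a + x) '' B) volume :=
    (hB.image (by fun_prop)).measurableSet.nullMeasurableSet
  rw [← h1, ← h2, ← measure_union₀ hm hd]
  refine measure_mono (union_subset ?_ ?_)
  · rintro _ ⟨x, hx, rfl⟩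
    exact h x hx b hb.1
  · rintro _ ⟨x, hx, rfl⟩
    exact h a ha.1 x hx

/-- The Brunn–Minkowski inequality on the real line. -/
theorem volume_add_volume_le {A B C : Set ℝ} (hA : MeasurableSet A) (hB : MeasurableSet B)
    (hA' : A.Nonempty) (hB' : B.Nonempty) (h : ∀ a ∈ A, ∀ b ∈ B, a + b ∈ C) :
    volume A + volume B ≤ volume C := by
  obtain ⟨a, ha⟩ := hA'
  obtain ⟨b, hb⟩ := hB'
  rw [hA.measure_eq_iSup_isCompact, hB.measure_eq_iSup_isCompact]
  simp only [iSup_and']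
  refine ENNReal.biSup_add_biSup_le' ⟨∅, by simp⟩ ⟨∅, by simp⟩ ?_
  rintro K ⟨hK, hKc⟩ L ⟨hL, hLc⟩
  calc volume K + volume L ≤ volume (insert a K) + volume (insert b L) := by
        gcongr <;> exact subset_insert _ _
    _ ≤ volume C := volume_add_volume_le_of_isCompact (hKc.insert a) (hLc.insert b)
        (insert_nonempty _ _) (insert_nonempty _ _) fun x hx y hy =>
          h x (insert_subset ha hK hx) y (insert_subset hb hL hy)

theorem volume_combo_le {A B C : Set ℝ} {l : ℝ} (h0 : 0 < l) (h1 : l < 1)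
    (hA : MeasurableSet A) (hB : MeasurableSet B)
    (hA' : A.Nonempty) (hB' : B.Nonempty) (h : ∀ a ∈ A, ∀ b ∈ B, l * a + (1 - l) * b ∈ C) :
    ENNReal.ofReal l * volume A + ENNReal.ofReal (1 - l) * volume B ≤ volume C := by
  have h2 : 0 < 1 - l := by linarith
  have e1 : volume (l • A) = ENNReal.ofReal l * volume A := by
    simp [Measure.addHaar_smul, abs_of_pos h0]
  have e2 : volume ((1 - l) • B) = ENNReal.ofReal (1 - l) * volume B := by
    simp [Measure.addHaar_smul, abs_of_pos h2]
  rw [← e1, ← e2]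
  refine volume_add_volume_le (hA.const_smul₀ l) (hB.const_smul₀ _) (hA'.smul_set) hB'.smul_set ?_
  rintro _ ⟨x, hx, rfl⟩ _ ⟨y, hy, rfl⟩
  exact h x hx y hy

theorem ENNReal.lintegral_eq_lintegral_lt {α : Type*} [MeasurableSpace α] (μ : Measure α)
    [SFinite μ] {f : α → ℝ≥0∞} (hf : Measurable f) :
    ∫⁻ x, f x ∂μ = ∫⁻ t in Ioi (0 : ℝ), μ {x | ENNReal.ofReal t < f x} := by
  have hm : MeasurableSet {p : ℝ × α | ENNReal.ofReal p.1 < f p.2} :=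
    measurableSet_lt (by fun_prop) (by fun_prop)
  have : ∀ t : ℝ, μ {x | ENNReal.ofReal t < f x}
      = ∫⁻ x, {p : ℝ × α | ENNReal.ofReal p.1 < f p.2}.indicator 1 (t, x) ∂μ := by
    intro t
    rw [← lintegral_indicator_one (measurableSet_lt measurable_const hf)]
    rfl
  simp_rw [this]
  rw [lintegral_lintegral_swap]
  · refine lintegral_congr fun x => ?_
    have : ∀ t : ℝ, {p : ℝ × α | ENNReal.ofReal p.1 < f p.2}.indicator (1 : ℝ × α → ℝ≥0∞) (t, x)
        = {t : ℝ | ENNReal.ofReal t < f x}.indicator 1 t := fun t => rfl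
    simp_rw [this]
    rw [lintegral_indicator_one (measurableSet_lt (by fun_prop) (by fun_prop)),
      Measure.restrict_apply (measurableSet_lt (by fun_prop) (by fun_prop))]
    rcases eq_or_ne (f x) ∞ with hx | hx
    · simp [hx]
    · have : {t : ℝ | ENNReal.ofReal t < f x} ∩ Ioi 0 = Ioo 0 (f x).toReal := by
        ext t
        simp only [mem_inter_iff, mem_ofPred_eq, mem_Ioi, mem_Ioo]
        constructor
        · rintro ⟨h, h'⟩
          exact ⟨h', (ENNReal.ofReal_lt_iff_lt_toReal h'.le hx).1 h⟩
        · rintro ⟨h, h'⟩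
          exact ⟨(ENNReal.ofReal_lt_iff_lt_toReal h.le hx).2 h', h⟩
      rw [this]; simp [ENNReal.ofReal_toReal hx]
  · exact (measurable_one.indicator hm).aemeasurable

theorem ENNReal.geom_mean_le_arith_mean {l : ℝ} (h0 : 0 < l) (h1 : l < 1) (a b : ℝ≥0∞) :
    a ^ l * b ^ (1 - l) ≤ ENNReal.ofReal l * a + ENNReal.ofReal (1 - l) * b := by
  have h2 : 0 < 1 - l := by linarith
  rcases eq_or_ne a ∞ with rfl | ha
  · simp [ENNReal.mul_top, h0]
  rcases eq_or_ne b ∞ with rfl | hb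
  · simp [ENNReal.mul_top, h1]
  lift a to ℝ≥0 using ha
  lift b to ℝ≥0 using hb
  have := NNReal.geom_mean_le_arith_mean2_weighted l.toNNReal (1 - l).toNNReal a b (by
    rw [← Real.toNNReal_add h0.le h2.le]; simp)
  rw [Real.coe_toNNReal _ h0.le, Real.coe_toNNReal _ h2.le] at this
  rw [← ENNReal.coe_rpow_of_nonneg _ h0.le, ← ENNReal.coe_rpow_of_nonneg _ h2.le]
  change _ ≤ ((l.toNNReal : ℝ≥0) : ℝ≥0∞) * a + (((1 - l).toNNReal : ℝ≥0) : ℝ≥0∞) * b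
  exact_mod_cast this

theorem prekopa_leindler_normalized {f g h : ℝ → ℝ≥0∞} (hf : Measurable f) (hg : Measurable g)
    (hh : Measurable h) {l : ℝ} (h0 : 0 < l) (h1 : l < 1)
    (hfgh : ∀ x y, f x ^ l * g y ^ (1 - l) ≤ h (l * x + (1 - l) * y))
    (hf1 : ⨆ x, f x = 1) (hg1 : ⨆ x, g x = 1) :
    (∫⁻ x, f x) ^ l * (∫⁻ x, g x) ^ (1 - l) ≤ ∫⁻ x, h x := by
  have h2 : 0 < 1 - l := by linarith
  refine (ENNReal.geom_mean_le_arith_mean h0 h1 _ _).trans ?_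
  have key : ∀ {f : ℝ → ℝ≥0∞}, Measurable f → ⨆ x, f x = 1 →
      ∫⁻ x, f x = ∫⁻ t in Ioo (0 : ℝ) 1, volume {x | ENNReal.ofReal t < f x} := by
    intro f hf hf1
    rw [ENNReal.lintegral_eq_lintegral_lt volume hf, ← Ioo_union_Ici_eq_Ioi (zero_lt_one' ℝ),
      lintegral_union measurableSet_Ici (by
        rw [Set.disjoint_left]; intro x hx hx'; exact absurd hx.2 (not_lt.2 hx'))]
    have : ∫⁻ t in Ici (1 : ℝ), volume {x | ENNReal.ofReal t < f x} = 0 := by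
      rw [setLIntegral_congr_fun (g := fun _ => 0) measurableSet_Ici, lintegral_zero]
      intro t ht
      have : {x | ENNReal.ofReal t < f x} = ∅ := by
        ext x
        simp only [mem_ofPred_eq, mem_empty_iff_false, iff_false, not_lt]
        calc f x ≤ 1 := hf1 ▸ le_iSup f x
          _ ≤ _ := by simpa using ht
      simp [this]
    rw [this, add_zero]
  rw [key hf hf1, key hg hg1, ENNReal.lintegral_eq_lintegral_lt volume hh]
  have hmeas : ∀ {f : ℝ → ℝ≥0∞}, Antitone fun t : ℝ => volume {x | ENNReal.ofReal t < f x} :=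
    fun {f} s t hst => measure_mono fun x hx => (ENNReal.ofReal_le_ofReal hst).trans_lt hx
  rw [← lintegral_const_mul _ hmeas.measurable, ← lintegral_const_mul _ hmeas.measurable,
    ← lintegral_add_left (hmeas.measurable.const_mul _)]
  refine (setLIntegral_mono' measurableSet_Ioo ?_).trans
    (lintegral_mono_set (Ioo_subset_Ioi_self))
  intro t ht
  have ht1 : ENNReal.ofReal t < 1 := by simpa using ht.2
  refine volume_combo_le h0 h1 (measurableSet_lt measurable_const hf)
    (measurableSet_lt measurable_const hg) ?_ ?_ ?_
  · exact lt_iSup_iff.1 (hf1 ▸ ht1)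
  · exact lt_iSup_iff.1 (hg1 ▸ ht1)
  · intro x hx y hy
    refine lt_of_lt_of_le ?_ (hfgh x y)
    calc ENNReal.ofReal t = ENNReal.ofReal t ^ l * ENNReal.ofReal t ^ (1 - l) := by
          rw [← ENNReal.rpow_add_of_nonneg _ _ h0.le h2.le]; simp
      _ < _ := ENNReal.mul_lt_mul (ENNReal.rpow_lt_rpow hx h0) (ENNReal.rpow_lt_rpow hy h2)

theorem prekopa_leindler_bounded {f g h : ℝ → ℝ≥0∞} (hf : Measurable f) (hg : Measurable g)
    (hh : Measurable h) {l : ℝ} (h0 : 0 < l) (h1 : l < 1)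
    (hfgh : ∀ x y, f x ^ l * g y ^ (1 - l) ≤ h (l * x + (1 - l) * y))
    (hf1 : ⨆ x, f x ≠ ∞) (hg1 : ⨆ x, g x ≠ ∞) :
    (∫⁻ x, f x) ^ l * (∫⁻ x, g x) ^ (1 - l) ≤ ∫⁻ x, h x := by
  have h2 : 0 < 1 - l := by linarith
  set a := ⨆ x, f x with ha
  set b := ⨆ x, g x with hb
  rcases eq_or_ne a 0 with ha0 | ha0
  · have : ∀ x, f x = 0 := fun x => le_antisymm (ha0 ▸ le_iSup f x) bot_le
    simp [this, h0]
  rcases eq_or_ne b 0 with hb0 | hb0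
  · have : ∀ x, g x = 0 := fun x => le_antisymm (hb0 ▸ le_iSup g x) bot_le
    simp [this, h1]
  have hc : (a⁻¹ ^ l * b⁻¹ ^ (1 - l)) * (a ^ l * b ^ (1 - l)) = 1 := by
    rw [mul_mul_mul_comm, ← ENNReal.mul_rpow_of_nonneg _ _ h0.le,
      ← ENNReal.mul_rpow_of_nonneg _ _ h2.le, ENNReal.inv_mul_cancel ha0 hf1,
      ENNReal.inv_mul_cancel hb0 hg1]; simp
  have := prekopa_leindler_normalized (hf.const_mul a⁻¹) (hg.const_mul b⁻¹)
    (hh.const_mul (a⁻¹ ^ l * b⁻¹ ^ (1 - l))) h0 h1 (fun x y => by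
      rw [ENNReal.mul_rpow_of_nonneg _ _ h0.le, ENNReal.mul_rpow_of_nonneg _ _ h2.le,
        mul_mul_mul_comm]
      gcongr
      exact hfgh x y) (by rw [← ENNReal.mul_iSup, ENNReal.inv_mul_cancel ha0 hf1])
      (by rw [← ENNReal.mul_iSup, ENNReal.inv_mul_cancel hb0 hg1])
  rw [lintegral_const_mul _ hf, lintegral_const_mul _ hg, lintegral_const_mul _ hh,
    ENNReal.mul_rpow_of_nonneg _ _ h0.le, ENNReal.mul_rpow_of_nonneg _ _ h2.le,
    mul_mul_mul_comm] at this
  have h3 : (a⁻¹ ^ l * b⁻¹ ^ (1 - l)) ≠ 0 := left_ne_zero_of_mul_eq_one hc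
  have h4 : (a⁻¹ ^ l * b⁻¹ ^ (1 - l)) ≠ ∞ :=
    ENNReal.mul_ne_top (ENNReal.rpow_ne_top_of_nonneg h0.le (by simpa using ha0))
      (ENNReal.rpow_ne_top_of_nonneg h2.le (by simpa using hb0))
  exact (ENNReal.mul_le_mul_iff_right h3 h4).1 this

theorem lintegral_min_tendsto {α : Type*} [MeasurableSpace α] (μ : Measure α) {f : α → ℝ≥0∞}
    (hf : Measurable f) :
    Tendsto (fun k : ℕ => ∫⁻ x, min (f x) k ∂μ) atTop (𝓝 (∫⁻ x, f x ∂μ)) := by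
  refine lintegral_tendsto_of_tendsto_of_monotone (fun k => by fun_prop) ?_ ?_
  · exact .of_forall fun x i j hij => min_le_min le_rfl (by exact_mod_cast hij)
  · refine .of_forall fun x => ?_
    have : Tendsto (fun k : ℕ => min (f x) (k : ℝ≥0∞)) atTop (𝓝 (min (f x) ∞)) :=
      tendsto_const_nhds.min ENNReal.tendsto_nat_nhds_top
    simpa using this

/-- The Prékopa–Leindler inequality on the real line. -/
theorem prekopa_leindler_real {f g h : ℝ → ℝ≥0∞} (hf : Measurable f) (hg : Measurable g)
    (hh : Measurable h) {l : ℝ} (h0 : 0 < l) (h1 : l < 1)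
    (hfgh : ∀ x y, f x ^ l * g y ^ (1 - l) ≤ h (l * x + (1 - l) * y)) :
    (∫⁻ x, f x) ^ l * (∫⁻ x, g x) ^ (1 - l) ≤ ∫⁻ x, h x := by
  have h2 : 0 < 1 - l := by linarith
  rcases eq_or_ne (∫⁻ x, f x) 0 with hf0 | hf0
  · simp [hf0, h0]
  rcases eq_or_ne (∫⁻ x, g x) 0 with hg0 | hg0
  · simp [hg0, h1]
  have hlim : Tendsto (fun k : ℕ => (∫⁻ x, min (f x) k) ^ l * (∫⁻ x, min (g x) k) ^ (1 - l)) atTop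
      (𝓝 ((∫⁻ x, f x) ^ l * (∫⁻ x, g x) ^ (1 - l))) := by
    refine ENNReal.Tendsto.mul ((lintegral_min_tendsto _ hf).ennrpow_const l) ?_
      ((lintegral_min_tendsto _ hg).ennrpow_const _) ?_
    · left; simp [hf0, h0.le, h0]
    · left; simp [hg0, h1.le, h1]
  refine le_of_tendsto' hlim fun k => ?_
  refine prekopa_leindler_bounded (by fun_prop) (by fun_prop) hh h0 h1 (fun x y => ?_) ?_ ?_
  · refine le_trans ?_ (hfgh x y)
    gcongr
    · exact min_le_left _ _
    · exact min_le_left _ _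
  · exact ne_top_of_le_ne_top (ENNReal.natCast_ne_top k) (iSup_le fun x => min_le_right _ _)
  · exact ne_top_of_le_ne_top (ENNReal.natCast_ne_top k) (iSup_le fun x => min_le_right _ _)

/-- The Prékopa–Leindler inequality. -/
theorem prekopa_leindler (n : ℕ) {f g h : (Fin n → ℝ) → ℝ≥0∞} (hf : Measurable f)
    (hg : Measurable g) (hh : Measurable h) {l : ℝ} (h0 : 0 < l) (h1 : l < 1)
    (hfgh : ∀ x y, f x ^ l * g y ^ (1 - l) ≤ h (l • x + (1 - l) • y)) :
    (∫⁻ x, f x) ^ l * (∫⁻ x, g x) ^ (1 - l) ≤ ∫⁻ x, h x := by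
  induction n with
  | zero =>
    have hv : (volume : Measure (Fin 0 → ℝ)) = Measure.dirac default :=
      Measure.pi_of_empty _ _
    have := hfgh default default
    rw [Subsingleton.elim (l • default + (1 - l) • default) (default : Fin 0 → ℝ)] at this
    rwa [hv, lintegral_dirac, lintegral_dirac, lintegral_dirac]
  | succ n ih =>
    have e := (volume_preserving_piFinSuccAbove (fun _ : Fin (n + 1) => ℝ) 0).symm
    have key : ∀ {f : (Fin (n + 1) → ℝ) → ℝ≥0∞}, Measurable f →
        Measurable (fun s : ℝ => ∫⁻ x : Fin n → ℝ, f (Fin.cons s x)) ∧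
        ∫⁻ x, f x = ∫⁻ s : ℝ, ∫⁻ x : Fin n → ℝ, f (Fin.cons s x) := by
      intro f hf
      have hm : Measurable fun p : ℝ × (Fin n → ℝ) =>
          f ((MeasurableEquiv.piFinSuccAbove (fun _ : Fin (n + 1) => ℝ) 0).symm p) :=
        hf.comp (MeasurableEquiv.measurable _)
      refine ⟨?_, ?_⟩
      · simpa [MeasurableEquiv.piFinSuccAbove, Fin.insertNthEquiv] using hm.lintegral_prod_right'
      · rw [← e.lintegral_comp hf, Measure.volume_eq_prod, lintegral_prod _ hm.aemeasurable]
        simp [MeasurableEquiv.piFinSuccAbove, Fin.insertNthEquiv]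
    rw [(key hf).2, (key hg).2, (key hh).2]
    have hc : ∀ {f : (Fin (n + 1) → ℝ) → ℝ≥0∞} (s : ℝ), Measurable f →
        Measurable fun x : Fin n → ℝ => f (Fin.cons s x) := fun s hf =>
      hf.comp (by fun_prop)
    refine prekopa_leindler_real (key hf).1 (key hg).1 (key hh).1 h0 h1 fun s t => ?_
    refine ih (hc s hf) (hc t hg) (hc _ hh) fun x y => ?_
    convert hfgh (Fin.cons s x) (Fin.cons t y) using 2
    ext i
    refine Fin.cases ?_ (fun j => ?_) i <;> simp

/-- The multiplicative form of the Brunn–Minkowski inequality. -/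
theorem brunn_minkowski {d : ℕ} {A B C : Set (EuclideanSpace ℝ (Fin d))} (hA : MeasurableSet A)
    (hB : MeasurableSet B) (hC : MeasurableSet C) {l : ℝ} (h0 : 0 < l) (h1 : l < 1)
    (h : ∀ x ∈ A, ∀ y ∈ B, l • x + (1 - l) • y ∈ C) :
    volume A ^ l * volume B ^ (1 - l) ≤ volume C := by
  have h2 : 0 < 1 - l := by linarith
  have e := PiLp.volume_preserving_toLp (Fin d)
  rw [← e.measure_preimage hA.nullMeasurableSet, ← e.measure_preimage hB.nullMeasurableSet,
    ← e.measure_preimage hC.nullMeasurableSet, ← lintegral_indicator_one (e.measurable hA),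
    ← lintegral_indicator_one (e.measurable hB), ← lintegral_indicator_one (e.measurable hC)]
  refine prekopa_leindler d (measurable_one.indicator (e.measurable hA))
    (measurable_one.indicator (e.measurable hB)) (measurable_one.indicator (e.measurable hC))
    h0 h1 fun x y => ?_
  by_cases hx : WithLp.toLp 2 x ∈ A
  · by_cases hy : WithLp.toLp 2 y ∈ B
    · have := h _ hx _ hy
      rw [← WithLp.toLp_smul, ← WithLp.toLp_smul, ← WithLp.toLp_add] at this
      simp only [mem_preimage.2 hx, mem_preimage.2 hy, indicator_of_mem, mem_preimage.2 this]
      simp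
    · simp [indicator, hy, h1]
  · simp [indicator, hx, h0]

theorem volume_ball_add_le_volume_thickening {d : ℕ} {A : Set (EuclideanSpace ℝ (Fin d))}
    (hA : MeasurableSet A) {R δ : ℝ} (hR : 0 < R) (hδ : 0 < δ)
    (hAR : volume A = volume (Metric.ball (0 : EuclideanSpace ℝ (Fin d)) R)) :
    volume (Metric.ball (0 : EuclideanSpace ℝ (Fin d)) (R + δ)) ≤
      volume (Metric.thickening δ A) := by
  have hRδ : 0 < R + δ := by linarith
  set l := R / (R + δ) with hl
  have h0 : 0 < l := by positivity
  have h1 : l < 1 := by rw [hl, div_lt_one hRδ]; linarith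
  have h2 : 0 < 1 - l := by linarith
  have e1 : l * (R + δ) = R := by rw [hl]; field_simp
  have e2 : (1 - l) * (R + δ) = δ := by rw [hl]; field_simp; ring
  have hp : ∀ {k : ℝ}, 0 < k → (fun x : EuclideanSpace ℝ (Fin d) => k • x) ⁻¹' Metric.ball 0
      (k * (R + δ)) = Metric.ball 0 (R + δ) := by
    intro k hk
    ext x
    simp [norm_smul, abs_of_pos hk, hk]
  have v1 : volume ((fun x : EuclideanSpace ℝ (Fin d) => l • x) ⁻¹' A) =
      volume (Metric.ball (0 : EuclideanSpace ℝ (Fin d)) (R + δ)) := by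
    rw [Measure.addHaar_preimage_smul _ h0.ne', hAR, ← Measure.addHaar_preimage_smul _ h0.ne']
    rw [← hp h0, e1]
  have := brunn_minkowski (C := Metric.thickening δ A) (measurable_const_smul l hA)
    (Metric.isOpen_ball (x := (0 : EuclideanSpace ℝ (Fin d))) (ε := R + δ)).measurableSet
    Metric.isOpen_thickening.measurableSet h0 h1 (by
      intro x hx y hy
      refine Metric.mem_thickening_iff.2 ⟨l • x, hx, ?_⟩
      rw [← hp h2] at hy
      simpa [e2, dist_eq_norm] using hy)
  change volume ((fun x : EuclideanSpace ℝ (Fin d) => l • x) ⁻¹' A) ^ l * _ ≤ _ at this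
  rw [v1, ← ENNReal.rpow_add_of_nonneg _ _ h0.le h2.le] at this
  simpa using this

theorem volume_ball_eq_ofReal {d : ℕ} (hd : d ≠ 0) {R : ℝ} (hR : 0 ≤ R) :
    volume (Metric.ball (0 : EuclideanSpace ℝ (Fin d)) R) =
      ENNReal.ofReal (volume.real (Metric.ball (0 : EuclideanSpace ℝ (Fin d)) 1) * R ^ d) := by
  have : Nonempty (Fin d) := ⟨⟨0, Nat.pos_of_ne_zero hd⟩⟩
  rw [Measure.addHaar_ball _ _ hR, mul_comm, ENNReal.ofReal_mul measureReal_nonneg,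
    ofReal_measureReal measure_ball_lt_top.ne]
  simp [mul_comm]

theorem le_volume_thickening_diff {d : ℕ} (hd : 2 ≤ d) {A : Set (EuclideanSpace ℝ (Fin d))}
    (hA : MeasurableSet A) {R δ : ℝ} (hR : 0 ≤ R) (hδ : 0 < δ)
    (hAR : volume A = volume (Metric.ball (0 : EuclideanSpace ℝ (Fin d)) R)) :
    ENNReal.ofReal (d * volume.real (Metric.ball (0 : EuclideanSpace ℝ (Fin d)) 1) *
      R ^ (d - 1) * δ) ≤ volume (Metric.thickening δ A \ A) := by
  rcases hR.eq_or_lt with rfl | hR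
  · simp [zero_pow (show d - 1 ≠ 0 by omega)]
  have h := volume_ball_add_le_volume_thickening hA hR hδ hAR
  have hd0 : d ≠ 0 := by omega
  refine le_trans ?_ (le_measure_sdiff)
  rw [hAR]
  refine le_trans ?_ (tsub_le_tsub_right h _)
  rw [volume_ball_eq_ofReal hd0 hR.le, volume_ball_eq_ofReal hd0 (by positivity),
    ← ENNReal.ofReal_sub _ (by positivity)]
  refine ENNReal.ofReal_le_ofReal ?_
  have := pow_add_mul_le_add_pow hR.le (b := δ) (by linarith) d
  rw [← mul_sub]
  calc _ = volume.real (Metric.ball (0 : EuclideanSpace ℝ (Fin d)) 1) *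
        (d * R ^ (d - 1) * δ) := by ring
    _ ≤ _ := by
      gcongr
      linarith

theorem lintegral_mul_radius_pow_le {d : ℕ} (hd : 2 ≤ d) {u D B : EuclideanSpace ℝ (Fin d) → ℝ}
    {R G : ℝ → ℝ} {C : ℝ} (hu : Continuous u)
    (hR : ∀ t, 0 ≤ R t)
    (huR : ∀ t > 0, volume {x | t < u x} =
      volume (Metric.ball (0 : EuclideanSpace ℝ (Fin d)) (R t)))
    (hG : Measurable G) (hG0 : ∀ t, 0 ≤ G t) (hGC : ∀ t, G t ≤ C)
    (hGu : ∀ᵐ x, ContinuousWithinAt G (Ici (u x)) (u x))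
    (hD0 : ∀ x, 0 ≤ D x)
    (hD : ∀ x, ∀ c > D x, ∀ᶠ y in 𝓝 x, u y ≤ u x + c * dist y x)
    (hB0 : ∀ x, 0 ≤ B x)
    (hB : ∀ x y, dist y x < 1 → u y ≤ u x + B x * dist y x)
    (hBi : ∫⁻ x, ENNReal.ofReal (B x) ≠ ∞) :
    ENNReal.ofReal (d * volume.real (Metric.ball (0 : EuclideanSpace ℝ (Fin d)) 1)) *
      ∫⁻ t in Ioi 0, ENNReal.ofReal (G t * R t ^ (d - 1)) ≤
    ∫⁻ x, ENNReal.ofReal (G (u x) * D x) := by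
  set δ : ℕ → ℝ := fun n => 1 / (n + 1) with hδ
  have hδ0 : ∀ n, 0 < δ n := fun n => by positivity
  have hδ1 : ∀ n, δ n ≤ 1 := fun n => by
    rw [hδ]; exact (div_le_one (by positivity)).2 (by simp)
  have hδlim : Tendsto δ atTop (𝓝 0) := tendsto_one_div_add_atTop_nhds_zero_nat
  set S : ℕ → Set (EuclideanSpace ℝ (Fin d) × ℝ) := fun n =>
    {p | u p.1 ≤ p.2 ∧ p.1 ∈ Metric.thickening (δ n) {x | p.2 < u x}} with hS
  have hSm : ∀ n, MeasurableSet (S n) := by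
    intro n
    refine (measurableSet_le (hu.measurable.comp measurable_fst) measurable_snd).inter ?_
    have : {p : EuclideanSpace ℝ (Fin d) × ℝ | p.1 ∈ Metric.thickening (δ n) {x | p.2 < u x}} =
        ⋃ y, Metric.ball y (δ n) ×ˢ Iio (u y) := by
      ext p
      simp only [Metric.mem_thickening_iff, mem_ofPred_eq, mem_iUnion, mem_prod, Metric.mem_ball,
        mem_Iio]
      constructor
      · rintro ⟨z, hz, hz'⟩
        exact ⟨z, hz', hz⟩
      · rintro ⟨z, hz, hz'⟩
        exact ⟨z, hz', hz⟩
    change MeasurableSet {p : EuclideanSpace ℝ (Fin d) × ℝ |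
      p.1 ∈ Metric.thickening (δ n) {x | p.2 < u x}}
    rw [this]
    exact (isOpen_iUnion fun y => Metric.isOpen_ball.prod isOpen_Iio).measurableSet
  set Φ : ℕ → EuclideanSpace ℝ (Fin d) × ℝ → ℝ≥0∞ := fun n p =>
    ENNReal.ofReal (δ n)⁻¹ * (S n).indicator (fun p => ENNReal.ofReal (G p.2)) p with hΦ
  have hΦm : ∀ n, Measurable (Φ n) := fun n =>
    (Measurable.indicator (by fun_prop) (hSm n)).const_mul _
  set F : ℕ → EuclideanSpace ℝ (Fin d) → ℝ≥0∞ := fun n x => ∫⁻ t in Ioi 0, Φ n (x, t) with hF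
  have hFm : ∀ n, Measurable (F n) := fun n => (hΦm n).lintegral_prod_right'
  have hFle : ∀ n x c e, 0 ≤ c → 0 ≤ e →
      (∀ y, dist y x < δ n → u y ≤ u x + c * δ n) →
      (∀ t ∈ Icc (u x) (u x + c * δ n), G t ≤ e) → F n x ≤ ENNReal.ofReal (e * c) := by
    intro n x c e hc he hy ht
    calc F n x ≤ ∫⁻ t in Ioi 0, (Icc (u x) (u x + c * δ n)).indicator
          (fun _ => ENNReal.ofReal (δ n)⁻¹ * ENNReal.ofReal e) t := by
          refine lintegral_mono fun t => ?_
          simp only [hΦ]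
          by_cases hxt : (x, t) ∈ S n
          · have hxt' := hxt
            obtain ⟨h1, h2⟩ := hxt'
            obtain ⟨z, hz, hz'⟩ := Metric.mem_thickening_iff.1 h2
            have ht' : t ∈ Icc (u x) (u x + c * δ n) :=
              ⟨h1, hz.le.trans (hy z (by rwa [dist_comm]))⟩
            rw [indicator_of_mem hxt, indicator_of_mem ht']
            gcongr
            exact ht t ht'
          · simp [indicator_of_notMem hxt]
      _ ≤ ∫⁻ t, (Icc (u x) (u x + c * δ n)).indicator
          (fun _ => ENNReal.ofReal (δ n)⁻¹ * ENNReal.ofReal e) t := setLIntegral_le_lintegral _ _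
      _ = ENNReal.ofReal (e * c) := by
          rw [lintegral_indicator measurableSet_Icc, setLIntegral_const, Real.volume_Icc,
            ← ENNReal.ofReal_mul (by have := hδ0 n; positivity),
            ← ENNReal.ofReal_mul (by have := hδ0 n; positivity)]
          congr 1
          have := hδ0 n
          field_simp
          ring
  have hlow : ∀ n, ENNReal.ofReal (d * volume.real
      (Metric.ball (0 : EuclideanSpace ℝ (Fin d)) 1)) *
      ∫⁻ t in Ioi 0, ENNReal.ofReal (G t * R t ^ (d - 1)) ≤ ∫⁻ x, F n x := by
    intro n
    rw [hF, lintegral_lintegral_swap (hΦm n).aemeasurable, ← lintegral_const_mul' _ _ ENNReal.ofReal_ne_top]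
    refine setLIntegral_mono' measurableSet_Ioi fun t ht => ?_
    have hAm : MeasurableSet {x | t < u x} := measurableSet_lt (by fun_prop) (by fun_prop)
    have hpt : ∀ x, Φ n (x, t) = ENNReal.ofReal (δ n)⁻¹ * ENNReal.ofReal (G t) *
        (Metric.thickening (δ n) {x | t < u x} \ {x | t < u x}).indicator 1 x := by
      intro x
      simp only [hΦ]
      rw [mul_assoc]
      congr 1
      by_cases hx : (x, t) ∈ S n
      · rw [indicator_of_mem hx, indicator_of_mem]
        · simp
        · exact ⟨hx.2, by simpa using hx.1⟩
      · rw [indicator_of_notMem hx, indicator_of_notMem]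
        · simp
        · intro h
          exact hx ⟨by simpa using h.2, h.1⟩
    simp_rw [hpt]
    rw [lintegral_const_mul' _ _ (ENNReal.mul_ne_top (by simp) (by simp)),
      lintegral_indicator_one (Metric.isOpen_thickening.measurableSet.diff hAm)]
    refine le_trans (le_of_eq ?_) (mul_le_mul_right
      (le_volume_thickening_diff hd hAm (hR t) (hδ0 n) (huR t ht)) _)
    have := hδ0 n
    have := hG0 t
    have := hR t
    rw [← ENNReal.ofReal_mul (by positivity), ← ENNReal.ofReal_mul (by positivity),
      ← ENNReal.ofReal_mul (by positivity)]
    congr 1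
    field_simp
  have hC : 0 ≤ C := (hG0 0).trans (hGC 0)
  have hfin : ∫⁻ x, ENNReal.ofReal (C * B x) ≠ ∞ := by
    simp_rw [ENNReal.ofReal_mul hC]
    rw [lintegral_const_mul' _ _ (by simp)]
    exact ENNReal.mul_ne_top (by simp) hBi
  have hup := limsup_lintegral_le (μ := volume) (f := F) (fun x => ENNReal.ofReal (C * B x)) hFm
    (fun n => .of_forall fun x => hFle n x (B x) C (hB0 x) hC (fun y hy =>
      (hB x y (hy.trans_le (hδ1 n))).trans (by have := hB0 x; gcongr)) fun t _ => hGC t) hfin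
  refine le_trans ?_ (hup.trans ?_)
  · exact le_limsup_of_frequently_le (Frequently.of_forall hlow)
  · refine lintegral_mono_ae ?_
    filter_upwards [hGu] with x hx
    have key : ∀ s > 0, limsup (fun n => F n x) atTop ≤
        ENNReal.ofReal ((G (u x) + s) * (D x + s)) := by
      intro s hs
      have := hG0 (u x)
      have hDx := hD0 x
      obtain ⟨r, hr, hr'⟩ := Metric.eventually_nhds_iff.1 (hD x (D x + s) (by linarith))
      have hx' : ∀ᶠ t in 𝓝[Ici (u x)] (u x), G t < G (u x) + s :=
        hx.eventually (gt_mem_nhds (by linarith))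
      obtain ⟨r2, hr2, hr2'⟩ := Metric.eventually_nhds_iff.1 (eventually_nhdsWithin_iff.1 hx')
      have ev1 : ∀ᶠ n in atTop, δ n < r := hδlim.eventually (gt_mem_nhds hr)
      have ev2 : ∀ᶠ n in atTop, (D x + s) * δ n < r2 := by
        have : Tendsto (fun n => (D x + s) * δ n) atTop (𝓝 ((D x + s) * 0)) :=
          hδlim.const_mul _
        rw [mul_zero] at this
        exact this.eventually (gt_mem_nhds hr2)
      refine limsup_le_of_le (by isBoundedDefault) ?_
      filter_upwards [ev1, ev2] with n h1 h2
      refine hFle n x _ _ (by positivity) (by positivity) (fun y hy => ?_) fun t ht => ?_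
      · refine (hr' (hy.trans h1)).trans ?_
        gcongr
      · refine (hr2' (y := t) ?_ ht.1).le
        rw [Real.dist_eq, abs_of_nonneg (by linarith [ht.1])]
        linarith [ht.2]
    have hlim : Tendsto (fun s : ℝ => ENNReal.ofReal ((G (u x) + s) * (D x + s))) (𝓝[>] 0)
        (𝓝 (ENNReal.ofReal ((G (u x) + 0) * (D x + 0)))) :=
      (ENNReal.continuous_ofReal.comp (by fun_prop)).continuousWithinAt.tendsto
    simp only [add_zero] at hlim
    exact ge_of_tendsto hlim (by filter_upwards [self_mem_nhdsWithin] with s hs using key s hs)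

/-- Integration in polar coordinates of a radial function. -/
theorem lintegral_fun_norm {d : ℕ} (hd : d ≠ 0) {φ : ℝ → ℝ≥0∞} (hφ : Measurable φ) :
    ∫⁻ x : EuclideanSpace ℝ (Fin d), φ ‖x‖ =
      ENNReal.ofReal (d * volume.real (Metric.ball (0 : EuclideanSpace ℝ (Fin d)) 1)) *
        ∫⁻ y in Ioi (0 : ℝ), ENNReal.ofReal (y ^ (d - 1)) * φ y := by
  have : NeZero d := ⟨hd⟩
  have hdim : Module.finrank ℝ (EuclideanSpace ℝ (Fin d)) = d := by simp
  have hm : Measurable fun y : Ioi (0 : ℝ) => φ y := hφ.comp measurable_subtype_coe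
  calc
    ∫⁻ x : EuclideanSpace ℝ (Fin d), φ ‖x‖ =
        ∫⁻ x : ({(0)}ᶜ : Set (EuclideanSpace ℝ (Fin d))), φ ‖x.1‖
          ∂(volume.comap (Subtype.val)) := by
      rw [lintegral_subtype_comap (measurableSet_singleton _).compl fun x ↦ φ (‖x‖),
        restrict_compl_singleton]
    _ = ∫⁻ x, φ x.2 ∂(volume : Measure (EuclideanSpace ℝ (Fin d))).toSphere.prod
          (.volumeIoiPow (Module.finrank ℝ (EuclideanSpace ℝ (Fin d)) - 1)) := by
      rw [← (volume : Measure (EuclideanSpace ℝ (Fin d))).measurePreserving_homeomorphUnitSphereProd.lintegral_comp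
        (f := fun x => φ x.2) (hm.comp measurable_snd)]
      simp
    _ = (volume : Measure (EuclideanSpace ℝ (Fin d))).toSphere univ *
          ∫⁻ x : Ioi (0 : ℝ), φ x ∂.volumeIoiPow (d - 1) := by
      rw [hdim, lintegral_prod (fun x : Metric.sphere (0 : EuclideanSpace ℝ (Fin d)) 1 × Ioi (0 : ℝ) => φ x.2) (hm.comp measurable_snd).aemeasurable]
      simp [mul_comm]
    _ = _ := by
      rw [Measure.toSphere_apply_univ, hdim, Measure.volumeIoiPow,
        lintegral_withDensity_eq_lintegral_mul _ (by fun_prop) hm,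
        ENNReal.ofReal_mul (by positivity), ENNReal.ofReal_natCast,
        ofReal_measureReal (by exact measure_ball_lt_top.ne)]
      congr 1
      exact lintegral_subtype_comap measurableSet_Ioi
        fun y => ENNReal.ofReal (y ^ (d - 1)) * φ y

theorem ball_one_pos {d : ℕ} : 0 < volume.real (Metric.ball (0 : EuclideanSpace ℝ (Fin d)) 1) :=
  ENNReal.toReal_pos (Metric.measure_ball_pos _ _ one_pos).ne' measure_ball_lt_top.ne

/-- The properties of the radius function `R` of the superlevel sets of `u`, and of its inverse
`U`, the decreasing rearrangement. -/
structure IsRearrangement {d : ℕ} (u : EuclideanSpace ℝ (Fin d) → ℝ) (R U : ℝ → ℝ) : Prop where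
  nonneg : ∀ t, 0 ≤ R t
  meas : Measurable R
  vol : ∀ t > 0, volume {x | t < u x} =
      volume (Metric.ball (0 : EuclideanSpace ℝ (Fin d)) (R t))
  cont : ContinuousOn R (Ioi 0)
  U_pos : ∀ ρ > 0, 0 < U ρ
  R_U : ∀ ρ > 0, R (U ρ) = ρ
  lt_iff : ∀ ρ > 0, ∀ t > 0, ρ < R t ↔ t < U ρ
  U_R : ∀ t > 0, 0 < R t → U (R t) = t
  cont_U : ContinuousOn U (Ioi 0)
  ae_pos : ∀ᵐ x, 0 < R (u x)
  map_eq : volume.map (fun x => R (u x)) = volume.map (fun x : EuclideanSpace ℝ (Fin d) => ‖x‖)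

theorem volume_superlevel_lt_top {d : ℕ} {u : EuclideanSpace ℝ (Fin d) → ℝ}
    (h0 : Tendsto u (cocompact _) (𝓝 0)) {t : ℝ} (ht : 0 < t) : volume {x | t < u x} < ∞ := by
  have := h0.eventually (gt_mem_nhds ht)
  rw [Filter.Eventually, mem_cocompact] at this
  obtain ⟨K, hK, hKs⟩ := this
  refine (measure_mono fun x hx => ?_).trans_lt hK.measure_lt_top
  by_contra hxK
  have := hKs hxK
  simp only [mem_ofPred_eq] at hx this
  linarith

theorem exists_isRearrangement {d : ℕ} (hd : 2 ≤ d) {u : EuclideanSpace ℝ (Fin d) → ℝ}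
    (hu : Continuous u) (hpos : ∀ x, 0 < u x) (h0 : Tendsto u (cocompact _) (𝓝 0))
    (hnull : ∀ t > 0, volume {x | u x = t} = 0) : ∃ R U, IsRearrangement u R U := by
  have : NeZero d := ⟨by omega⟩
  have hd0 : d ≠ 0 := by omega
  set V := volume.real (Metric.ball (0 : EuclideanSpace ℝ (Fin d)) 1) with hV
  have hV0 : 0 < V := ball_one_pos
  set m : ℝ → ℝ := fun t => volume.real {x | t < u x} with hm
  have hfin : ∀ {t : ℝ}, 0 < t → volume {x | t < u x} ≠ ∞ := fun ht =>
    (volume_superlevel_lt_top h0 ht).ne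
  have hm0 : ∀ t, 0 ≤ m t := fun t => ENNReal.toReal_nonneg
  set R : ℝ → ℝ := fun t => (m t / V) ^ ((d : ℝ)⁻¹) with hRdef
  have hR0 : ∀ t, 0 ≤ R t := fun t => by have := hm0 t; positivity
  have hRd : ∀ t, V * R t ^ d = m t := fun t => by
    rw [hRdef]
    simp only
    rw [Real.rpow_inv_natCast_pow (by have := hm0 t; positivity) hd0]
    field_simp
  have hmm : Measurable m :=
    Measurable.ennreal_toReal (f := fun t => volume {x | t < u x})
      (Antitone.measurable fun s t hst => measure_mono fun x hx => lt_of_le_of_lt hst hx)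
  have hRm : Measurable R := (hmm.div_const V).pow_const _
  have hvol : ∀ t > 0, volume {x | t < u x} =
      volume (Metric.ball (0 : EuclideanSpace ℝ (Fin d)) (R t)) := by
    intro t ht
    rw [volume_ball_eq_ofReal hd0 (hR0 t), hRd, hm, ofReal_measureReal (hfin ht)]
  have hmanti : ∀ {s t}, 0 < s → s ≤ t → m t ≤ m s := fun hs hst =>
    ENNReal.toReal_mono (hfin hs) (measure_mono fun x hx => lt_of_le_of_lt hst hx)
  have hRle : ∀ {s t}, m s ≤ m t → R s ≤ R t := fun h =>
    Real.rpow_le_rpow (by have := hm0; positivity) (by gcongr) (by positivity)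
  have hRanti : ∀ {s t}, 0 < s → s ≤ t → R t ≤ R s := fun hs hst => hRle (hmanti hs hst)
  have hmcont : ContinuousOn m (Ioi 0) := by
    intro t ht
    refine ContinuousAt.continuousWithinAt ?_
    have ht : 0 < t := ht
    refine (ENNReal.continuousAt_toReal (hfin ht)).tendsto.comp ?_
    have e : ∀ s, volume {x | s < u x} =
        ∫⁻ x, {x | s < u x}.indicator 1 x := fun s => by
      rw [lintegral_indicator_one]
      exact measurableSet_lt measurable_const hu.measurable
    simp_rw [e]
    refine tendsto_lintegral_filter_of_dominated_convergence
      ({x | t / 2 < u x}.indicator 1) ?_ ?_ ?_ ?_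
    · exact Eventually.of_forall fun s =>
        measurable_one.indicator (measurableSet_lt measurable_const hu.measurable)
    · filter_upwards [lt_mem_nhds (show t / 2 < t by linarith)] with s hs
      refine Eventually.of_forall fun x => indicator_le_indicator_of_subset ?_ (by simp) x
      intro x hx
      exact lt_trans hs hx
    · rw [lintegral_indicator_one (measurableSet_lt measurable_const hu.measurable)]
      exact hfin (by linarith)
    · have : ∀ᵐ x, u x ≠ t := by
        rw [ae_iff]; simpa using hnull t ht
      filter_upwards [this] with x hx
      refine tendsto_const_nhds.congr' ?_
      rcases lt_or_gt_of_ne hx with h | h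
      · filter_upwards [lt_mem_nhds h] with s hs
        rw [indicator_of_notMem, indicator_of_notMem]
        · simpa using hs.le
        · simpa using h.le
      · filter_upwards [gt_mem_nhds h] with s hs
        rw [indicator_of_mem, indicator_of_mem]
        · simpa using hs
        · simpa using h
  have hRcont : ContinuousOn R (Ioi 0) :=
    (hmcont.div_const V).rpow_const fun _ _ => Or.inr (by positivity)
  have hne : Nonempty (EuclideanSpace ℝ (Fin d)) := ⟨0⟩
  have hsmall : ∀ δ > 0, ∃ y, u y < δ := fun δ hδ => (h0.eventually (gt_mem_nhds hδ)).exists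
  have hstrict : ∀ {s t}, 0 < s → s < t → 0 < R s → R t < R s := by
    intro s t hs hst hRs
    have hms : 0 < m s := by
      rw [← hRd]; positivity
    obtain ⟨x, hx⟩ : {x | s < u x}.Nonempty := by
      by_contra h
      rw [not_nonempty_iff_eq_empty] at h
      simp [hm, h] at hms
    obtain ⟨y, hy⟩ := hsmall s hs
    have hopen : IsOpen {x | s < u x ∧ u x < t} :=
      (isOpen_lt continuous_const hu).inter (isOpen_lt hu continuous_const)
    have hnon : {x | s < u x ∧ u x < t}.Nonempty := by
      have : IsPreconnected (range u) := isPreconnected_range hu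
      have hx : s < u x := hx
      obtain ⟨c, hc1, hc2⟩ := exists_between (lt_min hx hst)
      obtain ⟨z, hz⟩ := this.Icc_subset (mem_range_self y) (mem_range_self x)
        ⟨(hy.trans hc1).le, (hc2.trans_le (min_le_left _ _)).le⟩
      exact ⟨z, by rw [mem_ofPred_eq, hz]; exact ⟨hc1, hc2.trans_le (min_le_right _ _)⟩⟩
    have hp := hopen.measure_pos volume hnon
    have hlt : m t < m s := by
      refine (ENNReal.toReal_lt_toReal (hfin (hs.trans hst)) (hfin hs)).2 ?_
      have hdis : Disjoint {x | s < u x ∧ u x < t} {x | t < u x} :=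
        Set.disjoint_left.2 fun x hx hx' => lt_asymm hx.2 hx'
      have := measure_union (μ := volume) hdis (measurableSet_lt measurable_const hu.measurable)
      refine lt_of_lt_of_le ?_ ((this.symm.le).trans (measure_mono ?_))
      · rw [add_comm]; exact ENNReal.lt_add_right (hfin (hs.trans hst)) hp.ne'
      · rintro x (hx | hx)
        · exact hx.1
        · exact hst.trans hx
    exact Real.rpow_lt_rpow (by have := hm0 t; positivity) (by gcongr) (by positivity)
  have honto : ∀ ρ > 0, ∃ t, 0 < t ∧ R t = ρ := by
    intro ρ hρ
    obtain ⟨t₁, ht₁, hR₁⟩ : ∃ t, 0 < t ∧ R t < ρ := by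
      obtain ⟨C, hC⟩ : ∃ C, ∀ x, u x ≤ C := by
        have hb : BddAbove (range u) := by
          obtain ⟨x, hx⟩ := hu.exists_forall_ge' (x₀ := 0)
            ((h0.eventually (gt_mem_nhds (hpos 0))).mono fun x hx => hx.le)
          exact ⟨u x, by rintro _ ⟨y, rfl⟩; exact hx y⟩
        exact ⟨_, fun x => le_csSup hb (mem_range_self x)⟩
      refine ⟨C, (hpos 0).trans_le (hC 0), ?_⟩
      have : {x | C < u x} = ∅ := by
        ext x; simpa using hC x
      have : R C = 0 := by
        simp [hRdef, hm, this, hd0]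
      rwa [this]
    obtain ⟨t₂, ht₂, hR₂⟩ : ∃ t, 0 < t ∧ ρ < R t := by
      obtain ⟨x, hx, hmin⟩ := (isCompact_closedBall (0 : EuclideanSpace ℝ (Fin d))
        (ρ + 1)).exists_isMinOn ⟨0, by simp; positivity⟩ hu.continuousOn
      refine ⟨u x / 2, half_pos (hpos x), ?_⟩
      have hsub : Metric.ball 0 (ρ + 1) ⊆ {y | u x / 2 < u y} := by
        intro y hy
        have := hmin (Metric.ball_subset_closedBall hy)
        simp only [mem_ofPred_eq] at this ⊢
        linarith [hpos x]
      have := measure_mono (μ := volume) hsub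
      rw [hvol _ (half_pos (hpos x)), volume_ball_eq_ofReal hd0 (hR0 _),
        volume_ball_eq_ofReal hd0 (by positivity),
        ENNReal.ofReal_le_ofReal_iff (by have := hR0 (u x / 2); positivity)] at this
      have := le_of_mul_le_mul_left this hV0
      have := le_of_pow_le_pow_left₀ hd0 (hR0 _) this
      linarith
    have hc : IsPreconnected (Ioi (0 : ℝ)) := isPreconnected_Ioi
    obtain ⟨t, ht, h⟩ := hc.intermediate_value (mem_Ioi.2 ht₁) (mem_Ioi.2 ht₂) hRcont
      ⟨hR₁.le, hR₂.le⟩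
    exact ⟨t, ht, h⟩
  choose! U hU using honto
  have hU0 : ∀ ρ > 0, 0 < U ρ := fun ρ hρ => (hU ρ hρ).1
  have hRU : ∀ ρ > 0, R (U ρ) = ρ := fun ρ hρ => (hU ρ hρ).2
  have hlt : ∀ ρ > 0, ∀ t > 0, ρ < R t ↔ t < U ρ := by
    intro ρ hρ t ht
    constructor
    · intro h
      by_contra! h'
      have := hRanti (hU0 ρ hρ) h'
      rw [hRU ρ hρ] at this
      linarith
    · intro h
      have h1 := hRanti ht h.le
      rw [hRU ρ hρ] at h1
      have := hstrict ht h (hρ.trans_le h1)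
      rwa [hRU ρ hρ] at this
  have hgt : ∀ ρ > 0, ∀ t > 0, R t < ρ ↔ U ρ < t := by
    intro ρ hρ t ht
    constructor
    · intro h
      by_contra! h'
      have := hRanti ht h'
      rw [hRU ρ hρ] at this
      linarith
    · intro h
      have := hstrict (hU0 ρ hρ) h (by rwa [hRU ρ hρ])
      rwa [hRU ρ hρ] at this
  have hUc : ContinuousOn U (Ioi 0) := by
    intro ρ hρ
    have hρ : 0 < ρ := hρ
    refine ContinuousAt.continuousWithinAt (tendsto_order.2 ⟨fun t ht => ?_, fun t ht => ?_⟩)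
    · rcases le_or_gt t 0 with h | h
      · filter_upwards [lt_mem_nhds hρ] with r hr using h.trans_lt (hU0 r hr)
      · filter_upwards [lt_mem_nhds hρ, gt_mem_nhds ((hlt ρ hρ t h).2 ht)] with r hr hr'
        exact (hlt r hr t h).1 hr'
    · have h := (hU0 ρ hρ).trans ht
      filter_upwards [lt_mem_nhds hρ, lt_mem_nhds ((hgt ρ hρ t h).2 ht)] with r hr hr'
      exact (hgt r hr t h).1 hr'
  have hUR : ∀ t > 0, 0 < R t → U (R t) = t := by
    intro t ht hRt
    rcases lt_trichotomy (U (R t)) t with h | h | h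
    · exact absurd ((hgt _ hRt t ht).2 h) (lt_irrefl _)
    · exact h
    · exact absurd ((hlt _ hRt t ht).2 h) (lt_irrefl _)
  have hIic : ∀ ρ > 0, volume {x | R (u x) ≤ ρ} =
      volume (Metric.ball (0 : EuclideanSpace ℝ (Fin d)) ρ) := by
    intro ρ hρ
    have e : {x | R (u x) ≤ ρ} = {x | U ρ < u x} ∪ {x | u x = U ρ} := by
      ext x
      have := hlt ρ hρ (u x) (hpos x)
      simp only [mem_ofPred_eq, mem_union]
      rw [← not_lt, this, not_lt, le_iff_lt_or_eq, eq_comm]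
    have h1 : volume {x | U ρ < u x} = volume (Metric.ball (0 : EuclideanSpace ℝ (Fin d)) ρ) := by
      rw [hvol _ (hU0 ρ hρ), hRU ρ hρ]
    rw [e, ← h1]
    refine le_antisymm ((measure_union_le _ _).trans ?_) (measure_mono subset_union_left)
    rw [hnull _ (hU0 ρ hρ), add_zero]
  have hzero : volume {x | R (u x) ≤ 0} = 0 := by
    have hle : ∀ ρ > 0, volume {x | R (u x) ≤ 0} ≤ ENNReal.ofReal (V * ρ ^ d) := by
      intro ρ hρ
      rw [← volume_ball_eq_ofReal hd0 hρ.le, ← hIic ρ hρ]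
      exact measure_mono fun x (hx : R (u x) ≤ 0) => hx.trans hρ.le
    have hlim : Tendsto (fun ρ : ℝ => ENNReal.ofReal (V * ρ ^ d)) (𝓝[>] 0)
        (𝓝 (ENNReal.ofReal (V * 0 ^ d))) := by
      refine Tendsto.mono_left (Continuous.tendsto ?_ 0) nhdsWithin_le_nhds
      exact ENNReal.continuous_ofReal.comp (by fun_prop)
    have := ge_of_tendsto hlim (eventually_mem_nhdsWithin.mono fun ρ hρ => hle ρ hρ)
    simpa [hd0] using this
  refine ⟨R, U, hR0, hRm, hvol, hRcont, hU0, hRU, hlt, hUR, hUc, ?_, ?_⟩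
  · rw [ae_iff]; simpa using hzero
  · have hRu : Measurable fun x => R (u x) := hRm.comp hu.measurable
    have hI : ∀ a, volume.map (fun x => R (u x)) (Iic a) =
        volume.map (fun x : EuclideanSpace ℝ (Fin d) => ‖x‖) (Iic a) := by
      intro a
      rw [Measure.map_apply hRu measurableSet_Iic, Measure.map_apply measurable_norm
        measurableSet_Iic]
      have e : (fun x : EuclideanSpace ℝ (Fin d) => ‖x‖) ⁻¹' Iic a = Metric.closedBall 0 a := by
        ext; simp
      rw [e]
      rcases lt_trichotomy a 0 with h | h | h
      · rw [Metric.closedBall_eq_empty.2 h]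
        have : (fun x => R (u x)) ⁻¹' Iic a = ∅ := by
          ext x; simpa using h.trans_le (hR0 (u x))
        rw [this]
      · subst h
        rw [Measure.addHaar_closedBall _ _ le_rfl]
        simp only [ne_eq, finrank_euclideanSpace, Fintype.card_fin, hd0, not_false_eq_true, zero_pow,
          ENNReal.ofReal_zero, zero_mul]
        exact hzero
      · rw [Measure.addHaar_closedBall_eq_addHaar_ball]
        exact hIic a h
    have hIf : ∀ a, volume.map (fun x : EuclideanSpace ℝ (Fin d) => ‖x‖) (Iic a) ≠ ∞ := by
      intro a
      rw [Measure.map_apply measurable_norm measurableSet_Iic]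
      have e : (fun x : EuclideanSpace ℝ (Fin d) => ‖x‖) ⁻¹' Iic a = Metric.closedBall 0 a := by
        ext; simp
      rw [e]
      exact measure_closedBall_lt_top.ne
    refine Measure.ext_of_Ioc' _ _ (fun a b hab => ?_) fun a b hab => ?_
    · refine ((measure_mono Ioc_subset_Iic_self).trans_lt ?_).ne
      rw [hI]; exact (hIf b).lt_top
    · rw [← Iic_sdiff_Iic, measure_sdiff (Iic_subset_Iic.2 hab.le) measurableSet_Iic.nullMeasurableSet
        (by rw [hI]; exact hIf a), measure_sdiff (Iic_subset_Iic.2 hab.le)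
        measurableSet_Iic.nullMeasurableSet (hIf a), hI, hI]

section Cumulative

variable {k : ℝ → ℝ}

theorem intervalIntegrable_of_integrableOn_Ioi (hki : IntegrableOn k (Ioi 0)) {x : ℝ}
    (hx : 0 ≤ x) : IntervalIntegrable k volume 0 x :=
  (intervalIntegrable_iff_integrableOn_Ioc_of_le hx).2 (hki.mono_set Ioc_subset_Ioi_self)

theorem hasDerivAt_integral_of_integrableOn_Ioi (hk : ContinuousOn k (Ioi 0))
    (hki : IntegrableOn k (Ioi 0)) {x : ℝ} (hx : 0 < x) :
    HasDerivAt (fun x => ∫ t in 0..x, k t) (k x) x :=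
  intervalIntegral.integral_hasDerivAt_right (intervalIntegrable_of_integrableOn_Ioi hki hx.le)
    (hk.stronglyMeasurableAtFilter isOpen_Ioi x hx) (hk.continuousAt (Ioi_mem_nhds hx))

theorem strictMonoOn_integral_of_pos (hk : ContinuousOn k (Ioi 0))
    (hki : IntegrableOn k (Ioi 0)) (hk0 : ∀ x > 0, 0 < k x) :
    StrictMonoOn (fun x => ∫ t in 0..x, k t) (Ioi 0) := by
  refine strictMonoOn_of_deriv_pos (convex_Ioi 0) (fun x hx =>
    (hasDerivAt_integral_of_integrableOn_Ioi hk hki hx).continuousAt.continuousWithinAt)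
    fun x hx => ?_
  rw [interior_Ioi] at hx
  rw [(hasDerivAt_integral_of_integrableOn_Ioi hk hki hx).deriv]
  exact hk0 x hx

theorem integral_mem_Ioo_of_pos (hk : ContinuousOn k (Ioi 0))
    (hki : IntegrableOn k (Ioi 0)) (hk0 : ∀ x > 0, 0 < k x) {x : ℝ} (hx : 0 < x) :
    ∫ t in 0..x, k t ∈ Ioo 0 (∫ t in Ioi 0, k t) := by
  constructor
  · exact intervalIntegral.intervalIntegral_pos_of_pos_on
      (intervalIntegrable_of_integrableOn_Ioi hki hx.le) (fun t ht => hk0 t ht.1) hx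
  · refine lt_of_lt_of_le (strictMonoOn_integral_of_pos hk hki hk0 hx
      (mem_Ioi.2 (by linarith : 0 < x + 1)) (by linarith : x < x + 1)) ?_
    simp only
    rw [intervalIntegral.integral_of_le (by linarith)]
    exact setIntegral_mono_set hki ((ae_restrict_mem measurableSet_Ioi).mono
      fun t ht => (hk0 t ht).le) Ioc_subset_Ioi_self.eventuallyLE

theorem tendsto_integral_nhdsGT_zero (hki : IntegrableOn k (Ioi 0)) :
    Tendsto (fun x => ∫ t in 0..x, k t) (𝓝[>] 0) (𝓝 0) := by
  have h : ContinuousOn (fun x => ∫ t in 0..x, k t) (uIcc 0 1) :=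
    intervalIntegral.continuousOn_primitive_interval (by
      rw [uIcc_of_le zero_le_one, integrableOn_Icc_iff_integrableOn_Ioc]
      exact hki.mono_set Ioc_subset_Ioi_self)
  have := (h 0 (by simp)).tendsto
  simp only [intervalIntegral.integral_same, uIcc_of_le zero_le_one] at this
  refine this.mono_left ?_
  rw [← nhdsWithin_Ioc_eq_nhdsGT (zero_lt_one' ℝ)]
  exact nhdsWithin_mono _ Ioc_subset_Icc_self

theorem exists_integral_eq_of_mem_Ioo (hk : ContinuousOn k (Ioi 0))
    (hki : IntegrableOn k (Ioi 0)) {y : ℝ}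
    (hy : y ∈ Ioo 0 (∫ t in Ioi 0, k t)) : ∃ x > 0, ∫ t in 0..x, k t = y := by
  obtain ⟨a, ha, ha0⟩ := (((tendsto_integral_nhdsGT_zero hki).eventually
    (gt_mem_nhds hy.1)).and self_mem_nhdsWithin).exists
  obtain ⟨c, hc, hc0⟩ := (((intervalIntegral_tendsto_integral_Ioi 0 hki tendsto_id).eventually
    (lt_mem_nhds hy.2)).and (eventually_gt_atTop 0)).exists
  have hp : IsPreconnected (Ioi (0 : ℝ)) := isPreconnected_Ioi
  obtain ⟨x, hx, h⟩ := hp.intermediate_value ha0 (mem_Ioi.2 hc0)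
    (fun x hx => (hasDerivAt_integral_of_integrableOn_Ioi hk hki
      hx).continuousAt.continuousWithinAt) ⟨ha.le, hc.le⟩
  exact ⟨x, hx, h⟩

/-- Monotone transport between two positive densities on the half line. -/
theorem exists_transport {h : ℝ → ℝ} (hk : ContinuousOn k (Ioi 0))
    (hki : IntegrableOn k (Ioi 0)) (hk0 : ∀ x > 0, 0 < k x) (hh : ContinuousOn h (Ioi 0))
    (hhi : IntegrableOn h (Ioi 0)) (hh0 : ∀ x > 0, 0 < h x)
    (heq : ∫ t in Ioi 0, h t = ∫ t in Ioi 0, k t) :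
    ∃ τ : ℝ → ℝ, (∀ x > 0, 0 < τ x) ∧ (∀ x > 0, HasDerivAt τ (h x / k (τ x)) x) ∧
      Tendsto τ (𝓝[>] 0) (𝓝 0) ∧ InjOn τ (Ioi 0) ∧ τ '' Ioi 0 = Ioi 0 := by
  set K : ℝ → ℝ := fun x => ∫ t in 0..x, k t with hK
  set H : ℝ → ℝ := fun x => ∫ t in 0..x, h t with hH
  set T := ∫ t in Ioi 0, k t with hT
  have hKm : StrictMonoOn K (Ioi 0) := strictMonoOn_integral_of_pos hk hki hk0
  have hHm : StrictMonoOn H (Ioi 0) := strictMonoOn_integral_of_pos hh hhi hh0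
  have hHT : ∀ x > 0, H x ∈ Ioo 0 T := fun x hx => by
    have := integral_mem_Ioo_of_pos hh hhi hh0 hx
    rwa [heq] at this
  have hKT : ∀ x > 0, K x ∈ Ioo 0 T := fun x hx => integral_mem_Ioo_of_pos hk hki hk0 hx
  have hex : ∀ y ∈ Ioo 0 T, ∃ x > 0, K x = y := fun y hy =>
    exists_integral_eq_of_mem_Ioo hk hki hy
  choose! σ hσ0 hσ using hex
  have hlt : ∀ y ∈ Ioo 0 T, ∀ s > 0, s < σ y ↔ K s < y := fun y hy s hs => by
    rw [← hKm.lt_iff_lt hs (hσ0 y hy), hσ y hy]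
  have hgt : ∀ y ∈ Ioo 0 T, ∀ s > 0, σ y < s ↔ y < K s := fun y hy s hs => by
    rw [← hKm.lt_iff_lt (hσ0 y hy) hs, hσ y hy]
  have hσc : ∀ y ∈ Ioo 0 T, ContinuousAt σ y := by
    intro y hy
    have hnear := isOpen_Ioo.mem_nhds hy
    refine tendsto_order.2 ⟨fun s hs => ?_, fun s hs => ?_⟩
    · rcases le_or_gt s 0 with h | h
      · filter_upwards [hnear] with z hz using h.trans_lt (hσ0 z hz)
      · filter_upwards [hnear, lt_mem_nhds ((hlt y hy s h).1 hs)] with z hz hz'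
        exact (hlt z hz s h).2 hz'
    · have h := (hσ0 y hy).trans hs
      filter_upwards [hnear, gt_mem_nhds ((hgt y hy s h).1 hs)] with z hz hz'
      exact (hgt z hz s h).2 hz'
  have hσd : ∀ y ∈ Ioo 0 T, HasDerivAt σ (k (σ y))⁻¹ y := fun y hy =>
    HasDerivAt.of_local_left_inverse (hσc y hy)
      (hasDerivAt_integral_of_integrableOn_Ioi hk hki (hσ0 y hy)) (hk0 _ (hσ0 y hy)).ne'
      (by filter_upwards [isOpen_Ioo.mem_nhds hy] with z hz using hσ z hz)
  refine ⟨fun x => σ (H x), fun x hx => hσ0 _ (hHT x hx), fun x hx => ?_, ?_, ?_, ?_⟩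
  · have := (hσd _ (hHT x hx)).comp x (hasDerivAt_integral_of_integrableOn_Ioi hh hhi hx)
    rwa [inv_mul_eq_div] at this
  · refine tendsto_order.2 ⟨fun s hs => ?_, fun s hs => ?_⟩
    · filter_upwards [self_mem_nhdsWithin] with x hx using hs.trans (hσ0 _ (hHT x hx))
    · filter_upwards [self_mem_nhdsWithin, (tendsto_integral_nhdsGT_zero hhi).eventually
        (gt_mem_nhds (hKT s hs).1)] with x hx hx'
      exact (hgt _ (hHT x hx) s hs).2 hx'
  · intro x hx y hy hxy
    refine hHm.injOn hx hy ?_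
    rw [← hσ _ (hHT x hx), ← hσ _ (hHT y hy)]
    exact congrArg K hxy
  · ext s
    constructor
    · rintro ⟨x, hx, rfl⟩
      exact hσ0 _ (hHT x hx)
    · intro hs
      have hs : 0 < s := hs
      obtain ⟨x, hx, h⟩ := exists_integral_eq_of_mem_Ioo hh hhi
        (by rw [heq]; exact hKT s hs : K s ∈ _)
      refine ⟨x, hx, ?_⟩
      refine hKm.injOn (hσ0 _ (hHT x hx)) hs ?_
      rw [hσ _ (hHT x hx)]
      exact h

end Cumulative

section BlissKernel

variable {ε α n : ℝ}

theorem continuousOn_bliss (hε : 0 < ε) (s m a : ℝ) :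
    ContinuousOn (fun τ : ℝ => (ε + τ ^ s) ^ m * τ ^ a) (Ioi 0) := by
  have h : ∀ a : ℝ, ContinuousOn (fun τ : ℝ => τ ^ a) (Ioi 0) := fun a =>
    continuousOn_id.rpow_const fun x hx => Or.inl (ne_of_gt hx)
  refine ContinuousOn.mul (ContinuousOn.rpow_const (continuousOn_const.add (h s)) ?_) (h a)
  intro x hx
  have hx : 0 < x := hx
  left; positivity

theorem integrableOn_bliss (hε : 0 < ε) {s m a : ℝ} (hm : m ≤ 0) (ha : -1 < a)
    (h : a + s * m < -1) : IntegrableOn (fun τ : ℝ => (ε + τ ^ s) ^ m * τ ^ a) (Ioi 0) := by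
  have hc := continuousOn_bliss hε s m a
  have hsm : AEStronglyMeasurable (fun τ : ℝ => (ε + τ ^ s) ^ m * τ ^ a)
      (volume.restrict (Ioi 0)) := hc.aestronglyMeasurable measurableSet_Ioi
  rw [← Ioc_union_Ioi_eq_Ioi zero_le_one]
  refine IntegrableOn.union ?_ ?_
  · have hi : IntegrableOn (fun τ : ℝ => ε ^ m * τ ^ a) (Ioc 0 1) :=
      Integrable.const_mul ((intervalIntegrable_iff_integrableOn_Ioc_of_le zero_le_one).1
        (intervalIntegral.intervalIntegrable_rpow' ha)) _
    refine Integrable.mono' hi (hsm.mono_measure (Measure.restrict_mono Ioc_subset_Ioi_self le_rfl))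
      ((ae_restrict_mem measurableSet_Ioc).mono fun x hx => ?_)
    have hx0 : 0 < x := hx.1
    rw [Real.norm_of_nonneg (by positivity)]
    refine mul_le_mul_of_nonneg_right (Real.rpow_le_rpow_of_nonpos hε ?_ hm) (by positivity)
    have := Real.rpow_pos_of_pos hx0 s
    linarith
  · have hi : IntegrableOn (fun τ : ℝ => τ ^ (a + s * m)) (Ioi 1) :=
      integrableOn_Ioi_rpow_of_lt h one_pos
    refine Integrable.mono' hi (hsm.mono_measure
      (Measure.restrict_mono (Ioi_subset_Ioi zero_le_one) le_rfl))
      ((ae_restrict_mem measurableSet_Ioi).mono fun x hx => ?_)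
    have hx0 : 0 < x := zero_lt_one.trans hx
    rw [Real.norm_of_nonneg (by positivity), add_comm a, Real.rpow_add hx0, Real.rpow_mul hx0.le]
    exact mul_le_mul_of_nonneg_right (Real.rpow_le_rpow_of_nonpos (by positivity)
      (by linarith) hm) (by positivity)

theorem integral_bliss_pos (hε : 0 < ε) {s m a : ℝ} (hm : m ≤ 0) (ha : -1 < a)
    (h : a + s * m < -1) : 0 < ∫ τ in Ioi (0 : ℝ), (ε + τ ^ s) ^ m * τ ^ a := by
  have := integral_mem_Ioo_of_pos (continuousOn_bliss hε s m a) (integrableOn_bliss hε hm ha h)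
    (fun x hx => by positivity) one_pos
  exact this.1.trans this.2

theorem integral_bliss_identity (hε : 0 < ε) (hα : 0 < α) (hn : 2 < n) :
    n * ∫ τ in Ioi (0 : ℝ), (ε + τ ^ (2 * α)) ^ (-(n - 1)) * τ ^ (α * n - 1) =
      2 * (n - 1) * ∫ τ in Ioi (0 : ℝ), (ε + τ ^ (2 * α)) ^ (-n) * τ ^ (α * n - 1 + 2 * α) := by
  have hαn : 0 < α * n := by positivity
  have hαn2 : 0 < α * (n - 2) := mul_pos hα (by linarith)
  have iL : IntegrableOn (fun τ : ℝ => (ε + τ ^ (2 * α)) ^ (-(n - 1)) * τ ^ (α * n - 1)) (Ioi 0) :=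
    integrableOn_bliss hε (by linarith) (by linarith) (by nlinarith)
  have iK : IntegrableOn (fun τ : ℝ => (ε + τ ^ (2 * α)) ^ (-n) * τ ^ (α * n - 1 + 2 * α)) (Ioi 0) :=
    integrableOn_bliss hε (by linarith) (by linarith) (by nlinarith)
  set F : ℝ → ℝ := fun τ => (ε + τ ^ (2 * α)) ^ (-(n - 1)) * τ ^ (α * n) with hF
  have hd : ∀ x ∈ Ioi (0 : ℝ), HasDerivAt F
      (α * n * ((ε + x ^ (2 * α)) ^ (-(n - 1)) * x ^ (α * n - 1)) -
        2 * α * (n - 1) * ((ε + x ^ (2 * α)) ^ (-n) * x ^ (α * n - 1 + 2 * α))) x := by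
    intro x hx
    have hx : 0 < x := hx
    have hS : 0 < ε + x ^ (2 * α) := by positivity
    have h1 := ((Real.hasDerivAt_rpow_const (p := 2 * α) (Or.inl hx.ne')).const_add ε).rpow_const
      (p := -(n - 1)) (Or.inl hS.ne')
    have h2 := Real.hasDerivAt_rpow_const (p := α * n) (Or.inl hx.ne')
    refine (h1.mul h2).congr_deriv ?_
    rw [show α * n - 1 + 2 * α = (2 * α - 1) + α * n by ring, Real.rpow_add hx,
      show -(n - 1) - 1 = -n by ring]
    ring
  have hlim : Tendsto F atTop (𝓝 0) := by
    have : Tendsto (fun x : ℝ => x ^ (-(α * (n - 2)))) atTop (𝓝 0) :=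
      tendsto_rpow_neg_atTop hαn2
    refine squeeze_zero' ((eventually_gt_atTop 0).mono fun x hx => by positivity)
      ((eventually_gt_atTop 0).mono fun x hx => ?_) this
    rw [show -(α * (n - 2)) = 2 * α * (-(n - 1)) + α * n by ring, Real.rpow_add hx,
      Real.rpow_mul hx.le]
    simp only [hF]
    exact mul_le_mul_of_nonneg_right (Real.rpow_le_rpow_of_nonpos (by positivity)
      (by linarith) (by linarith)) (by positivity)
  have hcont : ContinuousWithinAt F (Ici 0) 0 := by
    have h1 : ContinuousAt (fun τ : ℝ => τ ^ (2 * α)) 0 :=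
      Real.continuousAt_rpow_const _ _ (Or.inr (by positivity))
    have h2 : ContinuousAt (fun τ : ℝ => τ ^ (α * n)) 0 :=
      Real.continuousAt_rpow_const _ _ (Or.inr (by positivity))
    exact ((ContinuousAt.rpow_const (continuousAt_const.add h1)
      (Or.inl (by simp [Real.zero_rpow, hα.ne', hε.ne']))).mul h2).continuousWithinAt
  have := integral_Ioi_of_hasDerivAt_of_tendsto hcont hd
    ((iL.const_mul (α * n)).sub (iK.const_mul (2 * α * (n - 1)))) hlim
  rw [integral_sub (iL.const_mul _) (iK.const_mul _), integral_const_mul, integral_const_mul] at this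
  simp only [hF, Real.zero_rpow hαn.ne', mul_zero, sub_zero] at this
  refine mul_left_cancel₀ hα.ne' ?_
  linear_combination this

theorem bliss_pointwise {ρ τ τ' c v q : ℝ} (hε : 0 < ε) (hα : 0 < α) (hn : 2 < n) (hρ : 0 < ρ)
    (hτ : 0 < τ) (hc : 0 < c) (hv : 0 < v) (hq : q = 2 * n / (n - 2))
    (hτ' : τ' = c * (v ^ q * ρ ^ (α * n - 1)) / ((ε + τ ^ (2 * α)) ^ (-n) * τ ^ (α * n - 1))) :
    α * n * c ^ (1 / n) * (v ^ q * ρ ^ (α * n - 1) * (ε + τ ^ (2 * α))) ≤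
      (α * τ ^ (α - 1) * τ' * ρ ^ (α * (n - 1)) +
        τ ^ α * (α * (n - 1) * ρ ^ (α * (n - 1) - 1))) * v ^ (q / 2 + 1) := by
  have hS : 0 < ε + τ ^ (2 * α) := by positivity
  set S := ε + τ ^ (2 * α) with hSdef
  have hn0 : 0 < n := by linarith
  have hn2 : n - 2 ≠ 0 := by linarith
  have hτ'0 : 0 < τ' := by rw [hτ']; positivity
  have hlog : Real.log τ' = Real.log c + q * Real.log v + (α * n - 1) * Real.log ρ +
      n * Real.log S - (α * n - 1) * Real.log τ := by
    rw [hτ', Real.log_div (by positivity) (by positivity), Real.log_mul hc.ne' (by positivity),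
      Real.log_mul (by positivity) (by positivity), Real.log_mul (by positivity) (by positivity),
      Real.log_rpow hv, Real.log_rpow hρ, Real.log_rpow hS, Real.log_rpow hτ]
    ring
  set P := τ ^ (α - 1) * τ' * ρ ^ (α * (n - 1)) with hP
  set Q := τ ^ α * ρ ^ (α * (n - 1) - 1) with hQ
  have hP0 : 0 < P := by positivity
  have hQ0 : 0 < Q := by positivity
  have amgm := Real.geom_mean_le_arith_mean2_weighted (w₁ := 1 / n) (w₂ := 1 - 1 / n)
    (by positivity) (by rw [sub_nonneg, div_le_one hn0]; linarith) hP0.le hQ0.le (by ring)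
  have key : P ^ (1 / n) * Q ^ (1 - 1 / n) * v ^ (q / 2 + 1) =
      c ^ (1 / n) * (v ^ q * ρ ^ (α * n - 1) * S) := by
    refine Real.log_injOn_pos (mem_Ioi.2 (by positivity)) (mem_Ioi.2 (by positivity)) ?_
    rw [Real.log_mul (by positivity) (by positivity), Real.log_mul (by positivity) (by positivity),
      Real.log_mul (by positivity) (by positivity), Real.log_mul (by positivity) (by positivity),
      Real.log_mul (by positivity) (by positivity),
      Real.log_rpow hP0, Real.log_rpow hQ0, Real.log_rpow hv, Real.log_rpow hv, Real.log_rpow hρ,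
      Real.log_rpow hc, hP, hQ,
      Real.log_mul (by positivity) (by positivity), Real.log_mul (by positivity) (by positivity),
      Real.log_mul (by positivity) (by positivity),
      Real.log_rpow hτ, Real.log_rpow hτ, Real.log_rpow hρ, Real.log_rpow hρ, hlog, hq]
    field_simp
    ring
  calc α * n * c ^ (1 / n) * (v ^ q * ρ ^ (α * n - 1) * S)
      = α * n * (P ^ (1 / n) * Q ^ (1 - 1 / n)) * v ^ (q / 2 + 1) := by
        rw [mul_assoc, ← key]; ring
    _ ≤ α * n * (1 / n * P + (1 - 1 / n) * Q) * v ^ (q / 2 + 1) := by gcongr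
    _ = _ := by
        rw [hP, hQ]
        field_simp

end BlissKernel

/-- Among sets of given volume, the centred ball maximises the integral of `‖x‖ ^ (-b)`. -/
theorem setLIntegral_norm_rpow_neg_le {d : ℕ} (hd : d ≠ 0) {b : ℝ} (hb : 0 ≤ b)
    {A : Set (EuclideanSpace ℝ (Fin d))} (hA : MeasurableSet A) {r : ℝ} (hr : 0 ≤ r)
    (h : volume A = volume (Metric.ball (0 : EuclideanSpace ℝ (Fin d)) r)) :
    ∫⁻ x in A, ENNReal.ofReal (‖x‖ ^ (-b)) ≤
      ∫⁻ x in Metric.ball (0 : EuclideanSpace ℝ (Fin d)) r, ENNReal.ofReal (‖x‖ ^ (-b)) := by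
  have : NeZero d := ⟨hd⟩
  rcases hr.eq_or_lt with rfl | hr
  · rw [Metric.ball_zero, measure_empty] at h
    rw [Measure.restrict_eq_zero.2 h]
    simp
  set B := Metric.ball (0 : EuclideanSpace ℝ (Fin d)) r with hB
  have hBm : MeasurableSet B := measurableSet_ball
  have hfin : volume B ≠ ∞ := measure_ball_lt_top.ne
  have hdiff : volume (A \ B) = volume (B \ A) := by
    have h1 := measure_inter_add_sdiff (μ := volume) A hBm
    have h2 := measure_inter_add_sdiff (μ := volume) B hA
    rw [inter_comm B A, ← h, ← h1] at h2
    refine ((ENNReal.add_right_inj ?_).1 h2).symm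
    exact ((measure_mono inter_subset_right).trans_lt hfin.lt_top).ne
  rw [← lintegral_inter_add_sdiff (μ := volume) _ A hBm,
    ← lintegral_inter_add_sdiff (μ := volume) _ B hA, inter_comm B A]
  refine add_le_add le_rfl ?_
  calc ∫⁻ x in A \ B, ENNReal.ofReal (‖x‖ ^ (-b))
      ≤ ∫⁻ x in A \ B, ENNReal.ofReal (r ^ (-b)) := by
        refine setLIntegral_mono measurable_const fun x hx => ENNReal.ofReal_le_ofReal ?_
        have : r ≤ ‖x‖ := by simpa [hB] using hx.2
        exact Real.rpow_le_rpow_of_nonpos hr this (by linarith)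
    _ = ∫⁻ x in B \ A, ENNReal.ofReal (r ^ (-b)) := by
        rw [setLIntegral_const, setLIntegral_const, hdiff]
    _ ≤ ∫⁻ x in B \ A, ENNReal.ofReal (‖x‖ ^ (-b)) := by
        refine lintegral_mono_ae ?_
        have h0 : ∀ᵐ x : EuclideanSpace ℝ (Fin d), x ≠ 0 := by
          rw [ae_iff]; simp
        filter_upwards [ae_restrict_mem (hBm.diff hA), ae_restrict_of_ae h0] with x hx hx0
        refine ENNReal.ofReal_le_ofReal (Real.rpow_le_rpow_of_nonpos (norm_pos_iff.2 hx0) ?_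
          (by linarith))
        have : ‖x‖ < r := by simpa [hB] using hx.1
        exact this.le

namespace IsRearrangement

variable {d : ℕ} {u : EuclideanSpace ℝ (Fin d) → ℝ} {R U : ℝ → ℝ}

theorem U_mul_pow_le (h : IsRearrangement u R U) (hd : d ≠ 0) {C : ℝ}
    (hC : ∀ x, u x * ‖x‖ ^ d ≤ C) {ρ : ℝ} (hρ : 0 < ρ) : U ρ * ρ ^ d ≤ C := by
  have : NeZero d := ⟨hd⟩
  have hC0 : 0 ≤ C := by simpa [hd] using hC 0
  have hU := h.U_pos ρ hρ
  set r := (C / U ρ) ^ ((d : ℝ)⁻¹) with hr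
  have hr0 : 0 ≤ r := by positivity
  have hrd : r ^ d = C / U ρ := Real.rpow_inv_natCast_pow (by positivity) hd
  have hsub : {x | U ρ < u x} ⊆ Metric.closedBall 0 r := by
    intro x hx
    have hx : U ρ < u x := hx
    have h1 : U ρ * ‖x‖ ^ d ≤ C := (mul_le_mul_of_nonneg_right hx.le (by positivity)).trans (hC x)
    have : ‖x‖ ^ d ≤ r ^ d := by rw [hrd, le_div_iff₀ hU]; linarith
    simpa using le_of_pow_le_pow_left₀ hd hr0 this
  have := measure_mono (μ := volume) hsub
  rw [h.vol _ hU, h.R_U ρ hρ, Measure.addHaar_closedBall_eq_addHaar_ball,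
    volume_ball_eq_ofReal hd hρ.le, volume_ball_eq_ofReal hd hr0,
    ENNReal.ofReal_le_ofReal_iff (mul_nonneg ball_one_pos.le (by positivity))] at this
  have := le_of_mul_le_mul_left this ball_one_pos
  rw [hrd, le_div_iff₀ hU] at this
  linarith

theorem U_le (h : IsRearrangement u R U) (hd : d ≠ 0) {C : ℝ} (hC : ∀ x, u x ≤ C) {ρ : ℝ}
    (hρ : 0 < ρ) : U ρ ≤ C := by
  have : NeZero d := ⟨hd⟩
  by_contra! hlt
  have hU := h.U_pos ρ hρ
  have e : {x | U ρ < u x} = ∅ := by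
    ext x; simpa using (hC x).trans hlt.le
  have := h.vol _ hU
  rw [e, measure_empty, h.R_U ρ hρ] at this
  exact (Metric.measure_ball_pos volume (0 : EuclideanSpace ℝ (Fin d)) hρ).ne this

theorem integrableOn (h : IsRearrangement u R U) (hd : d ≠ 0) {C : ℝ} (hC : ∀ x, u x ≤ C)
    (hC' : ∀ x, u x * ‖x‖ ^ d ≤ C) {q a : ℝ} (hq : 0 ≤ q) (ha : -1 < a) (hadq : a - d * q < -1) :
    IntegrableOn (fun ρ => U ρ ^ q * ρ ^ a) (Ioi 0) := by
  have hC0 : 0 ≤ C := by simpa [hd] using hC' 0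
  have hcont : ContinuousOn (fun ρ => U ρ ^ q * ρ ^ a) (Ioi 0) :=
    (h.cont_U.rpow_const fun x _ => Or.inr hq).mul
      (continuousOn_id.rpow_const fun x hx => Or.inl (ne_of_gt hx))
  have hsm : AEStronglyMeasurable (fun ρ => U ρ ^ q * ρ ^ a) (volume.restrict (Ioi 0)) :=
    hcont.aestronglyMeasurable measurableSet_Ioi
  rw [← Ioc_union_Ioi_eq_Ioi zero_le_one]
  refine IntegrableOn.union ?_ ?_
  · have hi : IntegrableOn (fun ρ : ℝ => C ^ q * ρ ^ a) (Ioc 0 1) :=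
      Integrable.const_mul ((intervalIntegrable_iff_integrableOn_Ioc_of_le zero_le_one).1
        (intervalIntegral.intervalIntegrable_rpow' ha)) _
    refine Integrable.mono' hi (hsm.mono_measure (Measure.restrict_mono Ioc_subset_Ioi_self le_rfl))
      ((ae_restrict_mem measurableSet_Ioc).mono fun ρ hρ => ?_)
    have hρ0 : 0 < ρ := hρ.1
    have := h.U_pos ρ hρ0
    rw [Real.norm_of_nonneg (by positivity)]
    exact mul_le_mul_of_nonneg_right (Real.rpow_le_rpow this.le (h.U_le hd hC hρ0) hq)
      (by positivity)
  · have hi : IntegrableOn (fun ρ : ℝ => C ^ q * ρ ^ (a - d * q)) (Ioi 1) :=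
      (integrableOn_Ioi_rpow_of_lt hadq one_pos).const_mul _
    refine Integrable.mono' hi (hsm.mono_measure
      (Measure.restrict_mono (Ioi_subset_Ioi zero_le_one) le_rfl))
      ((ae_restrict_mem measurableSet_Ioi).mono fun ρ hρ => ?_)
    have hρ0 : 0 < ρ := zero_lt_one.trans hρ
    have hU := h.U_pos ρ hρ0
    rw [Real.norm_of_nonneg (by positivity), sub_eq_neg_add, Real.rpow_add hρ0, ← mul_assoc]
    refine mul_le_mul_of_nonneg_right ?_ (by positivity)
    have h1 : U ρ ≤ C * ρ ^ (-(d : ℝ)) := by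
      rw [Real.rpow_neg hρ0.le, Real.rpow_natCast, ← div_eq_mul_inv, le_div_iff₀ (by positivity)]
      exact h.U_mul_pow_le hd hC' hρ0
    calc U ρ ^ q ≤ (C * ρ ^ (-(d : ℝ))) ^ q := Real.rpow_le_rpow hU.le h1 hq
      _ = C ^ q * ρ ^ (-((d : ℝ) * q)) := by
        rw [Real.mul_rpow hC0 (by positivity), ← Real.rpow_mul hρ0.le, neg_mul]

/-- The weighted integral does not decrease under rearrangement. -/
theorem lintegral_le (h : IsRearrangement u R U) (hd : d ≠ 0) (hu : Continuous u)
    (hpos : ∀ x, 0 < u x) {q b : ℝ} (hq : 0 < q) (hb : 0 ≤ b) :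
    ∫⁻ x, ENNReal.ofReal (‖x‖ ^ (-b) * u x ^ q) ≤
      ENNReal.ofReal (d * volume.real (Metric.ball (0 : EuclideanSpace ℝ (Fin d)) 1)) *
        ∫⁻ ρ in Ioi 0, ENNReal.ofReal (U ρ ^ q * ρ ^ ((d : ℝ) - 1 - b)) := by
  have : NeZero d := ⟨hd⟩
  set U' : ℝ → ℝ := (Ioi 0).indicator U with hU'
  have hU'm : Measurable U' := by
    classical
    rw [hU', ← piecewise_eq_indicator]
    exact h.cont_U.measurable_piecewise continuousOn_const measurableSet_Ioi
  have hwm : Measurable fun x : EuclideanSpace ℝ (Fin d) => ENNReal.ofReal (‖x‖ ^ (-b)) := by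
    fun_prop
  set μ := (volume : Measure (EuclideanSpace ℝ (Fin d))).withDensity
    fun x => ENNReal.ofReal (‖x‖ ^ (-b)) with hμ
  have hum : Measurable fun x => ENNReal.ofReal (u x ^ q) := by
    have := hu.measurable
    fun_prop
  have e1 : ∫⁻ x, ENNReal.ofReal (‖x‖ ^ (-b) * u x ^ q) = ∫⁻ x, ENNReal.ofReal (u x ^ q) ∂μ := by
    rw [hμ, lintegral_withDensity_eq_lintegral_mul _ hwm hum]
    refine lintegral_congr fun x => ?_
    rw [Pi.mul_apply, ENNReal.ofReal_mul (by positivity)]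
  have hm2 : Measurable fun ρ : ℝ => ENNReal.ofReal (U' ρ ^ q) := by fun_prop
  have hm3 : Measurable fun x : EuclideanSpace ℝ (Fin d) => ENNReal.ofReal (U' ‖x‖ ^ q) :=
    hm2.comp measurable_norm
  have e2 : ENNReal.ofReal (d * volume.real (Metric.ball (0 : EuclideanSpace ℝ (Fin d)) 1)) *
        ∫⁻ ρ in Ioi 0, ENNReal.ofReal (U ρ ^ q * ρ ^ ((d : ℝ) - 1 - b)) =
      ∫⁻ x, ENNReal.ofReal (U' ‖x‖ ^ q) ∂μ := by
    rw [hμ, lintegral_withDensity_eq_lintegral_mul _ hwm hm3]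
    have := lintegral_fun_norm hd (φ := fun ρ => ENNReal.ofReal (ρ ^ (-b)) *
      ENNReal.ofReal (U' ρ ^ q)) (by fun_prop)
    refine Eq.trans ?_ this.symm
    congr 1
    refine setLIntegral_congr_fun measurableSet_Ioi fun ρ hρ => ?_
    have hρ0 : 0 < ρ := hρ
    have hU0 := h.U_pos ρ hρ0
    simp only [hU', indicator_of_mem hρ]
    rw [← ENNReal.ofReal_mul (by positivity), ← ENNReal.ofReal_mul (by positivity),
      show (d : ℝ) - 1 - b = ((d : ℝ) - 1) + (-b) by ring, Real.rpow_add hρ0, ← Real.rpow_natCast,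
      Nat.cast_sub (Nat.one_le_iff_ne_zero.2 hd)]
    congr 1
    push_cast
    ring
  rw [e1, e2, ENNReal.lintegral_eq_lintegral_lt μ hum,
    ENNReal.lintegral_eq_lintegral_lt μ hm3]
  refine setLIntegral_mono_ae' measurableSet_Ioi (Eventually.of_forall fun t ht => ?_)
  have ht : 0 < t := ht
  set s := t ^ q⁻¹ with hs
  have hs0 : 0 < s := by positivity
  have hts : ∀ v ≥ 0, ENNReal.ofReal t < ENNReal.ofReal (v ^ q) ↔ s < v := fun v hv => by
    rw [ENNReal.ofReal_lt_ofReal_iff_of_nonneg ht.le, hs, Real.rpow_inv_lt_iff_of_pos ht.le hv hq]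
  have s1 : {x | ENNReal.ofReal t < ENNReal.ofReal (u x ^ q)} = {x | s < u x} := by
    ext x; exact hts _ (hpos x).le
  have hU'0 : ∀ ρ, 0 ≤ U' ρ := fun ρ => indicator_nonneg (fun ρ hρ => (h.U_pos ρ hρ).le) ρ
  have s2 : {x : EuclideanSpace ℝ (Fin d) | ENNReal.ofReal t < ENNReal.ofReal (U' ‖x‖ ^ q)} =
      {x | s < U' ‖x‖} := by
    ext x; exact hts _ (hU'0 _)
  have s3 : Metric.ball (0 : EuclideanSpace ℝ (Fin d)) (R s) \ {0} ⊆ {x | s < U' ‖x‖} := by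
    rintro x ⟨hx, hx0⟩
    have hx0 : 0 < ‖x‖ := norm_pos_iff.2 hx0
    have hx : ‖x‖ < R s := by simpa using hx
    simp only [mem_ofPred_eq, hU', indicator_of_mem (mem_Ioi.2 hx0)]
    exact (h.lt_iff _ hx0 s hs0).1 hx
  have hms : MeasurableSet {x | s < u x} := measurableSet_lt measurable_const hu.measurable
  rw [s1, s2]
  refine le_trans ?_ (measure_mono s3)
  have hμ0 : μ {0} = 0 := withDensity_absolutelyContinuous _ _ (by simp)
  rw [measure_sdiff_null hμ0, hμ, withDensity_apply _ hms, withDensity_apply _ measurableSet_ball]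
  exact setLIntegral_norm_rpow_neg_le hd hb hms (h.nonneg s) (h.vol s hs0)

/-- Radial functions of the radius have the law of the norm. -/
theorem lintegral_comp (h : IsRearrangement u R U) (hd : d ≠ 0) (hu : Continuous u)
    {φ : ℝ → ℝ≥0∞} (hφ : Measurable φ) :
    ∫⁻ x, φ (R (u x)) =
      ENNReal.ofReal (d * volume.real (Metric.ball (0 : EuclideanSpace ℝ (Fin d)) 1)) *
        ∫⁻ y in Ioi (0 : ℝ), ENNReal.ofReal (y ^ (d - 1)) * φ y := by
  have hm : Measurable fun x => R (u x) := h.meas.comp hu.measurable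
  rw [← lintegral_fun_norm hd hφ, ← lintegral_map hφ hm, ←
    lintegral_map hφ measurable_norm]
  exact congrArg (fun μ : Measure ℝ => ∫⁻ y, φ y ∂μ) h.map_eq

end IsRearrangement

theorem lintegral_deriv_le {F F' : ℝ → ℝ} (hF0 : F 0 = 0) (hc : Tendsto F (𝓝[>] 0) (𝓝 0))
    (hd : ∀ x > 0, HasDerivAt F (F' x) x) (hF' : ∀ x > 0, 0 ≤ F' x) {r : ℝ} (hr : 0 ≤ r) :
    ∫⁻ x in Ioo 0 r, ENNReal.ofReal (F' x) ≤ ENNReal.ofReal (F r) := by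
  have hcont : ContinuousOn F (Icc 0 r) := by
    intro x hx
    rcases hx.1.eq_or_lt with rfl | h
    · refine ContinuousWithinAt.mono ?_ Icc_subset_Ici_self
      rw [← continuousWithinAt_Ioi_iff_Ici, ContinuousWithinAt, hF0]
      exact hc
    · exact (hd x h).continuousAt.continuousWithinAt
  have hi : IntegrableOn F' (Ioc 0 r) := intervalIntegral.integrableOn_deriv_of_nonneg hcont
    (fun x hx => hd x hx.1) fun x hx => hF' x hx.1
  have he := intervalIntegral.integral_eq_sub_of_hasDerivAt_of_le hr hcont
    (fun x hx => hd x hx.1) ((intervalIntegrable_iff_integrableOn_Ioc_of_le hr).2 hi)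
  rw [hF0, sub_zero, intervalIntegral.integral_of_le hr] at he
  rw [← he, restrict_Ioo_eq_restrict_Ioc]
  exact (ofReal_integral_eq_lintegral_ofReal hi
    ((ae_restrict_mem measurableSet_Ioc).mono fun x hx => hF' x hx.1)).ge

theorem lintegral_Ioo_rpow {s v : ℝ} (hs : 0 ≤ s) (hv : 0 ≤ v) :
    ∫⁻ t in Ioo 0 v, ENNReal.ofReal (t ^ s) = ENNReal.ofReal (v ^ (s + 1) / (s + 1)) := by
  have he := integral_rpow (a := 0) (b := v) (r := s) (Or.inl (by linarith))
  rw [Real.zero_rpow (by linarith), sub_zero, intervalIntegral.integral_of_le hv] at he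
  rw [← he, restrict_Ioo_eq_restrict_Ioc]
  refine (ofReal_integral_eq_lintegral_ofReal ?_ ?_).symm
  · exact (intervalIntegrable_iff_integrableOn_Ioc_of_le hv).1
      (intervalIntegral.intervalIntegrable_rpow' (by linarith))
  · exact (ae_restrict_mem measurableSet_Ioc).mono fun x hx => Real.rpow_nonneg hx.1.le _

/-- Pointwise slope bound `D` together with an integrable uniform slope bound `B`. -/
structure IsSlopeBound {d : ℕ} (u D B : EuclideanSpace ℝ (Fin d) → ℝ) : Prop where
  nonneg : ∀ x, 0 ≤ D x
  meas : Measurable D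
  le : ∀ x, ∀ c > D x, ∀ᶠ y in 𝓝 x, u y ≤ u x + c * dist y x
  nonneg' : ∀ x, 0 ≤ B x
  le' : ∀ x y, dist y x < 1 → u y ≤ u x + B x * dist y x
  lintegral_ne_top : ∫⁻ x, ENNReal.ofReal (B x) ≠ ∞

namespace IsRearrangement

variable {d : ℕ} {u D B : EuclideanSpace ℝ (Fin d) → ℝ} {R U : ℝ → ℝ}

theorem lintegral_swap (h : IsRearrangement u R U) {s : ℝ} (hs : 0 ≤ s) {f : ℝ → ℝ≥0∞}
    (hf : AEMeasurable f (volume.restrict (Ioi 0))) :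
    ∫⁻ t in Ioi 0, ENNReal.ofReal (t ^ s) * ∫⁻ ρ in Ioo 0 (R t), f ρ =
      ∫⁻ ρ in Ioi 0, f ρ * ENNReal.ofReal (U ρ ^ (s + 1) / (s + 1)) := by
  set S : Set (ℝ × ℝ) := {p | p.2 < R p.1} with hS
  have hSm : MeasurableSet S := measurableSet_lt measurable_snd (h.meas.comp measurable_fst)
  calc ∫⁻ t in Ioi 0, ENNReal.ofReal (t ^ s) * ∫⁻ ρ in Ioo 0 (R t), f ρ
      = ∫⁻ t in Ioi (0 : ℝ), ∫⁻ ρ in Ioi (0 : ℝ),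
          S.indicator (fun p => ENNReal.ofReal (p.1 ^ s) * f p.2) (t, ρ) := by
        refine lintegral_congr fun t => ?_
        have e : ∀ ρ, S.indicator (fun p => ENNReal.ofReal (p.1 ^ s) * f p.2) (t, ρ) =
            ENNReal.ofReal (t ^ s) * (Iio (R t)).indicator f ρ := fun ρ => by
          by_cases hρ : ρ < R t
          · rw [indicator_of_mem (by exact hρ), indicator_of_mem (by exact hρ)]
          · rw [indicator_of_notMem (by exact hρ), indicator_of_notMem (by exact hρ), mul_zero]
        simp_rw [e]
        rw [lintegral_const_mul' _ _ ENNReal.ofReal_ne_top, lintegral_indicator measurableSet_Iio,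
          Measure.restrict_restrict measurableSet_Iio, inter_comm, Ioi_inter_Iio]
    _ = ∫⁻ ρ in Ioi (0 : ℝ), ∫⁻ t in Ioi (0 : ℝ),
          S.indicator (fun p => ENNReal.ofReal (p.1 ^ s) * f p.2) (t, ρ) := by
        refine lintegral_lintegral_swap ?_
        refine AEMeasurable.indicator ?_ hSm
        refine AEMeasurable.mul (Measurable.aemeasurable (by fun_prop)) ?_
        exact hf.comp_quasiMeasurePreserving Measure.quasiMeasurePreserving_snd
    _ = _ := by
        refine setLIntegral_congr_fun measurableSet_Ioi fun ρ hρ => ?_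
        have hρ : 0 < ρ := hρ
        rw [← lintegral_Ioo_rpow hs (h.U_pos ρ hρ).le, ← Ioi_inter_Iio, inter_comm,
          ← Measure.restrict_restrict measurableSet_Iio, ← lintegral_indicator measurableSet_Iio,
          mul_comm, ← lintegral_mul_const _ (Measurable.indicator (by fun_prop) measurableSet_Iio)]
        refine setLIntegral_congr_fun measurableSet_Ioi fun t ht => ?_
        have := h.lt_iff ρ hρ t ht
        by_cases hlt : ρ < R t
        · rw [indicator_of_mem (by exact hlt), indicator_of_mem (by exact this.1 hlt)]
        · rw [indicator_of_notMem (by exact hlt), indicator_of_notMem (by exact fun h' => hlt (this.2 h')),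
            zero_mul]

theorem lintegral_radial_le (h : IsRearrangement u R U) (hs : IsSlopeBound u D B) (hd : 2 ≤ d)
    (hu : Continuous u) (hpos : ∀ x, 0 < u x) {g : ℝ → ℝ} (hg : ContinuousOn g (Ioi 0))
    (hg0 : ∀ x > 0, 0 ≤ g x) :
    ENNReal.ofReal (d * volume.real (Metric.ball (0 : EuclideanSpace ℝ (Fin d)) 1)) *
      ∫⁻ t in Ioi 0, ENNReal.ofReal ((Ioi 0).indicator g (R t) * R t ^ (d - 1)) ≤
    (ENNReal.ofReal (d * volume.real (Metric.ball (0 : EuclideanSpace ℝ (Fin d)) 1)) *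
      ∫⁻ ρ in Ioi 0, ENNReal.ofReal (g ρ ^ 2 * ρ ^ (d - 1))) ^ (1 / 2 : ℝ) *
    (∫⁻ x, ENNReal.ofReal (D x ^ 2)) ^ (1 / 2 : ℝ) := by
  classical
  have hd0 : d ≠ 0 := by omega
  set G : ℝ → ℝ := (Ioi 0).indicator g with hG
  have hGm : Measurable G := by
    rw [hG, ← piecewise_eq_indicator]
    exact hg.measurable_piecewise continuousOn_const measurableSet_Ioi
  have hG0 : ∀ ρ, 0 ≤ G ρ := fun ρ => indicator_nonneg (fun ρ hρ => hg0 ρ hρ) ρ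
  have hRm := h.meas
  have hum := hu.measurable
  have hDm := hs.meas
  have step : ∀ k : ℕ,
      ENNReal.ofReal (d * volume.real (Metric.ball (0 : EuclideanSpace ℝ (Fin d)) 1)) *
        ∫⁻ t in Ioi 0, ENNReal.ofReal (min (G (R t)) k * R t ^ (d - 1)) ≤
      ∫⁻ x, ENNReal.ofReal (G (R (u x))) * ENNReal.ofReal (D x) := by
    intro k
    refine (lintegral_mul_radius_pow_le hd (G := fun t => min (G (R t)) k) (C := k) hu h.nonneg
      h.vol (by fun_prop) (fun t => le_min (hG0 _) k.cast_nonneg) (fun t => min_le_right _ _) ?_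
      hs.nonneg hs.le hs.nonneg' hs.le' hs.lintegral_ne_top).trans ?_
    · filter_upwards [h.ae_pos] with x hx
      refine ContinuousAt.continuousWithinAt (?_ : ContinuousAt (fun t => min (G (R t)) k) _)
      refine Filter.Tendsto.min ?_ tendsto_const_nhds
      change ContinuousAt (fun t => G (R t)) (u x)
      refine ContinuousAt.comp (g := G) ?_ (h.cont.continuousAt (Ioi_mem_nhds (hpos x)))
      refine (hg.continuousAt (Ioi_mem_nhds hx)).congr ?_
      filter_upwards [Ioi_mem_nhds hx] with y hy
      rw [hG, indicator_of_mem hy]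
    · refine lintegral_mono fun x => ?_
      rw [← ENNReal.ofReal_mul (hG0 _)]
      exact ENNReal.ofReal_le_ofReal (mul_le_mul_of_nonneg_right (min_le_left _ _) (hs.nonneg x))
  have hlim : Tendsto (fun k : ℕ => ∫⁻ t in Ioi 0, ENNReal.ofReal (min (G (R t)) k * R t ^ (d - 1)))
      atTop (𝓝 (∫⁻ t in Ioi 0, ENNReal.ofReal (G (R t) * R t ^ (d - 1)))) := by
    refine lintegral_tendsto_of_tendsto_of_monotone
      (fun k => Measurable.aemeasurable (by fun_prop)) ?_ ?_
    · refine Eventually.of_forall fun t k l hkl => ENNReal.ofReal_le_ofReal ?_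
      refine mul_le_mul_of_nonneg_right (min_le_min le_rfl (by exact_mod_cast hkl)) ?_
      have := h.nonneg t
      positivity
    · refine Eventually.of_forall fun t => tendsto_const_nhds.congr' ?_
      filter_upwards [eventually_ge_atTop ⌈G (R t)⌉₊] with k hk
      rw [min_eq_left (Nat.ceil_le.1 hk)]
  have hle : ENNReal.ofReal (d * volume.real (Metric.ball (0 : EuclideanSpace ℝ (Fin d)) 1)) *
        ∫⁻ t in Ioi 0, ENNReal.ofReal (G (R t) * R t ^ (d - 1)) ≤
      ∫⁻ x, ENNReal.ofReal (G (R (u x))) * ENNReal.ofReal (D x) :=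
    le_of_tendsto (ENNReal.Tendsto.const_mul hlim (Or.inr ENNReal.ofReal_ne_top))
      (Eventually.of_forall step)
  refine hle.trans ?_
  refine (ENNReal.lintegral_mul_le_Lp_mul_Lq volume Real.HolderConjugate.two_two
    (Measurable.aemeasurable (by fun_prop)) (Measurable.aemeasurable (by fun_prop))).trans ?_
  refine mul_le_mul' (le_of_eq ?_) (le_of_eq ?_)
  · congr 1
    rw [h.lintegral_comp hd0 hu (φ := fun ρ => ENNReal.ofReal (G ρ) ^ (2 : ℝ)) (by fun_prop)]
    congr 1
    refine setLIntegral_congr_fun measurableSet_Ioi fun ρ hρ => ?_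
    have hρ0 : 0 < ρ := hρ
    simp only [hG, indicator_of_mem hρ]
    rw [ENNReal.rpow_two, ← ENNReal.ofReal_pow (hg0 ρ hρ0), ← ENNReal.ofReal_mul (by positivity),
      mul_comm]
  · congr 1
    refine lintegral_congr fun x => ?_
    rw [ENNReal.rpow_two, ← ENNReal.ofReal_pow (hs.nonneg x)]

end IsRearrangement

/-- The integral `∫ (ε + τ ^ (2 α)) ^ (-n) τ ^ (α n - 1)`. -/
noncomputable def blissMass (ε α n : ℝ) : ℝ :=
  ∫ τ in Ioi (0 : ℝ), (ε + τ ^ (2 * α)) ^ (-n) * τ ^ (α * n - 1)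

/-- The integral `∫ (ε + τ ^ (2 α)) ^ (-n) τ ^ (α n - 1 + 2 α)`. -/
noncomputable def blissEnergy (ε α n : ℝ) : ℝ :=
  ∫ τ in Ioi (0 : ℝ), (ε + τ ^ (2 * α)) ^ (-n) * τ ^ (α * n - 1 + 2 * α)

section

variable {ε α n : ℝ}

theorem integrableOn_blissMass (hε : 0 < ε) (hα : 0 < α) (hn : 2 < n) :
    IntegrableOn (fun τ : ℝ => (ε + τ ^ (2 * α)) ^ (-n) * τ ^ (α * n - 1)) (Ioi 0) := by
  have : 0 < α * n := by positivity
  exact integrableOn_bliss hε (by linarith) (by linarith) (by linarith)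

theorem integrableOn_blissEnergy (hε : 0 < ε) (hα : 0 < α) (hn : 2 < n) :
    IntegrableOn (fun τ : ℝ => (ε + τ ^ (2 * α)) ^ (-n) * τ ^ (α * n - 1 + 2 * α)) (Ioi 0) := by
  have : 0 < α * n := by positivity
  have : 0 < α * (n - 2) := mul_pos hα (by linarith)
  exact integrableOn_bliss hε (by linarith) (by linarith) (by linarith)

theorem blissMass_pos (hε : 0 < ε) (hα : 0 < α) (hn : 2 < n) : 0 < blissMass ε α n := by
  have : 0 < α * n := by positivity
  exact integral_bliss_pos hε (by linarith) (by linarith) (by linarith)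

theorem blissEnergy_pos (hε : 0 < ε) (hα : 0 < α) (hn : 2 < n) : 0 < blissEnergy ε α n := by
  have : 0 < α * n := by positivity
  have : 0 < α * (n - 2) := mul_pos hα (by linarith)
  exact integral_bliss_pos hε (by linarith) (by linarith) (by linarith)

end

namespace IsRearrangement

variable {d : ℕ} {u D B : EuclideanSpace ℝ (Fin d) → ℝ} {R U : ℝ → ℝ}

/-- The sharp Hardy–Sobolev inequality, in terms of the one-dimensional integrals. -/
theorem lintegral_weight_le (h : IsRearrangement u R U) (hs : IsSlopeBound u D B) (hd : 3 ≤ d)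
    (hu : Continuous u) (hpos : ∀ x, 0 < u x) {C : ℝ} (hC : ∀ x, u x ≤ C)
    (hC' : ∀ x, u x * ‖x‖ ^ d ≤ C) {ε α n q E : ℝ} (hε : 0 < ε) (hα : 0 < α) (hα1 : α < 1)
    (hn : 2 < n) (hdn : (d : ℝ) = α * (n - 2) + 2) (hq : q = 2 * n / (n - 2)) (hE0 : 0 ≤ E)
    (hE : ∫⁻ x, ENNReal.ofReal (D x ^ 2) = ENNReal.ofReal E) :
    ∫⁻ x, ENNReal.ofReal (‖x‖ ^ (-(2 - 2 * α)) * u x ^ q) ≤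
      ENNReal.ofReal (d * volume.real (Metric.ball (0 : EuclideanSpace ℝ (Fin d)) 1) *
        blissMass ε α n * (E / (d * volume.real (Metric.ball (0 : EuclideanSpace ℝ (Fin d)) 1) *
          (α * (n - 2)) ^ 2 * blissEnergy ε α n)) ^ (q / 2)) := by
  have hd0 : d ≠ 0 := by omega
  have hn0 : 0 < n := by linarith
  have hn2 : 0 < n - 2 := by linarith
  have hq0 : 0 < q := by rw [hq]; positivity
  have hq1 : 1 ≤ q := by rw [hq, le_div_iff₀ hn2]; linarith
  have hαn : 0 < α * n := by positivity
  have hαn2 : 0 < α * (n - 2) := by positivity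
  set ν : ℝ := d * volume.real (Metric.ball (0 : EuclideanSpace ℝ (Fin d)) 1) with hν
  have hν0 : 0 < ν := mul_pos (by positivity) ball_one_pos
  set I := blissMass ε α n with hI
  set K := blissEnergy ε α n with hK
  have hI0 : 0 < I := blissMass_pos hε hα hn
  have hK0 : 0 < K := blissEnergy_pos hε hα hn
  set ker : ℝ → ℝ := fun τ => (ε + τ ^ (2 * α)) ^ (-n) * τ ^ (α * n - 1) with hker
  have hkc : ContinuousOn ker (Ioi 0) := continuousOn_bliss hε _ _ _
  have hki : IntegrableOn ker (Ioi 0) := integrableOn_blissMass hε hα hn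
  have hk0 : ∀ s > 0, 0 < ker s := fun s hs => by simp only [hker]; positivity
  set w : ℝ → ℝ := fun ρ => U ρ ^ q * ρ ^ (α * n - 1) with hw
  have hw0 : ∀ ρ > 0, 0 < w ρ := fun ρ hρ => by
    have := h.U_pos ρ hρ
    simp only [hw]; positivity
  have hrpow : ∀ a : ℝ, ContinuousOn (fun ρ : ℝ => ρ ^ a) (Ioi 0) := fun a =>
    continuousOn_id.rpow_const fun x hx => Or.inl (ne_of_gt hx)
  have hUpow : ∀ a : ℝ, ContinuousOn (fun ρ : ℝ => U ρ ^ a) (Ioi 0) := fun a =>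
    h.cont_U.rpow_const fun x hx => Or.inl (h.U_pos x hx).ne'
  have hwc : ContinuousOn w (Ioi 0) := (hUpow q).mul (hrpow _)
  have hwi : IntegrableOn w (Ioi 0) := by
    refine h.integrableOn hd0 hC hC' hq0.le (by linarith) ?_
    have : (d : ℝ) * 1 ≤ d * q := by gcongr
    nlinarith
  set M := ∫ ρ in Ioi 0, w ρ with hM
  have hM0 : 0 < M := by
    have := integral_mem_Ioo_of_pos hwc hwi hw0 one_pos
    exact this.1.trans this.2
  set c := I / M with hc
  have hc0 : 0 < c := by positivity
  obtain ⟨τ, hτ0, hτd, hτlim, hτinj, hτim⟩ := exists_transport (h := fun ρ => c * w ρ) hkc hki hk0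
    (continuousOn_const.mul hwc) (hwi.const_mul c) (fun ρ hρ => mul_pos hc0 (hw0 ρ hρ)) (by
      rw [integral_const_mul, ← hM, hc, div_mul_cancel₀ _ hM0.ne']; rfl)
  have hτc : ContinuousOn τ (Ioi 0) := fun ρ hρ => (hτd ρ hρ).continuousAt.continuousWithinAt
  have hτpow : ∀ a : ℝ, ContinuousOn (fun ρ : ℝ => τ ρ ^ a) (Ioi 0) := fun a =>
    hτc.rpow_const fun x hx => Or.inl (hτ0 x hx).ne'
  -- change of variables
  have hcv : ∀ ψ : ℝ → ℝ, (∀ s > 0, 0 ≤ ψ s) →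
      ∫⁻ ρ in Ioi 0, ENNReal.ofReal (c * w ρ * ψ (τ ρ)) =
        ∫⁻ s in Ioi 0, ENNReal.ofReal (ψ s * ker s) := by
    intro ψ hψ
    conv_rhs => rw [← hτim]
    rw [lintegral_image_eq_lintegral_abs_deriv_mul measurableSet_Ioi
      (fun ρ hρ => (hτd ρ hρ).hasDerivWithinAt) hτinj]
    refine setLIntegral_congr_fun measurableSet_Ioi fun ρ hρ => ?_
    have h1 := hw0 ρ hρ
    have h2 := hk0 _ (hτ0 ρ hρ)
    rw [abs_of_nonneg (by positivity), ← ENNReal.ofReal_mul (by positivity)]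
    congr 1
    field_simp
  have hcvK : ∫⁻ ρ in Ioi 0, ENNReal.ofReal (c * w ρ * τ ρ ^ (2 * α)) = ENNReal.ofReal K := by
    rw [hcv (fun s => s ^ (2 * α)) (fun s hs => by positivity), hK, blissEnergy,
      ofReal_integral_eq_lintegral_ofReal (integrableOn_blissEnergy hε hα hn)
        ((ae_restrict_mem measurableSet_Ioi).mono fun s (hs : 0 < s) => by positivity)]
    refine setLIntegral_congr_fun measurableSet_Ioi fun s (hs : 0 < s) => ?_
    simp only [hker]
    rw [Real.rpow_add hs]
    congr 1
    ring
  have hcvL : ∫⁻ ρ in Ioi 0, ENNReal.ofReal (c * w ρ * (ε + τ ρ ^ (2 * α))) =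
      ENNReal.ofReal (2 * (n - 1) / n * K) := by
    have hid := integral_bliss_identity hε hα hn
    rw [hcv (fun s => ε + s ^ (2 * α)) (fun s hs => by positivity)]
    have : 2 * (n - 1) / n * K =
        ∫ τ in Ioi (0 : ℝ), (ε + τ ^ (2 * α)) ^ (-(n - 1)) * τ ^ (α * n - 1) := by
      rw [hK, blissEnergy, div_mul_eq_mul_div, div_eq_iff hn0.ne', ← hid, mul_comm]
    rw [this, ofReal_integral_eq_lintegral_ofReal
      (integrableOn_bliss hε (by linarith) (by linarith) (by linarith))
        ((ae_restrict_mem measurableSet_Ioi).mono fun s (hs : 0 < s) => by positivity)]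
    refine setLIntegral_congr_fun measurableSet_Ioi fun s (hs : 0 < s) => ?_
    simp only [hker]
    rw [show -(n - 1) = -n + 1 by ring, Real.rpow_add (by positivity), Real.rpow_one]
    congr 1
    ring
  set g : ℝ → ℝ := fun ρ => U ρ ^ (q / 2) * τ ρ ^ α * ρ ^ (-(1 - α)) with hg
  have hgc : ContinuousOn g (Ioi 0) := ((hUpow _).mul (hτpow _)).mul (hrpow _)
  have hg0 : ∀ ρ > 0, 0 ≤ g ρ := fun ρ hρ => by
    have := h.U_pos ρ hρ
    have := hτ0 ρ hρ
    simp only [hg]; positivity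
  have hmain := h.lintegral_radial_le hs (by omega) hu hpos hgc hg0
  have hright : ∫⁻ ρ in Ioi 0, ENNReal.ofReal (g ρ ^ 2 * ρ ^ (d - 1)) = ENNReal.ofReal (K / c) := by
    have : ENNReal.ofReal (K / c) =
        ENNReal.ofReal c⁻¹ * ∫⁻ ρ in Ioi 0, ENNReal.ofReal (c * w ρ * τ ρ ^ (2 * α)) := by
      rw [hcvK, ← ENNReal.ofReal_mul (by positivity)]
      congr 1; ring
    rw [this, ← lintegral_const_mul' _ _ ENNReal.ofReal_ne_top]
    refine setLIntegral_congr_fun measurableSet_Ioi fun ρ (hρ : 0 < ρ) => ?_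
    have hUρ := h.U_pos ρ hρ
    have hτρ := hτ0 ρ hρ
    rw [← ENNReal.ofReal_mul (by positivity)]
    congr 1
    have e1 : U ρ ^ q = U ρ ^ (q / 2) * U ρ ^ (q / 2) := by
      rw [← Real.rpow_add hUρ]; congr 1; ring
    have e2 : τ ρ ^ (2 * α) = τ ρ ^ α * τ ρ ^ α := by
      rw [← Real.rpow_add hτρ]; congr 1; ring
    have e3 : ρ ^ (α * n - 1) = ρ ^ (-(1 - α)) * ρ ^ (-(1 - α)) * ρ ^ (d - 1) := by
      rw [← Real.rpow_natCast, ← Real.rpow_add hρ, ← Real.rpow_add hρ,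
        Nat.cast_sub (by omega : 1 ≤ d), hdn]
      congr 1; push_cast; ring
    simp only [hg, hw]
    rw [e1, e2, e3]
    field_simp
  set A' : ℝ → ℝ := fun ρ => α * τ ρ ^ (α - 1) * (c * w ρ / ker (τ ρ)) * ρ ^ (α * (n - 1)) +
        τ ρ ^ α * (α * (n - 1) * ρ ^ (α * (n - 1) - 1)) with hA'
  have hA'c : ContinuousOn A' (Ioi 0) := by
    refine ContinuousOn.add (((continuousOn_const.mul (hτpow _)).mul
      ((continuousOn_const.mul hwc).div (hkc.comp hτc fun ρ hρ => hτ0 ρ hρ)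
        fun ρ hρ => (hk0 _ (hτ0 ρ hρ)).ne')).mul (hrpow _))
      ((hτpow _).mul (continuousOn_const.mul (hrpow _)))
  have hκ : 0 < α * (n - 1) := mul_pos hα (by linarith)
  have hA'0 : ∀ ρ > 0, 0 ≤ A' ρ := fun ρ hρ => by
    have h1 := hτ0 ρ hρ
    have h2 := hw0 ρ hρ
    have h3 := hk0 _ h1
    simp only [hA']; positivity
  have hprim : ∀ r ≥ 0, ∫⁻ ρ in Ioo 0 r, ENNReal.ofReal (A' ρ) ≤
      ENNReal.ofReal (τ r ^ α * r ^ (α * (n - 1))) := by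
    intro r hr
    refine lintegral_deriv_le (F := fun r => τ r ^ α * r ^ (α * (n - 1)))
      (by simp [Real.zero_rpow hκ.ne']) ?_ (fun ρ hρ => ?_) hA'0 hr
    · have h1 : Tendsto (fun ρ : ℝ => ρ ^ (α * (n - 1))) (𝓝[>] 0) (𝓝 0) := by
        have := (Real.continuousAt_rpow_const 0 (α * (n - 1)) (Or.inr hκ.le)).tendsto
        rw [Real.zero_rpow hκ.ne'] at this
        exact this.mono_left nhdsWithin_le_nhds
      have h2 : Tendsto (fun ρ : ℝ => τ ρ ^ α) (𝓝[>] 0) (𝓝 0) := by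
        have := hτlim.rpow_const (p := α) (Or.inr hα.le)
        rwa [Real.zero_rpow hα.ne'] at this
      simpa using h2.mul h1
    · refine (((hτd ρ hρ).rpow_const (p := α) (Or.inl (hτ0 ρ hρ).ne')).mul
        (Real.hasDerivAt_rpow_const (p := α * (n - 1)) (Or.inl hρ.ne'))).congr_deriv ?_
      simp only [hA']
      ring
  set κ := α * n * c ^ (1 / n) / (c * (q / 2 + 1)) with hκdef
  have hκ0 : 0 < κ := by positivity
  have hleft : ENNReal.ofReal (κ * (2 * (n - 1) / n * K)) ≤
      ∫⁻ t in Ioi 0, ENNReal.ofReal ((Ioi 0).indicator g (R t) * R t ^ (d - 1)) := by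
    calc ENNReal.ofReal (κ * (2 * (n - 1) / n * K))
        = ∫⁻ ρ in Ioi 0, ENNReal.ofReal κ * ENNReal.ofReal (c * w ρ * (ε + τ ρ ^ (2 * α))) := by
          rw [lintegral_const_mul' _ _ ENNReal.ofReal_ne_top, hcvL, ← ENNReal.ofReal_mul hκ0.le]
      _ ≤ ∫⁻ ρ in Ioi 0, ENNReal.ofReal (A' ρ) *
            ENNReal.ofReal (U ρ ^ (q / 2 + 1) / (q / 2 + 1)) := by
          refine setLIntegral_mono_ae' measurableSet_Ioi
            (Eventually.of_forall fun ρ (hρ : 0 < ρ) => ?_)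
          have hUρ := h.U_pos ρ hρ
          rw [← ENNReal.ofReal_mul hκ0.le, ← ENNReal.ofReal_mul (hA'0 ρ hρ)]
          refine ENNReal.ofReal_le_ofReal ?_
          have hb := bliss_pointwise (τ' := c * w ρ / ker (τ ρ)) hε hα hn hρ (hτ0 ρ hρ) hc0 hUρ hq
            rfl
          rw [mul_div_assoc', le_div_iff₀ (by positivity)]
          refine le_trans (le_of_eq ?_) hb
          rw [hκdef]
          field_simp
          simp only [hw]
          ring
      _ = ∫⁻ t in Ioi 0, ENNReal.ofReal (t ^ (q / 2)) *
            ∫⁻ ρ in Ioo 0 (R t), ENNReal.ofReal (A' ρ) :=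
          (h.lintegral_swap (by positivity)
            (hA'c.aemeasurable measurableSet_Ioi).ennreal_ofReal).symm
      _ ≤ _ := by
          refine setLIntegral_mono_ae' measurableSet_Ioi
            (Eventually.of_forall fun t (ht : 0 < t) => ?_)
          rcases (h.nonneg t).eq_or_lt with h0 | h0
          · rw [← h0]; simp
          · refine (mul_le_mul' le_rfl (hprim _ h0.le)).trans ?_
            rw [← ENNReal.ofReal_mul (by positivity)]
            refine ENNReal.ofReal_le_ofReal (le_of_eq ?_)
            rw [indicator_of_mem (mem_Ioi.2 h0)]
            simp only [hg]
            rw [h.U_R t ht h0, mul_assoc, mul_assoc, ← Real.rpow_natCast,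
              ← Real.rpow_add h0, Nat.cast_sub (by omega : 1 ≤ d), hdn]
            congr 3
            push_cast; ring
  have hineq : ENNReal.ofReal (ν * (κ * (2 * (n - 1) / n * K))) ≤
      ENNReal.ofReal ((ν * (K / c)) ^ (1 / 2 : ℝ) * E ^ (1 / 2 : ℝ)) := by
    rw [hright, hE, ← ENNReal.ofReal_mul hν0.le, ENNReal.ofReal_rpow_of_nonneg (by positivity)
      (by positivity), ENNReal.ofReal_rpow_of_nonneg hE0 (by positivity),
      ← ENNReal.ofReal_mul (by positivity)] at hmain
    rw [ENNReal.ofReal_mul hν0.le]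
    exact (mul_le_mul' le_rfl hleft).trans hmain
  rw [ENNReal.ofReal_le_ofReal_iff (by positivity), ← Real.mul_rpow (by positivity) hE0,
    ← Real.sqrt_eq_rpow] at hineq
  have hn1 : 0 < n - 1 := by linarith
  have hsq := (Real.le_sqrt' (by positivity)).1 hineq
  have hκK : κ * (2 * (n - 1) / n * K) = α * (n - 2) * K * (c ^ (1 / n) / c) := by
    rw [hκdef, hq]
    field_simp
    ring
  rw [hκK] at hsq
  set X := E / (ν * (α * (n - 2)) ^ 2 * K) with hX
  have hX0 : c ^ (2 / n - 1) ≤ X := by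
    have e : c ^ (2 / n - 1) = (c ^ (1 / n)) ^ 2 / c := by
      rw [Real.rpow_sub_one hc0.ne', ← Real.rpow_mul_natCast hc0.le]
      congr 2; push_cast; ring
    rw [e, hX, le_div_iff₀ (by positivity)]
    have : (ν * (α * (n - 2) * K * (c ^ (1 / n) / c))) ^ 2 =
      ((c ^ (1 / n)) ^ 2 / c * (ν * (α * (n - 2)) ^ 2 * K)) * (ν * (K / c)) := by
      field_simp
    rw [this, mul_comm (ν * (K / c)) E] at hsq
    exact le_of_mul_le_mul_right hsq (by positivity)
  have hfin : M ≤ I * X ^ (q / 2) := by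
    have h1 : (c ^ (2 / n - 1)) ^ (q / 2) ≤ X ^ (q / 2) :=
      Real.rpow_le_rpow (by positivity) hX0 (by positivity)
    rw [← Real.rpow_mul hc0.le, show (2 / n - 1) * (q / 2) = -1 by
      rw [hq]; field_simp; ring, Real.rpow_neg_one] at h1
    have h2 : M = I * c⁻¹ := by rw [hc]; field_simp
    rw [h2]
    gcongr
  calc ∫⁻ x, ENNReal.ofReal (‖x‖ ^ (-(2 - 2 * α)) * u x ^ q)
      ≤ ENNReal.ofReal ν * ∫⁻ ρ in Ioi 0, ENNReal.ofReal
          (U ρ ^ q * ρ ^ ((d : ℝ) - 1 - (2 - 2 * α))) :=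
        h.lintegral_le hd0 hu hpos hq0 (by linarith)
    _ = ENNReal.ofReal ν * ENNReal.ofReal M := by
        congr 1
        rw [hM, ofReal_integral_eq_lintegral_ofReal hwi
          ((ae_restrict_mem measurableSet_Ioi).mono fun ρ hρ => (hw0 ρ hρ).le)]
        refine setLIntegral_congr_fun measurableSet_Ioi fun ρ _ => ?_
        simp only [hw]
        rw [show (d : ℝ) - 1 - (2 - 2 * α) = α * n - 1 by rw [hdn]; ring]
    _ ≤ _ := by
        rw [← ENNReal.ofReal_mul hν0.le, mul_assoc ν]
        exact ENNReal.ofReal_le_ofReal (mul_le_mul_of_nonneg_left hfin hν0.le)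

end IsRearrangement

theorem integrable_and_integral_radial {d : ℕ} {F : EuclideanSpace ℝ (Fin d) → ℝ} {g G : ℝ → ℝ}
    (hd : d ≠ 0) (hF : ∀ x ≠ 0, F x = g ‖x‖) (hG : ∀ y > 0, y ^ (d - 1) * g y = G y)
    (hGi : IntegrableOn G (Ioi 0)) :
    Integrable F ∧ ∫ x, F x =
      d * volume.real (Metric.ball (0 : EuclideanSpace ℝ (Fin d)) 1) * ∫ y in Ioi 0, G y := by
  have : NeZero d := ⟨hd⟩
  have hae : F =ᵐ[volume] fun x => g ‖x‖ := by
    filter_upwards [Measure.ae_ne volume (0 : EuclideanSpace ℝ (Fin d))] with x hx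
    exact hF x hx
  have hdim : Module.finrank ℝ (EuclideanSpace ℝ (Fin d)) = d := by simp
  constructor
  · rw [integrable_congr hae, integrable_fun_norm_addHaar, hdim]
    exact hGi.congr_fun (fun y hy => (hG y hy).symm) measurableSet_Ioi
  · rw [integral_congr_ae hae, integral_fun_norm_addHaar, hdim, nsmul_eq_mul, smul_eq_mul, mul_assoc]
    congr 2
    exact setIntegral_congr_fun measurableSet_Ioi fun y hy => hG y hy

section

variable {d : ℕ} {W : EuclideanSpace ℝ (Fin d) → ℝ} {A ε α n q : ℝ}

theorem norm_fderiv_bubble (hd : d ≠ 0) (hε : 0 < ε) (hα : 0 < α) (hn : 2 < n) (hA : 0 < A)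
    (hW : ∀ x, W x = A * (ε + ‖x‖ ^ (2 * α)) ^ (-((n - 2) / 2)))
    {x : EuclideanSpace ℝ (Fin d)} (hx : x ≠ 0) :
    ‖fderiv ℝ W x‖ =
      A * (α * (n - 2)) * (‖x‖ ^ (2 * α - 1) * (ε + ‖x‖ ^ (2 * α)) ^ (-(n / 2))) := by
  have : NeZero d := ⟨hd⟩
  have hx0 : 0 < ‖x‖ := norm_pos_iff.2 hx
  have hpos : 0 < ε + ‖x‖ ^ (2 * α) := by positivity
  have h1 : DifferentiableAt ℝ (fun y : EuclideanSpace ℝ (Fin d) => ‖y‖) x :=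
    differentiableAt_id.norm ℝ hx
  have h2 : HasDerivAt (fun r : ℝ => A * (ε + r ^ (2 * α)) ^ (-((n - 2) / 2)))
      (A * (2 * α * ‖x‖ ^ (2 * α - 1) * (-((n - 2) / 2)) *
        (ε + ‖x‖ ^ (2 * α)) ^ (-((n - 2) / 2) - 1))) ‖x‖ :=
    ((((Real.hasDerivAt_rpow_const (p := 2 * α) (Or.inl hx0.ne')).const_add ε).rpow_const
      (p := -((n - 2) / 2)) (Or.inl hpos.ne')).const_mul A)
  have h3 := h2.comp_hasFDerivAt x h1.hasFDerivAt
  have hWe : W = (fun r : ℝ => A * (ε + r ^ (2 * α)) ^ (-((n - 2) / 2))) ∘ fun y => ‖y‖ :=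
    funext hW
  rw [hWe, h3.fderiv, norm_smul, norm_fderiv_norm h1, mul_one, Real.norm_eq_abs,
    show -((n - 2) / 2) - 1 = -(n / 2) by ring, ← abs_neg, abs_of_nonneg]
  · ring
  · have : 0 < n - 2 := by linarith
    have e : -(A * (2 * α * ‖x‖ ^ (2 * α - 1) * -((n - 2) / 2) * (ε + ‖x‖ ^ (2 * α)) ^ (-(n / 2)))) =
      A * (2 * α * ‖x‖ ^ (2 * α - 1) * ((n - 2) / 2) * (ε + ‖x‖ ^ (2 * α)) ^ (-(n / 2))) := by ring
    rw [e]
    positivity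

theorem integral_bubble_energy (hd : 3 ≤ d) (hε : 0 < ε) (hα : 0 < α) (hn : 2 < n) (hA : 0 < A)
    (hdn : (d : ℝ) = α * (n - 2) + 2)
    (hW : ∀ x, W x = A * (ε + ‖x‖ ^ (2 * α)) ^ (-((n - 2) / 2))) :
    Integrable (fun x => ‖fderiv ℝ W x‖ ^ 2) ∧ ∫ x, ‖fderiv ℝ W x‖ ^ 2 =
      d * volume.real (Metric.ball (0 : EuclideanSpace ℝ (Fin d)) 1) *
        ((A * (α * (n - 2))) ^ 2 * blissEnergy ε α n) := by
  rw [blissEnergy, ← integral_const_mul]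
  refine integrable_and_integral_radial (by omega)
    (g := fun r => (A * (α * (n - 2)) * (r ^ (2 * α - 1) * (ε + r ^ (2 * α)) ^ (-(n / 2)))) ^ 2)
    (fun x hx => by rw [norm_fderiv_bubble (by omega) hε hα hn hA hW hx]) (fun y hy => ?_)
    ((integrableOn_blissEnergy hε hα hn).const_mul _)
  have hpos : 0 < ε + y ^ (2 * α) := by positivity
  have e1 : y ^ (α * n - 1 + 2 * α) = y ^ (d - 1) * (y ^ (2 * α - 1) * y ^ (2 * α - 1)) := by
    rw [← Real.rpow_natCast, ← Real.rpow_add hy, ← Real.rpow_add hy,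
      Nat.cast_sub (by omega : 1 ≤ d), hdn]
    congr 1; push_cast; ring
  have e2 : (ε + y ^ (2 * α)) ^ (-n) =
      (ε + y ^ (2 * α)) ^ (-(n / 2)) * (ε + y ^ (2 * α)) ^ (-(n / 2)) := by
    rw [← Real.rpow_add hpos]; congr 1; ring
  rw [e1, e2]
  ring

theorem integral_bubble_mass (hd : 3 ≤ d) (hε : 0 < ε) (hα : 0 < α) (hn : 2 < n) (hA : 0 < A)
    (hdn : (d : ℝ) = α * (n - 2) + 2) (hq : q = 2 * n / (n - 2))
    (hW : ∀ x, W x = A * (ε + ‖x‖ ^ (2 * α)) ^ (-((n - 2) / 2))) :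
    Integrable (fun x => ‖x‖ ^ (-(2 - 2 * α)) * W x ^ q) ∧ ∫ x, ‖x‖ ^ (-(2 - 2 * α)) * W x ^ q =
      d * volume.real (Metric.ball (0 : EuclideanSpace ℝ (Fin d)) 1) *
        (A ^ q * blissMass ε α n) := by
  rw [blissMass, ← integral_const_mul]
  refine integrable_and_integral_radial (by omega)
    (g := fun r => r ^ (-(2 - 2 * α)) * (A * (ε + r ^ (2 * α)) ^ (-((n - 2) / 2))) ^ q)
    (fun x _ => by rw [hW]) (fun y hy => ?_) ((integrableOn_blissMass hε hα hn).const_mul _)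
  have hpos : 0 < ε + y ^ (2 * α) := by positivity
  have hn2 : n - 2 ≠ 0 := by linarith
  have e1 : y ^ (α * n - 1) = y ^ (d - 1) * y ^ (-(2 - 2 * α)) := by
    rw [← Real.rpow_natCast, ← Real.rpow_add hy, Nat.cast_sub (by omega : 1 ≤ d), hdn]
    congr 1; push_cast; ring
  rw [Real.mul_rpow hA.le (by positivity), ← Real.rpow_mul hpos.le,
    show -((n - 2) / 2) * q = -n by rw [hq]; field_simp, e1]
  ring

end

/-- The positive, strictly radially decreasing function `(1 + ‖x‖ ^ 2) ^ (-d)` on `ℝ ^ d`. -/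
noncomputable def japanesePow (d : ℕ) (x : EuclideanSpace ℝ (Fin d)) : ℝ := ((1 + ‖x‖ ^ 2) ^ d)⁻¹

section

variable {d : ℕ}

theorem japanesePow_pos (x : EuclideanSpace ℝ (Fin d)) : 0 < japanesePow d x := by
  unfold japanesePow; positivity

theorem japanesePow_le_one (x : EuclideanSpace ℝ (Fin d)) : japanesePow d x ≤ 1 :=
  inv_le_one_of_one_le₀ (one_le_pow₀ (by nlinarith [sq_nonneg ‖x‖]))

theorem japanesePow_mul_pow_le (x : EuclideanSpace ℝ (Fin d)) : japanesePow d x * ‖x‖ ^ d ≤ 1 := by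
  unfold japanesePow
  rw [inv_mul_le_one₀ (by positivity)]
  exact pow_le_pow_left₀ (norm_nonneg x) (by nlinarith [sq_nonneg (‖x‖ - 1)]) d

theorem japanesePow_le_of_dist_le {x y : EuclideanSpace ℝ (Fin d)} (h : dist y x ≤ 1) :
    japanesePow d y ≤ 3 ^ d * japanesePow d x := by
  unfold japanesePow
  have h1 : ‖x‖ ≤ ‖y‖ + 1 := by
    have := norm_le_norm_add_norm_sub' x y
    rw [← dist_eq_norm, dist_comm] at this
    linarith
  rw [← div_eq_mul_inv, le_div_iff₀ (by positivity), inv_mul_le_iff₀ (by positivity), ← mul_pow]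
  refine pow_le_pow_left₀ (by positivity) ?_ d
  nlinarith [sq_nonneg (‖y‖ - 1), norm_nonneg x, norm_nonneg y]

theorem integrable_japanesePow (hd : d ≠ 0) : Integrable (japanesePow d) := by
  have h := integrable_rpow_neg_one_add_norm_sq (E := EuclideanSpace ℝ (Fin d)) (μ := volume)
    (r := 2 * d) (by
      have : (0 : ℝ) < d := by positivity
      simp; linarith)
  refine h.congr (Eventually.of_forall fun x => ?_)
  simp only [japanesePow]
  rw [show -(2 * (d : ℝ)) / 2 = -(d : ℝ) by ring, Real.rpow_neg (by positivity), Real.rpow_natCast]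

theorem tendsto_japanesePow (hd : d ≠ 0) :
    Tendsto (japanesePow d) (cocompact (EuclideanSpace ℝ (Fin d))) (𝓝 0) := by
  refine Tendsto.inv_tendsto_atTop ((tendsto_pow_atTop hd).comp
    (tendsto_atTop_add_const_left _ 1 ((tendsto_pow_atTop two_ne_zero).comp
      tendsto_norm_cocompact_atTop)))

theorem hasFDerivAt_japanesePow (x : EuclideanSpace ℝ (Fin d)) :
    HasFDerivAt (japanesePow d) ((-(d * (1 + ‖x‖ ^ 2) ^ (d - 1)) / ((1 + ‖x‖ ^ 2) ^ d) ^ 2) •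
      (2 • innerSL ℝ x)) x := by
  have h1 := (hasStrictFDerivAt_norm_sq x).hasFDerivAt.const_add 1
  have h2 : HasDerivAt (fun s : ℝ => (s ^ d)⁻¹)
      (-(d * (1 + ‖x‖ ^ 2) ^ (d - 1)) / ((1 + ‖x‖ ^ 2) ^ d) ^ 2) (1 + ‖x‖ ^ 2) :=
    (hasDerivAt_pow d (1 + ‖x‖ ^ 2)).inv (by positivity)
  exact HasDerivAt.comp_hasFDerivAt (h₂ := fun s : ℝ => (s ^ d)⁻¹)
    (f := fun y : EuclideanSpace ℝ (Fin d) => 1 + ‖y‖ ^ 2) x h2 h1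

theorem norm_fderiv_japanesePow_le (x : EuclideanSpace ℝ (Fin d)) :
    ‖fderiv ℝ (japanesePow d) x‖ ≤ 2 * d * japanesePow d x := by
  rw [(hasFDerivAt_japanesePow x).fderiv, norm_smul, ← Nat.cast_smul_eq_nsmul ℝ, norm_smul,
    innerSL_apply_norm, neg_div, norm_neg, Real.norm_of_nonneg (by positivity)]
  unfold japanesePow
  rcases d with _ | k
  · simp
  simp only [Nat.add_sub_cancel, Nat.cast_ofNat, Real.norm_ofNat]
  have hs : 0 < 1 + ‖x‖ ^ 2 := by positivity
  have hx : ‖x‖ ≤ 1 + ‖x‖ ^ 2 := by nlinarith [sq_nonneg (‖x‖ - 1)]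
  rw [div_mul_eq_mul_div, div_le_iff₀ (by positivity)]
  have e : 2 * ((k + 1 : ℕ) : ℝ) * ((1 + ‖x‖ ^ 2) ^ (k + 1))⁻¹ * ((1 + ‖x‖ ^ 2) ^ (k + 1)) ^ 2 =
      2 * ((k + 1 : ℕ) : ℝ) * (1 + ‖x‖ ^ 2) ^ k * (1 + ‖x‖ ^ 2) := by
    field_simp
    ring
  rw [e]
  have : 0 ≤ 2 * ((k + 1 : ℕ) : ℝ) * (1 + ‖x‖ ^ 2) ^ k := by positivity
  nlinarith [mul_le_mul_of_nonneg_left hx this]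

theorem norm_eq_of_japanesePow_eq (hd : d ≠ 0) {x y : EuclideanSpace ℝ (Fin d)}
    (h : japanesePow d x = japanesePow d y) : ‖x‖ = ‖y‖ := by
  have h1 := inv_injective h
  have h2 := (pow_left_inj₀ (by positivity) (by positivity) hd).1 h1
  exact (pow_left_inj₀ (norm_nonneg x) (norm_nonneg y) two_ne_zero).1 (by linarith)

theorem continuous_japanesePow : Continuous (japanesePow d) :=
  continuous_iff_continuousAt.2 fun x => (hasFDerivAt_japanesePow x).continuousAt

end

theorem isSlopeBound_norm {d : ℕ} (hd : d ≠ 0) {H : Type*} [NormedAddCommGroup H]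
    [NormedSpace ℝ H] [CompleteSpace H] {G : EuclideanSpace ℝ (Fin d) → H} {C : ℝ} (hC : 0 ≤ C)
    (hG : Differentiable ℝ G) (hG' : ∀ x, ‖fderiv ℝ G x‖ ≤ C * japanesePow d x) :
    IsSlopeBound (fun x => ‖G x‖) (fun x => ‖fderiv ℝ G x‖)
      (fun x => C * 3 ^ d * japanesePow d x) where
  nonneg x := norm_nonneg _
  meas := (measurable_fderiv ℝ G).norm
  le x c hc := by
    have h := (hG x).hasFDerivAt.isLittleO.def (sub_pos.2 hc)
    filter_upwards [h] with y hy
    have h1 := (fderiv ℝ G x).le_opNorm (y - x)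
    have h2 := norm_le_norm_add_norm_sub' (G y) (G x)
    have h3 := norm_le_norm_add_norm_sub' (G y - G x) (fderiv ℝ G x (y - x))
    rw [dist_eq_norm]
    linarith
  nonneg' x := mul_nonneg (by positivity) (japanesePow_pos x).le
  le' x y hy := by
    have h := (convex_closedBall x 1).norm_image_sub_le_of_norm_fderiv_le (𝕜 := ℝ) (f := G)
      (C := C * 3 ^ d * japanesePow d x) (fun z _ => hG z) (fun z hz => (hG' z).trans (by
        rw [mul_assoc]
        exact mul_le_mul_of_nonneg_left (japanesePow_le_of_dist_le hz) hC))
      (Metric.mem_closedBall_self zero_le_one) (Metric.mem_closedBall.2 hy.le)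
    have h2 := norm_le_norm_add_norm_sub' (G y) (G x)
    rw [dist_eq_norm]
    linarith
  lintegral_ne_top :=
    ((hasFiniteIntegral_iff_ofReal (Eventually.of_forall fun x =>
      mul_nonneg (by positivity) (japanesePow_pos x).le)).1
        ((integrable_japanesePow hd).const_mul (C * 3 ^ d)).2).ne

section

variable {d : ℕ} {H : Type*} [NormedAddCommGroup H]

/-- Adjoin to `f` a small positive component orthogonal to it. -/
noncomputable def perturb (f : EuclideanSpace ℝ (Fin d) → H) (η : ℝ)
    (x : EuclideanSpace ℝ (Fin d)) : WithLp 2 (H × ℝ) :=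
  WithLp.toLp 2 (f x, η * japanesePow d x)

variable {f : EuclideanSpace ℝ (Fin d) → H} {η : ℝ}

theorem norm_perturb_sq (x : EuclideanSpace ℝ (Fin d)) :
    ‖perturb f η x‖ ^ 2 = ‖f x‖ ^ 2 + (η * japanesePow d x) ^ 2 := by
  rw [WithLp.prod_norm_sq_eq_of_L2]
  simp [perturb, mul_pow]

theorem norm_le_norm_perturb (x : EuclideanSpace ℝ (Fin d)) : ‖f x‖ ≤ ‖perturb f η x‖ := by
  rw [← sq_le_sq₀ (norm_nonneg _) (norm_nonneg _), norm_perturb_sq]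
  nlinarith [sq_nonneg (η * japanesePow d x)]

theorem norm_perturb_pos (hη : 0 < η) (x : EuclideanSpace ℝ (Fin d)) : 0 < ‖perturb f η x‖ := by
  have h : 0 < ‖perturb f η x‖ ^ 2 := by
    have := mul_pos hη (japanesePow_pos x)
    rw [norm_perturb_sq]
    positivity
  exact (norm_nonneg _).lt_of_ne fun h0 => by simp [← h0] at h

theorem countable_bad_perturb (hd : d ≠ 0) (hf : Continuous f) :
    {η : Ioi (0 : ℝ) | ∃ t, 0 < volume {x | ‖perturb f (η : ℝ) x‖ = t}}.Countable := by
  have : NeZero d := ⟨hd⟩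
  have hcont : ∀ η : ℝ, Continuous (fun x => ‖perturb f η x‖ ^ 2) := fun η => by
    simp only [norm_perturb_sq]
    exact (hf.norm.pow 2).add ((continuous_const.mul continuous_japanesePow).pow 2)
  have hcont' : ∀ η : ℝ, Continuous (fun x => ‖perturb f η x‖) := fun η => by
    simpa using (hcont η).sqrt
  classical
  let t : Ioi (0 : ℝ) → ℝ := fun η =>
    if h : ∃ t, 0 < volume {x | ‖perturb f (η : ℝ) x‖ = t} then h.choose else 0
  have key := Measure.countable_meas_pos_of_disjoint_iUnion₀
    (μ := (volume : Measure (EuclideanSpace ℝ (Fin d))))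
    (As := fun η : Ioi (0 : ℝ) => {x | ‖perturb f (η : ℝ) x‖ = t η})
    (fun η => (measurableSet_eq_fun (hcont' η).measurable measurable_const).nullMeasurableSet) ?_
  · refine key.mono fun η hη => ?_
    have hη' : ∃ t, 0 < volume {x | ‖perturb f (η : ℝ) x‖ = t} := hη
    have : t η = hη'.choose := dif_pos hη'
    change 0 < volume {x | ‖perturb f (η : ℝ) x‖ = t η}
    rw [this]
    exact hη'.choose_spec
  · rintro ⟨η, hη⟩ ⟨η', hη'⟩ hne
    have hne' : η ≠ η' := fun h => hne (Subtype.ext h)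
    set s := t ⟨η, hη⟩
    set s' := t ⟨η', hη'⟩
    change volume ({x | ‖perturb f η x‖ = s} ∩ {x | ‖perturb f η' x‖ = s'}) = 0
    rcases ({x | ‖perturb f η x‖ = s} ∩ {x | ‖perturb f η' x‖ = s'}).eq_empty_or_nonempty with
      h | ⟨y, hy, hy'⟩
    · rw [h, measure_empty]
    · refine measure_mono_null (t := Metric.sphere 0 ‖y‖) (fun x ⟨hx, hx'⟩ => ?_)
        (Measure.addHaar_sphere _ _ _)
      rw [mem_sphere_zero_iff_norm]
      refine norm_eq_of_japanesePow_eq hd ?_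
      have e1 : ‖perturb f η x‖ ^ 2 = ‖perturb f η y‖ ^ 2 := by
        rw [show ‖perturb f η x‖ = s from hx, show ‖perturb f η y‖ = s from hy]
      have e2 : ‖perturb f η' x‖ ^ 2 = ‖perturb f η' y‖ ^ 2 := by
        rw [show ‖perturb f η' x‖ = s' from hx', show ‖perturb f η' y‖ = s' from hy']
      simp only [norm_perturb_sq] at e1 e2
      have h0 : 0 < η := hη
      have h0' : 0 < η' := hη'
      have e3 : (η ^ 2 - η' ^ 2) * (japanesePow d x ^ 2 - japanesePow d y ^ 2) = 0 := by
        linear_combination e1 - e2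
      rcases mul_eq_zero.1 e3 with h | h
      · exact absurd ((pow_left_inj₀ h0.le h0'.le two_ne_zero).1 (sub_eq_zero.1 h)) hne'
      · exact (pow_left_inj₀ (japanesePow_pos x).le (japanesePow_pos y).le two_ne_zero).1
          (sub_eq_zero.1 h)

variable [NormedSpace ℝ H]

theorem hasFDerivAt_perturb (hf : Differentiable ℝ f) (x : EuclideanSpace ℝ (Fin d)) :
    HasFDerivAt (perturb f η) (((WithLp.prodContinuousLinearEquiv 2 ℝ H ℝ).symm :
      H × ℝ →L[ℝ] WithLp 2 (H × ℝ)).comp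
        ((fderiv ℝ f x).prod (η • fderiv ℝ (japanesePow d) x))) x :=
  ((WithLp.prodContinuousLinearEquiv 2 ℝ H ℝ).symm :
    H × ℝ →L[ℝ] WithLp 2 (H × ℝ)).hasFDerivAt.comp x ((hf x).hasFDerivAt.prodMk
      ((hasFDerivAt_japanesePow x).differentiableAt.hasFDerivAt.const_mul η))

theorem norm_fderiv_perturb_sq_le (hf : Differentiable ℝ f) (x : EuclideanSpace ℝ (Fin d)) :
    ‖fderiv ℝ (perturb f η) x‖ ^ 2 ≤
      ‖fderiv ℝ f x‖ ^ 2 + η ^ 2 * ‖fderiv ℝ (japanesePow d) x‖ ^ 2 := by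
  refine (Real.le_sqrt (norm_nonneg _) (by positivity)).1 ?_
  refine ContinuousLinearMap.opNorm_le_bound _ (Real.sqrt_nonneg _) fun v => ?_
  rw [← sq_le_sq₀ (norm_nonneg _) (by positivity), mul_pow, Real.sq_sqrt (by positivity),
    (hasFDerivAt_perturb hf x).fderiv, WithLp.prod_norm_sq_eq_of_L2]
  have h1 := pow_le_pow_left₀ (norm_nonneg _) ((fderiv ℝ f x).le_opNorm v) 2
  have h2 := pow_le_pow_left₀ (norm_nonneg _) ((fderiv ℝ (japanesePow d) x).le_opNorm v) 2
  have h3 := mul_le_mul_of_nonneg_left h2 (sq_nonneg η)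
  simp only [mul_pow, Real.norm_eq_abs, sq_abs] at h1 h3
  change ‖fderiv ℝ f x v‖ ^ 2 + ‖η * fderiv ℝ (japanesePow d) x v‖ ^ 2 ≤ _
  simp only [norm_mul, mul_pow, Real.norm_eq_abs, sq_abs]
  linarith

end

section

variable {d : ℕ} {H : Type*} [NormedAddCommGroup H] [NormedSpace ℝ H] [CompleteSpace H]
  {f : EuclideanSpace ℝ (Fin d) → H}

theorem integrable_sq_of_le_japanesePow (hd : d ≠ 0) {g : EuclideanSpace ℝ (Fin d) → ℝ} {C : ℝ}
    (hg : Measurable g) (h0 : ∀ x, 0 ≤ g x) (h : ∀ x, g x ≤ C * japanesePow d x) :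
    Integrable fun x => g x ^ 2 := by
  refine ((integrable_japanesePow hd).const_mul (C ^ 2)).mono' (hg.pow_const 2).aestronglyMeasurable
    (Eventually.of_forall fun x => ?_)
  have h1 := japanesePow_le_one x
  have h2 := japanesePow_pos x
  have h3 := pow_le_pow_left₀ (h0 x) (h x) 2
  rw [Real.norm_of_nonneg (sq_nonneg _)]
  refine h3.trans ?_
  rw [mul_pow]
  exact mul_le_mul_of_nonneg_left (by nlinarith) (sq_nonneg C)

/-- The sharp Hardy–Sobolev inequality for functions with sufficient decay. -/
theorem lintegral_weight_le_of_decay (hd : 3 ≤ d) (hf : Differentiable ℝ f) {C : ℝ}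
    (hC : ∀ x, ‖f x‖ ≤ C * japanesePow d x) (hC' : ∀ x, ‖fderiv ℝ f x‖ ≤ C * japanesePow d x)
    {ε α n q : ℝ} (hε : 0 < ε) (hα : 0 < α) (hα1 : α < 1)
    (hn : 2 < n) (hdn : (d : ℝ) = α * (n - 2) + 2) (hq : q = 2 * n / (n - 2)) :
    ∫⁻ x, ENNReal.ofReal (‖x‖ ^ (-(2 - 2 * α)) * ‖f x‖ ^ q) ≤
      ENNReal.ofReal (d * volume.real (Metric.ball (0 : EuclideanSpace ℝ (Fin d)) 1) *
        blissMass ε α n * ((∫ x, ‖fderiv ℝ f x‖ ^ 2) /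
          (d * volume.real (Metric.ball (0 : EuclideanSpace ℝ (Fin d)) 1) *
          (α * (n - 2)) ^ 2 * blissEnergy ε α n)) ^ (q / 2)) := by
  have hd0 : d ≠ 0 := by omega
  have hq0 : 0 < q := by rw [hq]; exact div_pos (by linarith) (by linarith)
  have hC0 : 0 ≤ C := nonneg_of_mul_nonneg_left ((norm_nonneg _).trans (hC 0)) (japanesePow_pos 0)
  set ν := d * volume.real (Metric.ball (0 : EuclideanSpace ℝ (Fin d)) 1)
  set Eφ := ∫ x, ‖fderiv ℝ (japanesePow d) x‖ ^ 2 with hEφ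
  set E := ∫ x, ‖fderiv ℝ f x‖ ^ 2 with hE
  have hfi : Integrable fun x => ‖fderiv ℝ f x‖ ^ 2 :=
    integrable_sq_of_le_japanesePow hd0 (measurable_fderiv ℝ f).norm (fun _ => norm_nonneg _) hC'
  have hφi : Integrable fun x => ‖fderiv ℝ (japanesePow d) x‖ ^ 2 :=
    integrable_sq_of_le_japanesePow hd0 (measurable_fderiv ℝ _).norm (fun _ => norm_nonneg _)
      norm_fderiv_japanesePow_le
  have hE0 : 0 ≤ E := integral_nonneg fun _ => sq_nonneg _
  have hEφ0 : 0 ≤ Eφ := integral_nonneg fun _ => sq_nonneg _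
  have hI := blissMass_pos hε hα hn
  have hK := blissEnergy_pos hε hα hn
  have hν : 0 ≤ ν := by positivity
  have key : ∀ η > 0, (∀ t, volume {x | ‖perturb f η x‖ = t} = 0) →
      ∫⁻ x, ENNReal.ofReal (‖x‖ ^ (-(2 - 2 * α)) * ‖f x‖ ^ q) ≤
        ENNReal.ofReal (ν * blissMass ε α n *
          ((E + η ^ 2 * Eφ) / (ν * (α * (n - 2)) ^ 2 * blissEnergy ε α n)) ^ (q / 2)) := by
    intro η hη hnull
    set G := perturb f η with hG
    have hGd : Differentiable ℝ G := fun x => (hasFDerivAt_perturb hf x).differentiableAt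
    have hGpos : ∀ x, 0 < ‖G x‖ := norm_perturb_pos hη
    set C₁ := C + η * (1 + 2 * d) with hC₁
    have hC₁0 : 0 ≤ C₁ := by positivity
    have hG1 : ∀ x, ‖G x‖ ≤ C₁ * japanesePow d x := fun x => by
      have hp := japanesePow_pos x
      rw [← sq_le_sq₀ (norm_nonneg _) (by positivity), norm_perturb_sq]
      have h1 := pow_le_pow_left₀ (norm_nonneg _) (hC x) 2
      have h2 : C ^ 2 + η ^ 2 ≤ C₁ ^ 2 := by
        have : 0 ≤ η * (2 * d) := by positivity
        have : C ≤ C + η * (2 * d) := by linarith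
        rw [hC₁]
        nlinarith [mul_nonneg hC0 hη.le]
      nlinarith [mul_le_mul_of_nonneg_right h2 (sq_nonneg (japanesePow d x))]
    have hG2 : ∀ x, ‖fderiv ℝ G x‖ ≤ C₁ * japanesePow d x := fun x => by
      have hp := japanesePow_pos x
      rw [← sq_le_sq₀ (norm_nonneg _) (by positivity)]
      refine (norm_fderiv_perturb_sq_le hf x).trans ?_
      have h1 := pow_le_pow_left₀ (norm_nonneg _) (hC' x) 2
      have h3 := pow_le_pow_left₀ (norm_nonneg _) (norm_fderiv_japanesePow_le x) 2
      have h2 : C ^ 2 + η ^ 2 * (2 * d) ^ 2 ≤ C₁ ^ 2 := by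
        have : 0 ≤ η * (2 * d) := by positivity
        rw [hC₁]
        nlinarith [mul_nonneg hC0 hη.le, mul_nonneg hC0 this, mul_nonneg this hη.le]
      nlinarith [mul_le_mul_of_nonneg_right h2 (sq_nonneg (japanesePow d x)),
        mul_le_mul_of_nonneg_left h3 (sq_nonneg η)]
    have hGi : Integrable fun x => ‖fderiv ℝ G x‖ ^ 2 :=
      integrable_sq_of_le_japanesePow hd0 (measurable_fderiv ℝ G).norm (fun _ => norm_nonneg _) hG2
    have hGE : ∫ x, ‖fderiv ℝ G x‖ ^ 2 ≤ E + η ^ 2 * Eφ := by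
      rw [hE, hEφ, ← integral_const_mul, ← integral_add hfi (hφi.const_mul _)]
      exact integral_mono hGi (hfi.add (hφi.const_mul _)) (norm_fderiv_perturb_sq_le hf)
    have hGc : Continuous fun x => ‖G x‖ := hGd.continuous.norm
    have hGz : Tendsto (fun x => ‖G x‖) (cocompact _) (𝓝 0) :=
      squeeze_zero (fun _ => norm_nonneg _) hG1 (by
        simpa using (tendsto_japanesePow hd0).const_mul C₁)
    obtain ⟨R, U, h⟩ := exists_isRearrangement (by omega) hGc hGpos hGz fun t _ => hnull t
    have hmain := h.lintegral_weight_le (isSlopeBound_norm hd0 hC₁0 hGd hG2) hd hGc hGpos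
      (C := C₁) (fun x => (hG1 x).trans (mul_le_of_le_one_right hC₁0 (japanesePow_le_one x)))
      (fun x => (mul_le_mul_of_nonneg_right (hG1 x) (by positivity)).trans (by
        rw [mul_assoc]
        exact mul_le_of_le_one_right hC₁0 (japanesePow_mul_pow_le x)))
      hε hα hα1 hn hdn hq (integral_nonneg fun _ => sq_nonneg _)
      (ofReal_integral_eq_lintegral_ofReal hGi (Eventually.of_forall fun _ => sq_nonneg _)).symm
    refine (lintegral_mono fun x => ENNReal.ofReal_le_ofReal ?_).trans
      (hmain.trans (ENNReal.ofReal_le_ofReal ?_))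
    · exact mul_le_mul_of_nonneg_left (Real.rpow_le_rpow (norm_nonneg _) (norm_le_norm_perturb x)
        hq0.le) (by positivity)
    · refine mul_le_mul_of_nonneg_left (Real.rpow_le_rpow ?_ ?_ (by positivity)) (by positivity)
      · exact div_nonneg (integral_nonneg fun _ => sq_nonneg _) (by positivity)
      · exact div_le_div_of_nonneg_right hGE (by positivity)
  have hbad := (countable_bad_perturb hd0 hf.continuous).image ((↑) : Ioi (0 : ℝ) → ℝ)
  have hfreq : ∃ᶠ η : ℝ in 𝓝[>] 0, ∀ t, volume {x | ‖perturb f η x‖ = t} = 0 := by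
    rw [frequently_nhdsWithin_iff, frequently_iff]
    intro s hs
    obtain ⟨δ, hδ, hδs⟩ := Metric.mem_nhds_iff.1 hs
    have hdense := hbad.dense_compl ℝ
    obtain ⟨η, hη, hη'⟩ := hdense.exists_mem_open isOpen_Ioo (nonempty_Ioo.2 hδ)
    refine ⟨η, hδs ?_, fun t => ?_, hη'.1⟩
    · rw [Metric.mem_ball, dist_zero_right, Real.norm_of_nonneg hη'.1.le]
      exact hη'.2
    · by_contra h0
      exact hη ⟨⟨η, hη'.1⟩, ⟨t, pos_iff_ne_zero.2 h0⟩, rfl⟩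
  have hlim : Tendsto (fun η : ℝ => ENNReal.ofReal (ν * blissMass ε α n *
      ((E + η ^ 2 * Eφ) / (ν * (α * (n - 2)) ^ 2 * blissEnergy ε α n)) ^ (q / 2))) (𝓝[>] 0)
      (𝓝 (ENNReal.ofReal (ν * blissMass ε α n *
        (E / (ν * (α * (n - 2)) ^ 2 * blissEnergy ε α n)) ^ (q / 2)))) := by
    have hcont : Continuous fun η : ℝ => ENNReal.ofReal (ν * blissMass ε α n *
        ((E + η ^ 2 * Eφ) / (ν * (α * (n - 2)) ^ 2 * blissEnergy ε α n)) ^ (q / 2)) := by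
      refine ENNReal.continuous_ofReal.comp (continuous_const.mul
        (Continuous.rpow_const ?_ fun _ => Or.inr (by positivity)))
      fun_prop
    have := hcont.tendsto 0
    simp only [ne_eq, OfNat.ofNat_ne_zero, not_false_eq_true, zero_pow, zero_mul, add_zero] at this
    exact this.mono_left nhdsWithin_le_nhds
  refine ge_of_tendsto_of_frequently hlim ?_
  exact (hfreq.and_eventually self_mem_nhdsWithin).mono fun η hη => key η hη.2 hη.1

theorem SchwartzMap.exists_le_japanesePow {F : Type*} [NormedAddCommGroup F] [NormedSpace ℝ F]
    (f : SchwartzMap (EuclideanSpace ℝ (Fin d)) F) :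
    ∃ C, (∀ x, ‖f x‖ ≤ C * japanesePow d x) ∧ ∀ x, ‖fderiv ℝ f x‖ ≤ C * japanesePow d x := by
  have h := fun k (hk : k ≤ 1) x =>
    SchwartzMap.one_add_le_sup_seminorm_apply (𝕜 := ℝ) (m := (2 * d, 1)) le_rfl hk f x
  set C := 2 ^ (2 * d, 1).1 * ((Finset.Iic (2 * d, 1)).sup fun m => SchwartzMap.seminorm ℝ m.1 m.2) f
  have key : ∀ (x : EuclideanSpace ℝ (Fin d)) (a : ℝ), 0 ≤ a → (1 + ‖x‖) ^ (2 * d) * a ≤ C →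
      a ≤ C * japanesePow d x := by
    intro x a ha hle
    unfold japanesePow
    rw [← div_eq_mul_inv, le_div_iff₀ (by positivity), mul_comm]
    refine (mul_le_mul_of_nonneg_right ?_ ha).trans hle
    rw [pow_mul]
    exact pow_le_pow_left₀ (by positivity) (by nlinarith [norm_nonneg x]) d
  refine ⟨C, fun x => key x _ (norm_nonneg _) ?_, fun x => key x _ (norm_nonneg _) ?_⟩
  · simpa using h 0 zero_le_one x
  · simpa [norm_iteratedFDeriv_one] using h 1 le_rfl x

end

theorem sharp_constant_algebra {N E A ν I K γ q : ℝ} (hN : 0 ≤ N) (hE : 0 ≤ E) (hA : 0 < A)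
    (hν : 0 < ν) (hI : 0 < I) (hK : 0 < K) (hγ : 0 < γ) (hq : 0 < q)
    (h : N ≤ ν * I * (E / (ν * γ ^ 2 * K)) ^ (q / 2)) :
    N ^ (1 / q) * (ν * ((A * γ) ^ 2 * K)) ^ ((1 : ℝ) / 2) ≤
      (ν * (A ^ q * I)) ^ (1 / q) * E ^ ((1 : ℝ) / 2) := by
  have h1 := Real.rpow_le_rpow hN h (show 0 ≤ 1 / q by positivity)
  have e0 : q / 2 * (1 / q) = 1 / 2 := by field_simp
  rw [Real.mul_rpow (by positivity) (by positivity), ← Real.rpow_mul (by positivity), e0] at h1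
  have e1 : (ν * (A ^ q * I)) ^ (1 / q) = A * (ν * I) ^ (1 / q) := by
    rw [show ν * (A ^ q * I) = A ^ q * (ν * I) by ring, Real.mul_rpow (by positivity) (by positivity),
      ← Real.rpow_mul hA.le, mul_one_div_cancel hq.ne', Real.rpow_one]
  have e2 : (ν * ((A * γ) ^ 2 * K)) ^ ((1 : ℝ) / 2) = A * (ν * γ ^ 2 * K) ^ ((1 : ℝ) / 2) := by
    rw [show ν * ((A * γ) ^ 2 * K) = A ^ 2 * (ν * γ ^ 2 * K) by ring,
      Real.mul_rpow (by positivity) (by positivity), ← Real.sqrt_eq_rpow (A ^ 2), Real.sqrt_sq hA.le]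
  rw [Real.div_rpow hE (by positivity), mul_div_assoc', le_div_iff₀ (by positivity)] at h1
  rw [e1, e2]
  calc N ^ (1 / q) * (A * (ν * γ ^ 2 * K) ^ ((1 : ℝ) / 2))
      = A * (N ^ (1 / q) * (ν * γ ^ 2 * K) ^ ((1 : ℝ) / 2)) := by ring
    _ ≤ A * ((ν * I) ^ (1 / q) * E ^ ((1 : ℝ) / 2)) := mul_le_mul_of_nonneg_left h1 hA.le
    _ = _ := by ring

end

/-- `W_b` attains the sharp constant in the Hardy–Sobolev inequality. -/
theorem stmt_2 (d : ℕ) (hd : 3 ≤ d) (b ε q : ℝ) (hb0 : 0 < b) (hb2 : b < 2) (hε : 0 < ε)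
    (hq : q = 2 * ((d : ℝ) - b) / ((d : ℝ) - 2))
    (W : EuclideanSpace ℝ (Fin d) → ℝ)
    (hW : ∀ x, W x = (ε * ((d : ℝ) - b) * ((d : ℝ) - 2)) ^ (((d : ℝ) - 2) / (4 - 2 * b)) /
        (ε + ‖x‖ ^ (2 - b)) ^ (((d : ℝ) - 2) / (2 - b))) :
    Integrable (fun x : EuclideanSpace ℝ (Fin d) => ‖fderiv ℝ W x‖ ^ 2) ∧
    Integrable (fun x : EuclideanSpace ℝ (Fin d) => ‖x‖ ^ (-b) * W x ^ q) ∧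
    (0 < ∫ x : EuclideanSpace ℝ (Fin d), ‖fderiv ℝ W x‖ ^ 2) ∧
    (0 < ∫ x : EuclideanSpace ℝ (Fin d), ‖x‖ ^ (-b) * W x ^ q) ∧
    ∀ f : SchwartzMap (EuclideanSpace ℝ (Fin d)) ℂ,
      (∫ x : EuclideanSpace ℝ (Fin d), ‖x‖ ^ (-b) * ‖f x‖ ^ q) ^ (1 / q) *
          (∫ x : EuclideanSpace ℝ (Fin d), ‖fderiv ℝ W x‖ ^ 2) ^ ((1 : ℝ) / 2)
        ≤ (∫ x : EuclideanSpace ℝ (Fin d), ‖x‖ ^ (-b) * W x ^ q) ^ (1 / q) *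
            (∫ x : EuclideanSpace ℝ (Fin d), ‖fderiv ℝ (⇑f) x‖ ^ 2) ^ ((1 : ℝ) / 2) := by
  have hd3 : (3 : ℝ) ≤ d := by exact_mod_cast hd
  have hb2' : 0 < 2 - b := by linarith
  have hd2 : 0 < (d : ℝ) - 2 := by linarith
  have hdb : 0 < (d : ℝ) - b := by linarith
  obtain ⟨α, hα⟩ : ∃ α, α = 1 - b / 2 := ⟨_, rfl⟩
  obtain ⟨n, hn⟩ : ∃ n, n = 2 * ((d : ℝ) - b) / (2 - b) := ⟨_, rfl⟩
  have hα0 : 0 < α := by linarith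
  have hα1 : α < 1 := by linarith
  have hn2 : 2 < n := by rw [hn, lt_div_iff₀ hb2']; linarith
  have e2α : 2 - b = 2 * α := by rw [hα]; ring
  have eb : -b = -(2 - 2 * α) := by rw [hα]; ring
  have hne : n - 2 = 2 * (((d : ℝ) - 2) / (2 - b)) := by
    rw [hn]; field_simp; ring
  have hdn : (d : ℝ) = α * (n - 2) + 2 := by
    rw [hne, hα]; field_simp; ring
  have hqn : q = 2 * n / (n - 2) := by
    rw [hq, hne, hn]; field_simp
  have hq0 : 0 < q := by rw [hq]; positivity
  obtain ⟨A, hA⟩ : ∃ A, A = (ε * ((d : ℝ) - b) * ((d : ℝ) - 2)) ^ (((d : ℝ) - 2) / (4 - 2 * b)) :=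
    ⟨_, rfl⟩
  have hA0 : 0 < A := by rw [hA]; positivity
  have hW' : ∀ x, W x = A * (ε + ‖x‖ ^ (2 * α)) ^ (-((n - 2) / 2)) := fun x => by
    rw [hW, ← hA, Real.rpow_neg (by positivity), ← div_eq_mul_inv, e2α, hne, e2α,
      mul_div_cancel_left₀ _ two_ne_zero]
  have hI := blissMass_pos hε hα0 hn2
  have hK := blissEnergy_pos hε hα0 hn2
  have hν : 0 < d * volume.real (Metric.ball (0 : EuclideanSpace ℝ (Fin d)) 1) :=
    mul_pos (by linarith) ball_one_pos
  have hγ : 0 < α * (n - 2) := mul_pos hα0 (by linarith)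
  rw [eb]
  obtain ⟨hei, hev⟩ := integral_bubble_energy hd hε hα0 hn2 hA0 hdn hW'
  obtain ⟨hmi, hmv⟩ := integral_bubble_mass hd hε hα0 hn2 hA0 hdn hqn hW'
  refine ⟨hei, hmi, ?_, ?_, fun f => ?_⟩
  · rw [hev]; positivity
  · rw [hmv]; positivity
  rw [hev, hmv]
  have hNnn : ∀ x, 0 ≤ ‖x‖ ^ (-(2 - 2 * α)) * ‖f x‖ ^ q := fun x => by positivity
  have hEnn : 0 ≤ ∫ x, ‖fderiv ℝ (⇑f) x‖ ^ 2 := integral_nonneg fun x => by positivity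
  refine sharp_constant_algebra (integral_nonneg hNnn) hEnn hA0 hν hI hK hγ hq0 ?_
  obtain ⟨C, hC, hC'⟩ := f.exists_le_japanesePow
  have hmain := lintegral_weight_le_of_decay hd f.differentiable hC hC' hε hα0 hα1 hn2 hdn hqn
  have hmeas : Measurable fun x : EuclideanSpace ℝ (Fin d) =>
      ‖x‖ ^ (-(2 - 2 * α)) * ‖f x‖ ^ q :=
    (measurable_norm.pow_const _).mul (f.continuous.norm.measurable.pow_const _)
  rw [integral_eq_lintegral_of_nonneg_ae (Filter.Eventually.of_forall hNnn)
    hmeas.aestronglyMeasurable]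
  refine ENNReal.toReal_le_of_le_ofReal ?_ hmain
  positivity
end

section
/- Let d ≥ 3 be a natural number, let b be a real number with 0 < b < 2, let ε > 0, and define W_b : ℝ^d → ℝ by W_b(x) = [ε(d−b)(d−2)]^{(d−2)/(4−2b)} / (ε + |x|^{2−b})^{(d−2)/(2−b)}. Then for every x ∈ ℝ^d with x ≠ 0, W_b is twice differentiable at x and Δ W_b(x) + |x|^{−b} · W_b(x)^{(d+2−2b)/(d−2)} = 0, where Δ W_b(x) denotes the Laplacian of W_b at x (the sum of the second partial derivatives of W_b at x along the standard basis directions). -/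
open MeasureTheory

/-- Away from the origin every real power of the norm is differentiable. -/
lemma hasFDerivAt_norm_rpow_of_ne_zero {E : Type*} [NormedAddCommGroup E] [InnerProductSpace ℝ E]
    {x : E} (hx : x ≠ 0) (s : ℝ) :
    HasFDerivAt (fun y : E => ‖y‖ ^ s) ((s * ‖x‖ ^ (s - 2)) • innerSL ℝ x) x := by
  have hr : 0 < ‖x‖ := norm_pos_iff.mpr hx
  have hn : HasFDerivAt (fun y : E => ‖y‖ ^ 2) (2 • innerSL ℝ x) x :=
    (hasStrictFDerivAt_norm_sq x).hasFDerivAt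
  have h := hn.rpow_const (p := s / 2) (Or.inl (by positivity))
  have hpow : ∀ t : ℝ, ∀ y : E, (‖y‖ ^ 2) ^ (t / 2) = ‖y‖ ^ t := fun t y => by
    rw [← Real.rpow_natCast, ← Real.rpow_mul (norm_nonneg y)]
    congr 1
    push_cast
    ring
  simp only [hpow] at h
  convert h using 1
  rw [show s / 2 - 1 = (s - 2) / 2 by ring, hpow]
  ext v
  simp
  ring

/-- The profile `(ε + ‖y‖ ^ m) ^ q` is differentiable away from the origin. -/
lemma hasFDerivAt_add_norm_rpow_rpow {E : Type*} [NormedAddCommGroup E] [InnerProductSpace ℝ E]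
    {x : E} (hx : x ≠ 0) {ε : ℝ} (hε : 0 < ε) (m q : ℝ) :
    HasFDerivAt (fun y : E => (ε + ‖y‖ ^ m) ^ q)
      ((q * (ε + ‖x‖ ^ m) ^ (q - 1) * (m * ‖x‖ ^ (m - 2))) • innerSL ℝ x) x := by
  have h := ((hasFDerivAt_norm_rpow_of_ne_zero hx m).const_add ε).rpow_const (p := q)
    (Or.inl (by positivity))
  convert h using 1
  rw [smul_smul]

/-- The Laplacian of the radial profile `(ε + ‖y‖ ^ m) ^ q`, as a sum over coordinates. -/
lemma sum_fderiv_fderiv_add_norm_rpow_rpow {d : ℕ} {x : EuclideanSpace ℝ (Fin d)} (hx : x ≠ 0)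
    {ε : ℝ} (hε : 0 < ε) (A m q : ℝ) :
    ∑ i : Fin d, fderiv ℝ (fun y => fderiv ℝ
        (fun z : EuclideanSpace ℝ (Fin d) => A * (ε + ‖z‖ ^ m) ^ q) y
        (EuclideanSpace.single i (1 : ℝ))) x (EuclideanSpace.single i (1 : ℝ)) =
      A * q * m * ‖x‖ ^ (m - 2) * (ε + ‖x‖ ^ m) ^ (q - 2) *
        ((d + m - 2) * (ε + ‖x‖ ^ m) + (q - 1) * m * ‖x‖ ^ m) := by
  have hr : 0 < ‖x‖ := norm_pos_iff.mpr hx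
  have hu : 0 < ε + ‖x‖ ^ m := by positivity
  have hterm : ∀ i : Fin d, fderiv ℝ (fun y => fderiv ℝ
        (fun z : EuclideanSpace ℝ (Fin d) => A * (ε + ‖z‖ ^ m) ^ q) y
        (EuclideanSpace.single i (1 : ℝ))) x (EuclideanSpace.single i (1 : ℝ)) =
      A * q * m * ((ε + ‖x‖ ^ m) ^ (q - 1) * ‖x‖ ^ (m - 2) +
        ((ε + ‖x‖ ^ m) ^ (q - 1) * ((m - 2) * ‖x‖ ^ (m - 2 - 2)) +
          (q - 1) * (ε + ‖x‖ ^ m) ^ (q - 1 - 1) * (m * ‖x‖ ^ (m - 2)) * ‖x‖ ^ (m - 2))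
          * x i ^ 2) := by
    intro i
    have hgrad : (fun y => fderiv ℝ
        (fun z : EuclideanSpace ℝ (Fin d) => A * (ε + ‖z‖ ^ m) ^ q) y
        (EuclideanSpace.single i (1 : ℝ))) =ᶠ[nhds x]
        fun y => A * q * m * ((ε + ‖y‖ ^ m) ^ (q - 1) * ‖y‖ ^ (m - 2) * y i) := by
      filter_upwards [isOpen_ne.mem_nhds hx] with y hy
      rw [((hasFDerivAt_add_norm_rpow_rpow hy hε m q).const_mul A).fderiv]
      simp [EuclideanSpace.inner_single_right]
      ring
    have hcoord : HasFDerivAt (fun y : EuclideanSpace ℝ (Fin d) => y i)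
        (EuclideanSpace.proj i : EuclideanSpace ℝ (Fin d) →L[ℝ] ℝ) x :=
      (EuclideanSpace.proj i : EuclideanSpace ℝ (Fin d) →L[ℝ] ℝ).hasFDerivAt
    rw [hgrad.fderiv_eq, ((((hasFDerivAt_add_norm_rpow_rpow hx hε m (q - 1)).fun_mul
      (hasFDerivAt_norm_rpow_of_ne_zero hx (m - 2))).fun_mul hcoord).const_mul (A * q * m)).fderiv]
    simp [EuclideanSpace.inner_single_right]
    ring
  have hnorm : ∑ i, x i ^ 2 = ‖x‖ ^ 2 := (EuclideanSpace.real_norm_sq_eq x).symm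
  simp only [hterm]
  rw [← Finset.mul_sum, Finset.sum_add_distrib, ← Finset.mul_sum (f := fun i => x i ^ 2), hnorm]
  simp only [Finset.sum_const, Finset.card_univ, Fintype.card_fin, nsmul_eq_mul]
  have h1 : ‖x‖ ^ (m - 2) = ‖x‖ ^ (m - 2 - 2) * ‖x‖ ^ 2 := by
    rw [← Real.rpow_add_natCast hr.ne']; congr 1; push_cast; ring
  have h2 : ‖x‖ ^ m = ‖x‖ ^ (m - 2) * ‖x‖ ^ 2 := by
    rw [← Real.rpow_add_natCast hr.ne']; congr 1; push_cast; ring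
  have h3 : (ε + ‖x‖ ^ m) ^ (q - 1) = (ε + ‖x‖ ^ m) ^ (q - 2) * (ε + ‖x‖ ^ m) := by
    rw [← Real.rpow_add_one hu.ne']; congr 1; ring
  rw [show q - 1 - 1 = q - 2 by ring, h3]
  linear_combination (-(A * q * m * (ε + ‖x‖ ^ m) ^ (q - 2) * (ε + ‖x‖ ^ m) * (m - 2))) * h1 -
    (A * q * m * (ε + ‖x‖ ^ m) ^ (q - 2) * (q - 1) * m * ‖x‖ ^ (m - 2)) * h2

/-- `W_b` solves the energy-critical elliptic equation away from the origin. -/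
theorem stmt_3 (d : ℕ) (hd : 3 ≤ d) (b ε : ℝ) (hb0 : 0 < b) (hb2 : b < 2) (hε : 0 < ε)
    (W : EuclideanSpace ℝ (Fin d) → ℝ)
    (hW : ∀ x, W x = (ε * ((d : ℝ) - b) * ((d : ℝ) - 2)) ^ (((d : ℝ) - 2) / (4 - 2 * b)) /
        (ε + ‖x‖ ^ (2 - b)) ^ (((d : ℝ) - 2) / (2 - b))) :
    ∀ x : EuclideanSpace ℝ (Fin d), x ≠ 0 →
      ContDiffAt ℝ 2 W x ∧
      (∑ i : Fin d, fderiv ℝ (fun y => fderiv ℝ W y (EuclideanSpace.single i (1 : ℝ))) x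
          (EuclideanSpace.single i (1 : ℝ)))
        + ‖x‖ ^ (-b) * W x ^ (((d : ℝ) + 2 - 2 * b) / ((d : ℝ) - 2)) = 0 := by
  intro x hx
  have hr : 0 < ‖x‖ := norm_pos_iff.mpr hx
  have hu : 0 < ε + ‖x‖ ^ (2 - b) := by positivity
  have hd3 : (3 : ℝ) ≤ d := by exact_mod_cast hd
  have hd2 : 0 < (d : ℝ) - 2 := by linarith
  have hdb : 0 < (d : ℝ) - b := by linarith
  have hm : 0 < 2 - b := by linarith
  have hm4 : 0 < 4 - 2 * b := by linarith
  set K : ℝ := ε * ((d : ℝ) - b) * ((d : ℝ) - 2) with hK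
  have hK0 : 0 < K := by positivity
  set p : ℝ := ((d : ℝ) - 2) / (2 - b) with hp
  have hWfun : W = fun y => K ^ (((d : ℝ) - 2) / (4 - 2 * b)) * (ε + ‖y‖ ^ (2 - b)) ^ (-p) := by
    funext y
    rw [hW, Real.rpow_neg (by positivity), div_eq_mul_inv]
  have hpm : p * (2 - b) = d - 2 := div_mul_cancel₀ _ hm.ne'
  have hpower : W x ^ (((d : ℝ) + 2 - 2 * b) / ((d : ℝ) - 2)) =
      K ^ (((d : ℝ) - 2) / (4 - 2 * b)) * K * (ε + ‖x‖ ^ (2 - b)) ^ (-p - 2) := by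
    rw [hWfun, Real.mul_rpow (by positivity) (by positivity), ← Real.rpow_mul hK0.le,
      ← Real.rpow_mul hu.le, ← Real.rpow_add_one hK0.ne']
    congr 2
    · field_simp
      ring
    · rw [hp]
      field_simp
      ring
  refine ⟨?_, ?_⟩
  · rw [hWfun]
    exact contDiffAt_const.mul ((contDiffAt_const.add
      ((contDiffAt_norm ℝ hx).rpow_const_of_ne hr.ne')).rpow_const_of_ne hu.ne')
  · rw [hpower, hWfun, sum_fderiv_fderiv_add_norm_rpow_rpow hx hε,
      show 2 - b - 2 = -b by ring, hK]
    generalize (ε * ((d : ℝ) - b) * ((d : ℝ) - 2)) ^ (((d : ℝ) - 2) / (4 - 2 * b)) = A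
    generalize (ε + ‖x‖ ^ (2 - b)) ^ (-p - 2) = U
    generalize ‖x‖ ^ (2 - b) = R
    generalize ‖x‖ ^ (-b) = S
    rw [← hpm, show (d : ℝ) = p * (2 - b) + 2 by linarith]
    ring
end

section
/- Let d ≥ 3 be a natural number, let b be a real number with 0 < b < 2, let ε > 0, set q = 2(d − b)/(d − 2), and define W_b : ℝ^d → ℝ by W_b(x) = [ε(d−b)(d−2)]^{(d−2)/(4−2b)} / (ε + |x|^{2−b})^{(d−2)/(2−b)}. Then ∫_{ℝ^d} |∇W_b(x)|² dx = ∫_{ℝ^d} |x|^{−b} W_b(x)^{q} dx, and both integrals are finite. -/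
open MeasureTheory

/-- The radial profile `t ^ a / (ε + t ^ s) ^ β` is integrable on the half-line when it is
integrable at `0` and decays faster than `1 / t` at infinity. -/
lemma integrableOn_rpow_div_add_rpow {ε s a β : ℝ} (hε : 0 < ε) (hβ : 0 ≤ β) (ha : -1 < a)
    (haβ : a - s * β < -1) :
    IntegrableOn (fun t : ℝ => t ^ a / (ε + t ^ s) ^ β) (Set.Ioi 0) := by
  have hmeas : Measurable fun t : ℝ => t ^ a / (ε + t ^ s) ^ β := by fun_prop
  rw [← Set.Ioc_union_Ioi_eq_Ioi zero_le_one]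
  refine IntegrableOn.union ?_ ?_
  · have h : IntegrableOn (fun t : ℝ => t ^ a / ε ^ β) (Set.Ioc 0 1) :=
      ((intervalIntegrable_iff_integrableOn_Ioc_of_le zero_le_one).1
        (intervalIntegral.intervalIntegrable_rpow' ha)).div_const _
    refine h.mono' hmeas.aestronglyMeasurable ?_
    filter_upwards [ae_restrict_mem measurableSet_Ioc] with t ht
    have ht0 : 0 < t := ht.1
    rw [Real.norm_of_nonneg (by positivity)]
    gcongr
    linarith [Real.rpow_nonneg ht0.le s]
  · refine (integrableOn_Ioi_rpow_of_lt haβ zero_lt_one).mono' hmeas.aestronglyMeasurable ?_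
    filter_upwards [ae_restrict_mem measurableSet_Ioi] with t ht
    have ht0 : 0 < t := zero_lt_one.trans ht
    rw [Real.norm_of_nonneg (by positivity), Real.rpow_sub ht0, Real.rpow_mul ht0.le]
    gcongr
    linarith

lemma hasDerivAt_add_rpow_rpow {ε s β t : ℝ} (hε : 0 < ε) (ht : 0 < t) :
    HasDerivAt (fun t : ℝ => (ε + t ^ s) ^ β)
      (β * s * t ^ (s - 1) * (ε + t ^ s) ^ (β - 1)) t := by
  have hu : 0 < ε + t ^ s := by positivity
  convert ((Real.hasDerivAt_rpow_const (p := s) (Or.inl ht.ne')).const_add ε).rpow_const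
    (p := β) (Or.inl hu.ne') using 1
  ring

/-- Integrating the derivative of `t ^ (D + s) / (ε + t ^ s) ^ ((2 * D + s) / s)`. -/
lemma integral_rpow_div_add_rpow_eq {ε s D : ℝ} (hε : 0 < ε) (hs : 0 < s) (hD : 0 < D) :
    ε * (D + s) * ∫ t in Set.Ioi (0 : ℝ), t ^ (D + s - 1) / (ε + t ^ s) ^ (2 * D / s + 2) =
      D * ∫ t in Set.Ioi (0 : ℝ), t ^ (D + 2 * s - 1) / (ε + t ^ s) ^ (2 * D / s + 2) := by
  have hβ : s * (2 * D / s + 2) = 2 * D + 2 * s := by field_simp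
  have h1 := integrableOn_rpow_div_add_rpow (s := s) (a := D + s - 1) (β := 2 * D / s + 2) hε
    (by positivity) (by linarith) (by linarith)
  have h2 := integrableOn_rpow_div_add_rpow (s := s) (a := D + 2 * s - 1) (β := 2 * D / s + 2) hε
    (by positivity) (by linarith) (by linarith)
  rw [← sub_eq_zero, ← integral_const_mul, ← integral_const_mul,
    ← integral_sub (h1.const_mul _) (h2.const_mul _)]
  have key := integral_Ioi_of_hasDerivAt_of_tendsto (a := 0) (m := 0)
    (f := fun t : ℝ => t ^ (D + s) * (ε + t ^ s) ^ (-(2 * D / s + 1)))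
    (f' := fun t : ℝ => ε * (D + s) * (t ^ (D + s - 1) / (ε + t ^ s) ^ (2 * D / s + 2)) -
      D * (t ^ (D + 2 * s - 1) / (ε + t ^ s) ^ (2 * D / s + 2))) ?_ ?_
    ((h1.const_mul _).sub (h2.const_mul _)) ?_
  · rw [key, Real.zero_rpow (by positivity)]
    simp
  · refine ContinuousAt.continuousWithinAt (ContinuousAt.mul ?_ (ContinuousAt.rpow_const ?_ ?_))
    · exact Real.continuousAt_rpow_const _ _ (Or.inr (by positivity))
    · exact continuousAt_const.add (Real.continuousAt_rpow_const _ _ (Or.inr hs.le))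
    · left; simp [Real.zero_rpow hs.ne', hε.ne']
  · intro t ht
    have ht0 : 0 < t := ht
    have hu : 0 < ε + t ^ s := by positivity
    refine ((Real.hasDerivAt_rpow_const (p := D + s) (Or.inl ht0.ne')).mul
      (hasDerivAt_add_rpow_rpow (s := s) (β := -(2 * D / s + 1)) hε ht0)).congr_deriv ?_
    have e1 : (ε + t ^ s) ^ (-(2 * D / s + 1)) =
        (ε + t ^ s) * ((ε + t ^ s) ^ (2 * D / s + 2))⁻¹ := by
      rw [← Real.rpow_neg hu.le, ← Real.rpow_one_add' hu.le (by
        have : 0 < 2 * D / s := by positivity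
        linarith)]
      ring_nf
    have e2 : (ε + t ^ s) ^ (-(2 * D / s + 1) - 1) = ((ε + t ^ s) ^ (2 * D / s + 2))⁻¹ := by
      rw [← Real.rpow_neg hu.le]; ring_nf
    have e3 : t ^ (D + 2 * s - 1) = t ^ (D + s - 1) * t ^ s := by
      rw [← Real.rpow_add ht0]; ring_nf
    have e4 : t ^ (D + s) * t ^ (s - 1) = t ^ (D + s - 1) * t ^ s := by
      rw [← Real.rpow_add ht0, ← Real.rpow_add ht0]; ring_nf
    have e5 : (2 * D / s + 1) * s = 2 * D + s := by field_simp
    rw [e1, e2, e3]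
    linear_combination (-(2 * D / s + 1) * s * ((ε + t ^ s) ^ (2 * D / s + 2))⁻¹) * e4 -
      t ^ (D + s - 1) * t ^ s * ((ε + t ^ s) ^ (2 * D / s + 2))⁻¹ * e5
  · refine squeeze_zero' ?_ ?_ (tendsto_rpow_neg_atTop hD)
    · filter_upwards [Filter.eventually_gt_atTop 0] with t ht
      positivity
    · filter_upwards [Filter.eventually_gt_atTop 0] with t ht
      have hm : 0 < 2 * D / s + 1 := by positivity
      have hle : (ε + t ^ s) ^ (-(2 * D / s + 1)) ≤ (t ^ s) ^ (-(2 * D / s + 1)) :=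
        Real.rpow_le_rpow_of_nonpos (by positivity) (by linarith) (by linarith)
      calc _ ≤ t ^ (D + s) * (t ^ s) ^ (-(2 * D / s + 1)) := by gcongr
        _ = t ^ (-D) := by
          rw [← Real.rpow_mul ht.le, ← Real.rpow_add ht]
          congr 1; field_simp; ring

/-- The gradient of a radial function has the size of the derivative of its profile. -/
lemma norm_fderiv_comp_norm {E : Type*} [NormedAddCommGroup E] [InnerProductSpace ℝ E]
    {g : ℝ → ℝ} {g' : ℝ} {x : E} (hx : x ≠ 0) (hg : HasDerivAt g g' ‖x‖) :
    ‖fderiv ℝ (fun y : E => g ‖y‖) x‖ = |g'| := by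
  have hd : DifferentiableAt ℝ (fun y : E => ‖y‖) x := differentiableAt_id.norm ℝ hx
  have : Nontrivial E := ⟨x, 0, hx⟩
  have h := hg.comp_hasFDerivAt x hd.hasFDerivAt
  have h' : fderiv ℝ (fun y : E => g ‖y‖) x = _ := h.fderiv
  rw [h', norm_smul, norm_fderiv_norm hd, mul_one, Real.norm_eq_abs]

/-- The kinetic and potential integrals of `W_b` coincide and are finite. -/
theorem stmt_4 (d : ℕ) (hd : 3 ≤ d) (b ε q : ℝ) (hb0 : 0 < b) (hb2 : b < 2) (hε : 0 < ε)
    (hq : q = 2 * ((d : ℝ) - b) / ((d : ℝ) - 2))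
    (W : EuclideanSpace ℝ (Fin d) → ℝ)
    (hW : ∀ x, W x = (ε * ((d : ℝ) - b) * ((d : ℝ) - 2)) ^ (((d : ℝ) - 2) / (4 - 2 * b)) /
        (ε + ‖x‖ ^ (2 - b)) ^ (((d : ℝ) - 2) / (2 - b))) :
    Integrable (fun x : EuclideanSpace ℝ (Fin d) => ‖fderiv ℝ W x‖ ^ 2) ∧
    Integrable (fun x : EuclideanSpace ℝ (Fin d) => ‖x‖ ^ (-b) * W x ^ q) ∧
    (∫ x : EuclideanSpace ℝ (Fin d), ‖fderiv ℝ W x‖ ^ 2)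
      = ∫ x : EuclideanSpace ℝ (Fin d), ‖x‖ ^ (-b) * W x ^ q := by
  have hd3 : (3 : ℝ) ≤ d := by exact_mod_cast hd
  have : Nonempty (Fin d) := ⟨⟨0, by lia⟩⟩
  obtain ⟨D, hD⟩ : ∃ D : ℝ, D = d - 2 := ⟨_, rfl⟩
  obtain ⟨s, hs⟩ : ∃ s : ℝ, s = 2 - b := ⟨_, rfl⟩
  have hD0 : 0 < D := by linarith
  have hs0 : 0 < s := by linarith
  have hdb : (d : ℝ) - b = D + s := by linarith
  have h2s : 4 - 2 * b = 2 * s := by linarith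
  rw [hdb, ← hD] at hq
  simp_rw [hdb, h2s, ← hD, ← hs] at hW
  have hK : 0 < ε * (D + s) * D := by positivity
  obtain ⟨A, hA⟩ : ∃ A : ℝ, A = (ε * (D + s) * D) ^ (D / (2 * s)) := ⟨_, rfl⟩
  have hA0 : 0 < A := hA ▸ Real.rpow_pos_of_pos hK _
  have hAq : A ^ q = A ^ 2 * (ε * (D + s) * D) := by
    rw [hA, ← Real.rpow_natCast, ← Real.rpow_mul hK.le, ← Real.rpow_mul hK.le,
      ← Real.rpow_add_one hK.ne', hq]
    congr 1; push_cast; field_simp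
  have hmq : D / s * q = 2 * D / s + 2 := by rw [hq]; field_simp
  simp_rw [← hA] at hW
  -- both integrands as radial profiles
  have hkin : (fun x => ‖fderiv ℝ W x‖ ^ 2) =ᵐ[volume] fun x : EuclideanSpace ℝ (Fin d) =>
      A ^ 2 * D ^ 2 * (‖x‖ ^ (2 * s - 2) / (ε + ‖x‖ ^ s) ^ (2 * D / s + 2)) := by
    filter_upwards [compl_mem_ae_iff.2 (measure_singleton 0)] with x hx
    have hr : 0 < ‖x‖ := norm_pos_iff.2 hx
    have hu : 0 < ε + ‖x‖ ^ s := by positivity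
    have hWfun : W = fun y => A * (ε + ‖y‖ ^ s) ^ (-(D / s)) := by
      funext y
      rw [hW, Real.rpow_neg (by positivity), div_eq_mul_inv]
    rw [hWfun, norm_fderiv_comp_norm hx ((hasDerivAt_add_rpow_rpow hε hr).const_mul A), sq_abs]
    have e1 : (‖x‖ ^ (s - 1)) ^ 2 = ‖x‖ ^ (2 * s - 2) := by
      rw [← Real.rpow_mul_natCast hr.le]; push_cast; ring_nf
    have e2 : ((ε + ‖x‖ ^ s) ^ (-(D / s) - 1)) ^ 2 =
        ((ε + ‖x‖ ^ s) ^ (2 * D / s + 2))⁻¹ := by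
      rw [← Real.rpow_mul_natCast hu.le, ← Real.rpow_neg hu.le]; push_cast; ring_nf
    have e3 : D / s * s = D := div_mul_cancel₀ D hs0.ne'
    rw [div_eq_mul_inv (‖x‖ ^ (2 * s - 2)), ← e1, ← e2]
    linear_combination (A * ‖x‖ ^ (s - 1) * (ε + ‖x‖ ^ s) ^ (-(D / s) - 1)) ^ 2 *
      (D / s * s + D) * e3
  have hpot : (fun x => ‖x‖ ^ (-b) * W x ^ q) = fun x : EuclideanSpace ℝ (Fin d) =>
      A ^ 2 * (ε * (D + s) * D) * (‖x‖ ^ (-b) / (ε + ‖x‖ ^ s) ^ (2 * D / s + 2)) := by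
    funext x
    rw [hW, Real.div_rpow hA0.le (by positivity), ← Real.rpow_mul (by positivity), hmq, hAq]
    ring
  have hprofile (a a' : ℝ) (ha : a' = a + D + 1) : Set.EqOn
      (fun t : ℝ => t ^ (d - 1) • (t ^ a / (ε + t ^ s) ^ (2 * D / s + 2)))
      (fun t => t ^ a' / (ε + t ^ s) ^ (2 * D / s + 2)) (Set.Ioi 0) := by
    intro t ht
    have ht0 : 0 < t := ht
    have : t ^ a' = t ^ (d - 1) * t ^ a := by
      rw [← Real.rpow_natCast, ← Real.rpow_add ht0, Nat.cast_sub (by lia), ha, hD]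
      push_cast; ring_nf
    simp only [smul_eq_mul, this, mul_div_assoc]
  have hkp := hprofile (2 * s - 2) (D + 2 * s - 1) (by ring)
  have hpp := hprofile (-b) (D + s - 1) (by linarith)
  have hβ : s * (2 * D / s + 2) = 2 * D + 2 * s := by field_simp
  have hrank : Module.finrank ℝ (EuclideanSpace ℝ (Fin d)) = d := by simp
  refine ⟨?_, ?_, ?_⟩
  · refine Integrable.congr (Integrable.const_mul ?_ _) hkin.symm
    rw [integrable_fun_norm_addHaar volume
      (f := fun t : ℝ => t ^ (2 * s - 2) / (ε + t ^ s) ^ (2 * D / s + 2)), hrank,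
      integrableOn_congr_fun hkp measurableSet_Ioi]
    exact integrableOn_rpow_div_add_rpow hε (by positivity) (by linarith) (by linarith)
  · rw [hpot]
    refine Integrable.const_mul ?_ _
    rw [integrable_fun_norm_addHaar volume
      (f := fun t : ℝ => t ^ (-b) / (ε + t ^ s) ^ (2 * D / s + 2)), hrank,
      integrableOn_congr_fun hpp measurableSet_Ioi]
    exact integrableOn_rpow_div_add_rpow hε (by positivity) (by linarith) (by linarith)
  · rw [integral_congr_ae hkin, hpot, integral_const_mul, integral_const_mul,
      integral_fun_norm_addHaar volume
        (fun t : ℝ => t ^ (2 * s - 2) / (ε + t ^ s) ^ (2 * D / s + 2)),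
      integral_fun_norm_addHaar volume
        (fun t : ℝ => t ^ (-b) / (ε + t ^ s) ^ (2 * D / s + 2)), hrank,
      setIntegral_congr_fun measurableSet_Ioi hkp, setIntegral_congr_fun measurableSet_Ioi hpp]
    simp only [nsmul_eq_mul, smul_eq_mul]
    linear_combination (-(A ^ 2 * D * d *
      volume.real (Metric.ball (0 : EuclideanSpace ℝ (Fin d)) 1))) *
        integral_rpow_div_add_rpow_eq hε hs0 hD0
end

section
/- Let d ∈ ℕ and let a be a real number with 0 < a < min{2, d}. Then there exists a constant C > 0 such that for every Schwartz function u : ℝ^d → ℂ one has ∫_{ℝ^d} |x|^{−a} |u(x)|² dx ≤ C · (∫_{ℝ^d} |∇u(x)|² dx)^{a/2} · (∫_{ℝ^d} |u(x)|² dx)^{(2−a)/2}. -/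
open MeasureTheory

theorem integral_mul_fderiv_self_eq_neg {d : ℕ} {f g : EuclideanSpace ℝ (Fin d) → ℝ}
    (hf : ContDiff ℝ 1 f) (hg : ContDiff ℝ 1 g)
    (hfg : Integrable (fun x ↦ f x * g x)) (hxfg : Integrable (fun x ↦ ‖x‖ * (f x * g x)))
    (hf'g : Integrable (fun x ↦ ‖x‖ * ‖fderiv ℝ f x‖ * g x))
    (hfg' : Integrable (fun x ↦ ‖x‖ * f x * ‖fderiv ℝ g x‖)) :
    ∫ x, f x * fderiv ℝ g x x = -∫ x, (d * f x + fderiv ℝ f x x) * g x := by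
  have hf1 := hf.continuous_fderiv one_ne_zero
  have hg1 := hg.continuous_fderiv one_ne_zero
  have hfc := hf.continuous
  have hgc := hg.continuous
  let e : Fin d → EuclideanSpace ℝ (Fin d) := fun i ↦ EuclideanSpace.single i 1
  have he (i : Fin d) : ‖e i‖ = 1 := by simp [e]
  have hsum (x : EuclideanSpace ℝ (Fin d)) : ∑ i, x i • e i = x := by
    simpa [e] using (EuclideanSpace.basisFun (Fin d) ℝ).sum_repr x
  have hcoord (x : EuclideanSpace ℝ (Fin d)) (i : Fin d) : |x i| ≤ ‖x‖ := by
    simpa using PiLp.norm_apply_le x i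
  have hdir (i : Fin d) (x : EuclideanSpace ℝ (Fin d)) :
      fderiv ℝ (fun y : EuclideanSpace ℝ (Fin d) ↦ y i * f y) x (e i)
        = f x + x i * fderiv ℝ f x (e i) := by
    have h1 : HasFDerivAt (fun y : EuclideanSpace ℝ (Fin d) ↦ y i)
        (EuclideanSpace.proj (𝕜 := ℝ) i : EuclideanSpace ℝ (Fin d) →L[ℝ] ℝ) x :=
      (EuclideanSpace.proj (𝕜 := ℝ) i : EuclideanSpace ℝ (Fin d) →L[ℝ] ℝ).hasFDerivAt
    have h2 := h1.mul (hf.differentiable one_ne_zero x).hasFDerivAt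
    have h3 := h2.fderiv
    rw [show (fun y : EuclideanSpace ℝ (Fin d) ↦ y i * f y) =
      ((fun y : EuclideanSpace ℝ (Fin d) ↦ y i) * f) from rfl, h3]
    simp [e]
    ring
  have hop (L : EuclideanSpace ℝ (Fin d) →L[ℝ] ℝ) (i : Fin d) : |L (e i)| ≤ ‖L‖ := by
    simpa [he] using L.le_opNorm (e i)
  have hA (i : Fin d) : Integrable (fun x : EuclideanSpace ℝ (Fin d) ↦
      (f x + x i * fderiv ℝ f x (e i)) * g x) := by
    have : Integrable (fun x : EuclideanSpace ℝ (Fin d) ↦ x i * fderiv ℝ f x (e i) * g x) := by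
      refine hf'g.mono (by fun_prop) (.of_forall fun x ↦ ?_)
      simp only [norm_mul, Real.norm_eq_abs, abs_norm]
      gcongr
      exacts [hcoord x i, by simpa using hop _ i]
    simp only [add_mul]
    exact hfg.add this
  have hB (i : Fin d) : Integrable (fun x : EuclideanSpace ℝ (Fin d) ↦
      x i * f x * fderiv ℝ g x (e i)) := by
    refine hfg'.mono (by fun_prop) (.of_forall fun x ↦ ?_)
    simp only [norm_mul, Real.norm_eq_abs, abs_norm]
    gcongr
    exacts [hcoord x i, by simpa using hop _ i]
  have hC (i : Fin d) : Integrable (fun x : EuclideanSpace ℝ (Fin d) ↦ x i * f x * g x) := by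
    refine hxfg.mono (by fun_prop) (.of_forall fun x ↦ ?_)
    simp only [norm_mul, Real.norm_eq_abs, abs_norm, mul_assoc]
    gcongr
    exact hcoord x i
  have hparts (i : Fin d) : ∫ x : EuclideanSpace ℝ (Fin d), x i * f x * fderiv ℝ g x (e i)
      = -∫ x : EuclideanSpace ℝ (Fin d), (f x + x i * fderiv ℝ f x (e i)) * g x := by
    have := integral_mul_fderiv_eq_neg_fderiv_mul_of_integrable (μ := volume) (v := e i)
      (f := fun x : EuclideanSpace ℝ (Fin d) ↦ x i * f x) (g := g)
      (by simpa only [hdir] using hA i) (hB i) (hC i)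
      (fun x _ ↦ by
        have := hf.differentiable one_ne_zero x
        fun_prop)
      (fun x _ ↦ hg.differentiable one_ne_zero x)
    simpa only [hdir] using this
  have hexp (L : EuclideanSpace ℝ (Fin d) →L[ℝ] ℝ) (x : EuclideanSpace ℝ (Fin d)) :
      L x = ∑ i, x i * L (e i) := by
    conv_lhs => rw [← hsum x]
    simp
  calc ∫ x, f x * fderiv ℝ g x x
      = ∫ x, ∑ i, x i * f x * fderiv ℝ g x (e i) := by
        congr 1 with x
        rw [hexp (fderiv ℝ g x) x, Finset.mul_sum]
        exact Finset.sum_congr rfl fun i _ ↦ by ring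
    _ = ∑ i, -∫ x : EuclideanSpace ℝ (Fin d), (f x + x i * fderiv ℝ f x (e i)) * g x := by
        rw [integral_finsetSum _ fun i _ ↦ hB i]
        exact Finset.sum_congr rfl fun i _ ↦ hparts i
    _ = -∫ x, (d * f x + fderiv ℝ f x x) * g x := by
        rw [Finset.sum_neg_distrib, ← integral_finsetSum _ fun i _ ↦ hA i]
        congr 2 with x
        rw [hexp (fderiv ℝ f x) x, ← Finset.sum_mul, Finset.sum_add_distrib]
        simp

theorem Real.rpow_le_one_add_self {t p : ℝ} (ht : 0 ≤ t) (hp0 : 0 ≤ p) (hp1 : p ≤ 1) :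
    t ^ p ≤ 1 + t := by
  rcases le_total t 1 with h | h
  · linarith [Real.rpow_le_one ht h hp0]
  · have := Real.rpow_le_rpow_of_exponent_le h hp1
    rw [Real.rpow_one] at this
    linarith

/-- A smooth truncation at scale `b ^ (-1/2)` of the singular weight `s ^ (-a / 2)`, where `s`
stands for the squared distance to the origin. -/
noncomputable def cutoffWeight (a ε b s : ℝ) : ℝ := (s + ε) ^ (-(a / 2)) * (1 + b * s)⁻¹

section cutoffWeight

variable {a ε b s : ℝ}

theorem cutoffWeight_nonneg (hε : 0 < ε) (hb : 0 < b) (hs : 0 ≤ s) :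
    0 ≤ cutoffWeight a ε b s := by
  unfold cutoffWeight
  positivity

theorem cutoffWeight_le (ha : 0 ≤ a) (hε : 0 < ε) (hb : 0 < b) (hs : 0 ≤ s) :
    cutoffWeight a ε b s ≤ ε ^ (-(a / 2)) := by
  unfold cutoffWeight
  have h1 : (s + ε) ^ (-(a / 2)) ≤ ε ^ (-(a / 2)) :=
    Real.rpow_le_rpow_of_nonpos hε (by linarith) (by linarith)
  have h2 : (1 + b * s)⁻¹ ≤ 1 := inv_le_one_of_one_le₀ (by nlinarith)
  calc _ ≤ ε ^ (-(a / 2)) * 1 := by gcongr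
    _ = _ := mul_one _

theorem mul_cutoffWeight_le (ha : 0 ≤ a) (ha2 : a ≤ 2) (hε : 0 < ε) (hb : 0 < b) (hs : 0 ≤ s) :
    b * s * cutoffWeight a ε b s ≤ b ^ (a / 2) := by
  rcases hs.eq_or_lt with rfl | hs
  · simp only [mul_zero, zero_mul]; positivity
  unfold cutoffWeight
  have h1 : (s + ε) ^ (-(a / 2)) ≤ s ^ (-(a / 2)) :=
    Real.rpow_le_rpow_of_nonpos hs (by linarith) (by linarith)
  have h2 : (b * s) ^ (1 - a / 2) ≤ 1 + b * s :=
    Real.rpow_le_one_add_self (by positivity) (by linarith) (by linarith)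
  have h3 : b * s * s ^ (-(a / 2)) = b ^ (a / 2) * (b * s) ^ (1 - a / 2) := by
    rw [Real.mul_rpow hb.le hs.le, ← mul_assoc, ← Real.rpow_add hb, mul_assoc,
      show s * s ^ (-(a / 2)) = s ^ (1 - a / 2) by
        rw [sub_eq_add_neg, Real.rpow_add hs, Real.rpow_one]]
    simp
  calc b * s * ((s + ε) ^ (-(a / 2)) * (1 + b * s)⁻¹)
      ≤ b * s * (s ^ (-(a / 2)) * (1 + b * s)⁻¹) := by gcongr
    _ = b ^ (a / 2) * ((b * s) ^ (1 - a / 2) / (1 + b * s)) := by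
        rw [← mul_assoc, h3, mul_assoc, ← div_eq_mul_inv]
    _ ≤ b ^ (a / 2) * 1 := by
        gcongr
        exact div_le_one_of_le₀ h2 (by positivity)
    _ = _ := mul_one _

theorem rpow_le_cutoffWeight_add (ha : 0 ≤ a) (ha2 : a ≤ 2) (hε : 0 < ε) (hb : 0 < b)
    (hs : 0 ≤ s) :
    (s + ε) ^ (-(a / 2)) ≤ cutoffWeight a ε b s + b ^ (a / 2) := by
  have h : (s + ε) ^ (-(a / 2)) = cutoffWeight a ε b s + b * s * cutoffWeight a ε b s := by
    unfold cutoffWeight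
    field_simp
  rw [h]
  gcongr
  exact mul_cutoffWeight_le ha ha2 hε hb hs

theorem hasDerivAt_cutoffWeight (hε : 0 < ε) (hb : 0 < b) (hs : 0 ≤ s) :
    HasDerivAt (cutoffWeight a ε b)
      (-(a / 2 / (s + ε) + b / (1 + b * s)) * cutoffWeight a ε b s) s := by
  have hsε : 0 < s + ε := by linarith
  have hbs : 0 < 1 + b * s := by positivity
  have h1 := ((hasDerivAt_id s).add_const ε).rpow_const (p := -(a / 2)) (.inl hsε.ne')
  have h2 := (((hasDerivAt_id s).const_mul b).const_add 1).inv hbs.ne'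
  refine (h1.mul h2).congr_deriv ?_
  simp only [id, cutoffWeight, Real.rpow_sub_one hsε.ne', Pi.inv_apply]
  field_simp
  ring

theorem contDiff_cutoffWeight_norm_sq {E : Type*} [NormedAddCommGroup E] [InnerProductSpace ℝ E]
    (hε : 0 < ε) (hb : 0 < b) : ContDiff ℝ 1 (fun x : E ↦ cutoffWeight a ε b (‖x‖ ^ 2)) := by
  unfold cutoffWeight
  refine .mul (.rpow_const_of_ne ?_ fun x ↦ by positivity) (.inv ?_ fun x ↦ by positivity)
  · exact (contDiff_norm_sq ℝ).add contDiff_const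
  · exact contDiff_const.add (contDiff_const.mul (contDiff_norm_sq ℝ))

theorem fderiv_cutoffWeight_norm_sq {E : Type*} [NormedAddCommGroup E] [InnerProductSpace ℝ E]
    (hε : 0 < ε) (hb : 0 < b) (x : E) :
    fderiv ℝ (fun x : E ↦ cutoffWeight a ε b (‖x‖ ^ 2)) x =
      (-(a / (‖x‖ ^ 2 + ε) + 2 * b / (1 + b * ‖x‖ ^ 2)) * cutoffWeight a ε b (‖x‖ ^ 2)) •
        innerSL ℝ x := by
  have h := ((hasDerivAt_cutoffWeight (a := a) hε hb (sq_nonneg ‖x‖)).comp_hasFDerivAt x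
    (hasStrictFDerivAt_norm_sq x).hasFDerivAt).fderiv
  rw [Function.comp_def] at h
  rw [h, ← Nat.cast_smul_eq_nsmul ℝ, smul_smul]
  congr 1
  push_cast
  ring

theorem norm_mul_norm_fderiv_cutoffWeight_le {E : Type*} [NormedAddCommGroup E]
    [InnerProductSpace ℝ E] (ha : 0 ≤ a) (hε : 0 < ε) (hb : 0 < b) (x : E) :
    ‖x‖ * ‖fderiv ℝ (fun x : E ↦ cutoffWeight a ε b (‖x‖ ^ 2)) x‖ ≤
      a * cutoffWeight a ε b (‖x‖ ^ 2) + 2 * (b * ‖x‖ ^ 2 * cutoffWeight a ε b (‖x‖ ^ 2)) := by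
  have hw := cutoffWeight_nonneg (a := a) hε hb (sq_nonneg ‖x‖)
  rw [fderiv_cutoffWeight_norm_sq hε hb, norm_smul, innerSL_apply_norm, norm_mul, norm_neg,
    Real.norm_of_nonneg hw, Real.norm_of_nonneg (by positivity)]
  set w := cutoffWeight a ε b (‖x‖ ^ 2)
  have h1 : a / (‖x‖ ^ 2 + ε) * ‖x‖ ^ 2 ≤ a := by
    rw [div_mul_eq_mul_div, div_le_iff₀ (by positivity)]
    nlinarith
  have h2 : 2 * b / (1 + b * ‖x‖ ^ 2) * ‖x‖ ^ 2 ≤ 2 * b * ‖x‖ ^ 2 := by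
    gcongr
    exact div_le_self (by positivity) (by nlinarith [sq_nonneg ‖x‖])
  calc _ = (a / (‖x‖ ^ 2 + ε) * ‖x‖ ^ 2 + 2 * b / (1 + b * ‖x‖ ^ 2) * ‖x‖ ^ 2) * w := by ring
    _ ≤ (a + 2 * b * ‖x‖ ^ 2) * w := by gcongr
    _ = _ := by ring

end cutoffWeight

theorem integral_rpow_add_mul_norm_sq_le {d : ℕ} {a ε b : ℝ} (ha0 : 0 ≤ a) (ha2 : a ≤ 2)
    (had : a < d) (hε : 0 < ε) (hb : 0 < b) (u : SchwartzMap (EuclideanSpace ℝ (Fin d)) ℂ) :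
    Integrable (fun x ↦ (‖x‖ ^ 2 + ε) ^ (-(a / 2)) * ‖u x‖ ^ 2) ∧
    ∫ x, (‖x‖ ^ 2 + ε) ^ (-(a / 2)) * ‖u x‖ ^ 2 ≤
      (1 + 4 / (d - a) + 4 / (d - a) ^ 2) *
        (b ^ (a / 2) * (∫ x, ‖u x‖ ^ 2) + b ^ (a / 2 - 1) * ∫ x, ‖fderiv ℝ (⇑u) x‖ ^ 2) := by
  set w : EuclideanSpace ℝ (Fin d) → ℝ := fun x ↦ cutoffWeight a ε b (‖x‖ ^ 2)
  have hδ : 0 < d - a := sub_pos.2 had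
  set δ : ℝ := d - a with hδ_def
  set B := ε ^ (-(a / 2))
  set A := b ^ (a / 2)
  have hw0 (x) : 0 ≤ w x := cutoffWeight_nonneg hε hb (sq_nonneg _)
  have hwB (x) : w x ≤ B := cutoffWeight_le ha0 hε hb (sq_nonneg _)
  have hwA (x) : b * ‖x‖ ^ 2 * w x ≤ A := mul_cutoffWeight_le ha0 ha2 hε hb (sq_nonneg _)
  have hwA' (x) : ‖x‖ ^ 2 * w x ≤ b ^ (a / 2 - 1) := by
    rw [Real.rpow_sub_one hb.ne', le_div_iff₀ hb]
    linarith [hwA x]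
  have hw' (x) : ‖x‖ * ‖fderiv ℝ w x‖ ≤ a * w x + 2 * (b * ‖x‖ ^ 2 * w x) :=
    norm_mul_norm_fderiv_cutoffWeight_le ha0 hε hb x
  have hwC : ContDiff ℝ 1 w := contDiff_cutoffWeight_norm_sq hε hb
  have hwc := hwC.continuous
  have hwc' := hwC.continuous_fderiv one_ne_zero
  have huC : ContDiff ℝ 1 u := u.smooth 1
  have huc := huC.continuous
  have huc' := huC.continuous_fderiv one_ne_zero
  have hgC : ContDiff ℝ 1 (fun x ↦ ‖u x‖ ^ 2) := huC.norm_sq ℝ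
  have hgc' := hgC.continuous_fderiv one_ne_zero
  have hM : Integrable (fun x ↦ ‖u x‖ ^ 2) := (u.memLp 2).integrable_norm_pow two_ne_zero
  have hG : Integrable (fun x ↦ ‖fderiv ℝ u x‖ ^ 2) :=
    ((SchwartzMap.fderivCLM ℝ _ _ u).memLp 2 volume).integrable_norm_pow two_ne_zero
  have hwM : Integrable (fun x ↦ w x * ‖u x‖ ^ 2) :=
    hM.bdd_mul (c := B) hwc.aestronglyMeasurable
      (.of_forall fun x ↦ by simpa [abs_of_nonneg (hw0 x)] using hwB x)
  have hwG : Integrable (fun x ↦ ‖x‖ ^ 2 * w x * ‖fderiv ℝ u x‖ ^ 2) :=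
    hG.bdd_mul (c := b ^ (a / 2 - 1)) (by fun_prop)
      (.of_forall fun x ↦ by simpa [abs_of_nonneg (hw0 x)] using hwA' x)
  have hg' (x) : ‖fderiv ℝ (fun x ↦ ‖u x‖ ^ 2) x‖ ≤ 2 * ‖u x‖ * ‖fderiv ℝ u x‖ := by
    rw [(huC.differentiable one_ne_zero x).hasFDerivAt.norm_sq.fderiv,
      ← Nat.cast_smul_eq_nsmul ℝ, norm_smul]
    calc _ ≤ 2 * (‖innerSL ℝ (u x)‖ * ‖fderiv ℝ u x‖) := by
          rw [Nat.cast_ofNat, Real.norm_ofNat]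
          gcongr
          exact ContinuousLinearMap.opNorm_comp_le _ _
      _ = _ := by rw [innerSL_apply_norm]; ring
  have hxw (x) : ‖x‖ * w x * ‖fderiv ℝ (fun x ↦ ‖u x‖ ^ 2) x‖ ≤
      δ / 2 * (w x * ‖u x‖ ^ 2) + 2 / δ * (‖x‖ ^ 2 * w x * ‖fderiv ℝ u x‖ ^ 2) := by
    have hsq : 2 * ‖u x‖ * (‖x‖ * ‖fderiv ℝ u x‖) ≤
        δ / 2 * ‖u x‖ ^ 2 + 2 / δ * (‖x‖ * ‖fderiv ℝ u x‖) ^ 2 := by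
      have : 0 ≤ (δ * ‖u x‖ - 2 * (‖x‖ * ‖fderiv ℝ u x‖)) ^ 2 / (2 * δ) := by positivity
      refine sub_nonneg.1 (this.trans_eq ?_)
      field_simp
      ring
    have hxw0 : 0 ≤ ‖x‖ * w x := mul_nonneg (norm_nonneg x) (hw0 x)
    calc _ ≤ ‖x‖ * w x * (2 * ‖u x‖ * ‖fderiv ℝ u x‖) := by gcongr; exact hg' x
      _ = w x * (2 * ‖u x‖ * (‖x‖ * ‖fderiv ℝ u x‖)) := by ring
      _ ≤ w x * (δ / 2 * ‖u x‖ ^ 2 + 2 / δ * (‖x‖ * ‖fderiv ℝ u x‖) ^ 2) :=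
        mul_le_mul_of_nonneg_left hsq (hw0 x)
      _ = _ := by ring
  have hdom : Integrable (fun x ↦
      δ / 2 * (w x * ‖u x‖ ^ 2) + 2 / δ * (‖x‖ ^ 2 * w x * ‖fderiv ℝ u x‖ ^ 2)) :=
    (hwM.const_mul (δ / 2)).add (hwG.const_mul (2 / δ))
  have hxwg : Integrable (fun x ↦ ‖x‖ * w x * ‖fderiv ℝ (fun x ↦ ‖u x‖ ^ 2) x‖) :=
    hdom.mono' (by fun_prop) (.of_forall fun x ↦ by
      simpa [abs_of_nonneg (hw0 x)] using hxw x)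
  have hdiv (x) : |fderiv ℝ w x x| ≤ a * w x + 2 * A := by
    calc |fderiv ℝ w x x| ≤ ‖x‖ * ‖fderiv ℝ w x‖ := by
          rw [mul_comm]; exact (fderiv ℝ w x).le_opNorm x
      _ ≤ _ := (hw' x).trans (by linarith [hwA x])
  have hint : Integrable (fun x ↦ (d * w x + fderiv ℝ w x x) * ‖u x‖ ^ 2) := by
    refine hM.bdd_mul (c := d * B + (a * B + 2 * A)) (by fun_prop) (.of_forall fun x ↦ ?_)
    refine (norm_add_le _ _).trans (add_le_add ?_ ((hdiv x).trans ?_))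
    · rw [norm_mul, Real.norm_of_nonneg (hw0 x), Real.norm_of_nonneg d.cast_nonneg]
      gcongr
      exact hwB x
    · gcongr
      exact hwB x
  have hparts := integral_mul_fderiv_self_eq_neg hwC hgC hwM
    (by
      simp only [← mul_assoc]
      refine hM.bdd_mul (c := B + b ^ (a / 2 - 1)) (by fun_prop) (.of_forall fun x ↦ ?_)
      rw [norm_mul, norm_norm, Real.norm_of_nonneg (hw0 x)]
      have : ‖x‖ ≤ 1 + ‖x‖ ^ 2 := by nlinarith [sq_nonneg (‖x‖ - 1)]
      calc ‖x‖ * w x ≤ (1 + ‖x‖ ^ 2) * w x := mul_le_mul_of_nonneg_right this (hw0 x)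
        _ ≤ _ := by linarith [hwB x, hwA' x])
    (hM.bdd_mul (c := a * B + 2 * A) (by fun_prop) (.of_forall fun x ↦ by
      rw [norm_mul, norm_norm, norm_norm]
      refine (hw' x).trans ?_
      gcongr
      exacts [hwB x, hwA x]))
    hxwg
  have hlow : δ * (∫ x, w x * ‖u x‖ ^ 2) - 2 * A * ∫ x, ‖u x‖ ^ 2 ≤
      ∫ x, (d * w x + fderiv ℝ w x x) * ‖u x‖ ^ 2 := by
    rw [← integral_const_mul, ← integral_const_mul,
      ← integral_sub (hwM.const_mul _) (hM.const_mul _)]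
    refine integral_mono ((hwM.const_mul _).sub (hM.const_mul _)) hint fun x ↦ ?_
    have h1 : δ * w x - 2 * A ≤ d * w x + fderiv ℝ w x x := by
      rw [hδ_def]
      linarith [neg_le_of_abs_le (hdiv x)]
    calc _ = (δ * w x - 2 * A) * ‖u x‖ ^ 2 := by ring
      _ ≤ _ := mul_le_mul_of_nonneg_right h1 (sq_nonneg _)
  have hup : -∫ x, w x * fderiv ℝ (fun x ↦ ‖u x‖ ^ 2) x x ≤
      δ / 2 * (∫ x, w x * ‖u x‖ ^ 2) +
        2 / δ * ∫ x, ‖x‖ ^ 2 * w x * ‖fderiv ℝ u x‖ ^ 2 := by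
    rw [← integral_const_mul, ← integral_const_mul,
      ← integral_add (hwM.const_mul _) (hwG.const_mul _)]
    refine (neg_le_abs _).trans ?_
    rw [← Real.norm_eq_abs]
    refine norm_integral_le_of_norm_le hdom (.of_forall fun x ↦ ?_)
    refine le_trans ?_ (hxw x)
    rw [norm_mul, Real.norm_of_nonneg (hw0 x), mul_comm ‖x‖, mul_assoc, mul_comm ‖x‖]
    exact mul_le_mul_of_nonneg_left (ContinuousLinearMap.le_opNorm _ _) (hw0 x)
  have hG' : ∫ x, ‖x‖ ^ 2 * w x * ‖fderiv ℝ u x‖ ^ 2 ≤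
      b ^ (a / 2 - 1) * ∫ x, ‖fderiv ℝ u x‖ ^ 2 := by
    rw [← integral_const_mul]
    exact integral_mono hwG (hG.const_mul _) fun x ↦
      mul_le_mul_of_nonneg_right (hwA' x) (sq_nonneg _)
  have hfull (x : EuclideanSpace ℝ (Fin d)) :
      (‖x‖ ^ 2 + ε) ^ (-(a / 2)) * ‖u x‖ ^ 2 ≤ w x * ‖u x‖ ^ 2 + A * ‖u x‖ ^ 2 := by
    rw [← add_mul]
    gcongr
    exact rpow_le_cutoffWeight_add ha0 ha2 hε hb (sq_nonneg _)
  have hdom' := hwM.add (hM.const_mul A)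
  have hI : Integrable (fun x ↦ (‖x‖ ^ 2 + ε) ^ (-(a / 2)) * ‖u x‖ ^ 2) :=
    hdom'.mono' (by
      refine Continuous.aestronglyMeasurable (.mul (.rpow_const (by fun_prop) fun x ↦ .inl ?_)
        (by fun_prop))
      positivity) (.of_forall fun x ↦ by
      rw [Real.norm_of_nonneg (by positivity)]
      exact hfull x)
  refine ⟨hI, ?_⟩
  have hlast : ∫ x, (‖x‖ ^ 2 + ε) ^ (-(a / 2)) * ‖u x‖ ^ 2 ≤
      (∫ x, w x * ‖u x‖ ^ 2) + A * ∫ x, ‖u x‖ ^ 2 := by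
    rw [← integral_const_mul, ← integral_add hwM (hM.const_mul A)]
    exact integral_mono hI hdom' hfull
  have hM0 : 0 ≤ ∫ x, ‖u x‖ ^ 2 := integral_nonneg fun x ↦ sq_nonneg _
  have hG0 : 0 ≤ ∫ x, ‖fderiv ℝ u x‖ ^ 2 := integral_nonneg fun x ↦ sq_nonneg _
  set I := ∫ x, w x * ‖u x‖ ^ 2
  set J := ∫ x, ‖x‖ ^ 2 * w x * ‖fderiv ℝ u x‖ ^ 2
  set M := ∫ x, ‖u x‖ ^ 2
  set G := ∫ x, ‖fderiv ℝ u x‖ ^ 2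
  have hJ : 2 / δ * J ≤ 2 / δ * (b ^ (a / 2 - 1) * G) := by gcongr
  have hmain : δ / 2 * I ≤ 2 * (A * M) + 2 / δ * (b ^ (a / 2 - 1) * G) := by linarith
  have hI' : I ≤ 4 / δ * (A * M) + 4 / δ ^ 2 * (b ^ (a / 2 - 1) * G) := by
    have := mul_le_mul_of_nonneg_left hmain (by positivity : 0 ≤ 2 / δ)
    calc I = 2 / δ * (δ / 2 * I) := by field_simp
      _ ≤ _ := this
      _ = _ := by field_simp; ring
  have hr1 : 0 ≤ 4 / δ ^ 2 * (A * M) := by positivity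
  have hr2 : 0 ≤ (1 + 4 / δ) * (b ^ (a / 2 - 1) * G) := by positivity
  linarith

/-- Letting the regularisation parameter tend to zero by Fatou's lemma. -/
theorem integral_norm_rpow_mul_le_of_forall_pos {E F : Type*} [NormedAddCommGroup E]
    [MeasurableSpace E] [OpensMeasurableSpace E] [NormedAddCommGroup F] {μ : Measure E}
    {u : E → F} (hu : Continuous u) {a K : ℝ} (ha : 0 < a)
    (hint : ∀ ε > 0, Integrable (fun x ↦ (‖x‖ ^ 2 + ε) ^ (-(a / 2)) * ‖u x‖ ^ 2) μ)
    (hle : ∀ ε > 0, ∫ x, (‖x‖ ^ 2 + ε) ^ (-(a / 2)) * ‖u x‖ ^ 2 ∂μ ≤ K) :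
    ∫ x, ‖x‖ ^ (-a) * ‖u x‖ ^ 2 ∂μ ≤ K := by
  have hK : 0 ≤ K := (integral_nonneg fun x ↦ by positivity).trans (hle 1 one_pos)
  have hmeas (ε : ℝ) : Measurable
      (fun x : E ↦ ENNReal.ofReal ((‖x‖ ^ 2 + ε) ^ (-(a / 2)) * ‖u x‖ ^ 2)) := by
    have := hu.norm.measurable
    fun_prop
  have hlim (x : E) : ENNReal.ofReal (‖x‖ ^ (-a) * ‖u x‖ ^ 2) ≤ Filter.liminf
      (fun ε : ℝ ↦ ENNReal.ofReal ((‖x‖ ^ 2 + ε) ^ (-(a / 2)) * ‖u x‖ ^ 2))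
      (nhdsWithin 0 (Set.Ioi 0)) := by
    rcases eq_or_ne x 0 with rfl | hx
    · simp [Real.zero_rpow (neg_ne_zero.2 ha.ne')]
    have hx' : 0 < ‖x‖ := norm_pos_iff.2 hx
    have hpow : ‖x‖ ^ (-a) = (‖x‖ ^ 2 + 0) ^ (-(a / 2)) := by
      rw [add_zero, ← Real.rpow_natCast_mul hx'.le]
      congr 1
      push_cast
      ring
    rw [hpow]
    refine (Filter.Tendsto.liminf_eq (ENNReal.tendsto_ofReal ?_)).ge
    refine Filter.Tendsto.mono_left ?_ nhdsWithin_le_nhds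
    refine ((tendsto_const_nhds.add Filter.tendsto_id).rpow_const (.inl ?_)).mul_const _
    positivity
  rw [integral_eq_lintegral_of_nonneg_ae (.of_forall fun x ↦ by positivity)
    (by
      have := hu.norm.measurable
      exact Measurable.aestronglyMeasurable (by fun_prop))]
  refine ENNReal.toReal_le_of_le_ofReal hK ?_
  calc _ ≤ ∫⁻ x, Filter.liminf
        (fun ε : ℝ ↦ ENNReal.ofReal ((‖x‖ ^ 2 + ε) ^ (-(a / 2)) * ‖u x‖ ^ 2))
        (nhdsWithin 0 (Set.Ioi 0)) ∂μ := lintegral_mono hlim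
    _ ≤ _ := lintegral_liminf_le hmeas
    _ ≤ _ := by
      refine Filter.liminf_le_of_frequently_le' (Filter.Eventually.frequently ?_)
      filter_upwards [self_mem_nhdsWithin] with ε hε
      rw [← ofReal_integral_eq_lintegral_ofReal (hint ε hε) (.of_forall fun x ↦ by
        have : (0 : ℝ) < ε := hε
        positivity)]
      exact ENNReal.ofReal_le_ofReal (hle ε hε)

theorem le_rpow_mul_rpow_of_forall_pos {L K M G p : ℝ} (hK : 0 ≤ K) (hM : 0 ≤ M) (hG : 0 ≤ G)
    (hp0 : 0 ≤ p) (hp1 : p ≤ 1)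
    (h : ∀ b > 0, L ≤ K * (b ^ p * M + b ^ (p - 1) * G)) :
    L ≤ 2 * K * G ^ p * M ^ (1 - p) := by
  have hη (η : ℝ) (hη : 0 < η) : L ≤ 2 * K * (G + η) ^ p * (M + η) ^ (1 - p) := by
    have hM' : 0 < M + η := by linarith
    have hG' : 0 < G + η := by linarith
    have hb : 0 < (G + η) / (M + η) := by positivity
    have h1 : ((G + η) / (M + η)) ^ p * (M + η) = (G + η) ^ p * (M + η) ^ (1 - p) := by
      rw [Real.div_rpow hG'.le hM'.le, Real.rpow_sub hM', Real.rpow_one]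
      ring
    have h2 : ((G + η) / (M + η)) ^ (p - 1) * (G + η) = (G + η) ^ p * (M + η) ^ (1 - p) := by
      rw [Real.rpow_sub_one hb.ne', ← h1]
      field_simp
    calc L ≤ K * (((G + η) / (M + η)) ^ p * M + ((G + η) / (M + η)) ^ (p - 1) * G) := h _ hb
      _ ≤ K * (((G + η) / (M + η)) ^ p * (M + η) +
          ((G + η) / (M + η)) ^ (p - 1) * (G + η)) := by gcongr <;> linarith
      _ = _ := by rw [h1, h2]; ring
  have hlim : Filter.Tendsto (fun η : ℝ ↦ 2 * K * (G + η) ^ p * (M + η) ^ (1 - p))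
      (nhdsWithin 0 (Set.Ioi 0)) (nhds (2 * K * (G + 0) ^ p * (M + 0) ^ (1 - p))) := by
    refine Filter.Tendsto.mono_left (Continuous.tendsto ?_ 0) nhdsWithin_le_nhds
    refine .mul (.mul continuous_const (.rpow_const (by fun_prop) fun _ ↦ .inr hp0))
      (.rpow_const (by fun_prop) fun _ ↦ .inr (by linarith))
  simp only [add_zero] at hlim
  exact ge_of_tendsto hlim (by filter_upwards [self_mem_nhdsWithin] with η h using hη η h)

/-- Hardy-type interpolation inequality. -/
theorem stmt_8 (d : ℕ) (a : ℝ) (ha0 : 0 < a) (ha2 : a < 2) (had : a < (d : ℝ)) :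
    ∃ C : ℝ, 0 < C ∧ ∀ u : SchwartzMap (EuclideanSpace ℝ (Fin d)) ℂ,
      (∫ x : EuclideanSpace ℝ (Fin d), ‖x‖ ^ (-a) * ‖u x‖ ^ 2)
        ≤ C * (∫ x : EuclideanSpace ℝ (Fin d), ‖fderiv ℝ (⇑u) x‖ ^ 2) ^ (a / 2)
            * (∫ x : EuclideanSpace ℝ (Fin d), ‖u x‖ ^ 2) ^ ((2 - a) / 2) := by
  have hδ : 0 < d - a := sub_pos.2 had
  refine ⟨2 * (1 + 4 / (d - a) + 4 / (d - a) ^ 2), by positivity, fun u ↦ ?_⟩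
  rw [show (2 - a) / 2 = 1 - a / 2 by ring]
  refine le_rpow_mul_rpow_of_forall_pos (by positivity) (integral_nonneg fun x ↦ sq_nonneg _)
    (integral_nonneg fun x ↦ sq_nonneg _) (by positivity) (by linarith) fun b hb ↦ ?_
  exact integral_norm_rpow_mul_le_of_forall_pos u.continuous ha0
    (fun ε hε ↦ (integral_rpow_add_mul_norm_sq_le ha0.le ha2.le had hε hb u).1)
    fun ε hε ↦ (integral_rpow_add_mul_norm_sq_le ha0.le ha2.le had hε hb u).2
end
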